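/- Let N ≥ 2, 0 < R₀ < R₁, p ∈ (1,∞) and s ∈ (0, R₁ − R₀). Let u be a first eigenfunction of the p-Laplacian on Ω_s, and suppose the function t ↦ λ₁(p, Ω_t) is differentiable at s with derivative 0. Then there exist r₁ ∈ (R₀ + s, R₁) and a function g : ℝ → ℝ such that u(x) = g(‖x‖) for every x with r₁ < ‖x‖ < R₁, and moreover ∇u(x) = 0 for every x with ‖x‖ = r₁. -/

import Mathlib

open MeasureTheory Metric Set Filter
open scoped RealInnerProductSpace ENNReal Topology

/-- The first Dirichlet eigenvalue of the p-Laplacian on `Ω`, defined variationally as the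
infimum of Rayleigh quotients of smooth, not identically zero functions with compact
support contained in `Ω`. -/
noncomputable def lam1 {N : ℕ} (p : ℝ) (Ω : Set (EuclideanSpace ℝ (Fin N))) : ℝ :=
  sInf { r : ℝ | ∃ u : EuclideanSpace ℝ (Fin N) → ℝ,
    ContDiff ℝ (⊤ : ℕ∞) u ∧ u ≠ 0 ∧ HasCompactSupport u ∧ tsupport u ⊆ Ω ∧
    r = (∫ x in Ω, ‖gradient u x‖ ^ p) / (∫ x in Ω, |u x| ^ p) }

/-- The first standard basis vector `e₁` of `ℝ^N`. -/
noncomputable def e1 (N : ℕ) : EuclideanSpace ℝ (Fin N) :=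
  (WithLp.equiv 2 (Fin N → ℝ)).symm (fun i => if (i : ℕ) = 0 then 1 else 0)

/-- The eccentric annulus `Ω_s = B_{R₁}(0) \ closure (B_{R₀}(s e₁))`. -/
noncomputable def Om (N : ℕ) (R₀ R₁ s : ℝ) : Set (EuclideanSpace ℝ (Fin N)) :=
  ball 0 R₁ \ closure (ball (s • e1 N) R₀)

/-- `u` is a first eigenfunction of the p-Laplacian on `Ω` with eigenvalue `lam`:
C¹ on an open set containing the closure of `Ω`, positive in `Ω`, zero on `∂Ω`, and a weak
solution of `−Δ_p u = lam · u^{p−1}`. -/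
def IsFirstEigenfunction {N : ℕ} (p : ℝ) (Ω : Set (EuclideanSpace ℝ (Fin N)))
    (lam : ℝ) (u : EuclideanSpace ℝ (Fin N) → ℝ) : Prop :=
  (∃ V : Set (EuclideanSpace ℝ (Fin N)), IsOpen V ∧ closure Ω ⊆ V ∧ ContDiffOn ℝ 1 u V) ∧
  (∀ x ∈ Ω, 0 < u x) ∧
  (∀ x ∈ frontier Ω, u x = 0) ∧
  (∀ φ : EuclideanSpace ℝ (Fin N) → ℝ, ContDiff ℝ (⊤ : ℕ∞) φ → HasCompactSupport φ →
    tsupport φ ⊆ Ω →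
    ∫ x in Ω, ‖gradient u x‖ ^ (p - 2) * ⟪gradient u x, gradient φ x⟫ =
      lam * ∫ x in Ω, (u x) ^ (p - 1) * φ x)

section PA
variable {E : Type*} [NormedAddCommGroup E] [InnerProductSpace ℝ E]

/-- the nonlinear field `|ξ|^{p-2} ξ`. -/
noncomputable def pa (p : ℝ) (ξ : E) : E := ‖ξ‖ ^ (p - 2) • ξ

theorem norm_pa {p : ℝ} (hp : 1 < p) (ξ : E) : ‖pa p ξ‖ = ‖ξ‖ ^ (p - 1) := by
  rcases eq_or_ne ξ 0 with rfl | h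
  · simp [pa, Real.zero_rpow (by linarith : p - 1 ≠ 0)]
  · have h0 : 0 < ‖ξ‖ := norm_pos_iff.mpr h
    rw [pa, norm_smul, Real.norm_of_nonneg (by positivity)]
    nth_rewrite 2 [← Real.rpow_one ‖ξ‖]
    rw [← Real.rpow_add h0]; ring_nf

theorem inner_pa_self {p : ℝ} (hp : 1 < p) (ξ : E) : ⟪pa p ξ, ξ⟫ = ‖ξ‖ ^ p := by
  rcases eq_or_ne ξ 0 with rfl | h
  · simp [pa, Real.zero_rpow (by linarith : p ≠ 0)]
  · have h0 : 0 < ‖ξ‖ := norm_pos_iff.mpr h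
    rw [pa, real_inner_smul_left, real_inner_self_eq_norm_sq, ← Real.rpow_natCast,
      ← Real.rpow_add h0]
    norm_num

theorem continuous_pa {p : ℝ} (hp : 1 < p) : Continuous (pa p : E → E) := by
  rw [continuous_iff_continuousAt]
  intro x
  rcases eq_or_ne x 0 with rfl | h
  · have : pa p (0 : E) = 0 := by simp [pa]
    rw [ContinuousAt, this, tendsto_zero_iff_norm_tendsto_zero]
    simp_rw [norm_pa hp]
    have : Tendsto (fun x : E => ‖x‖ ^ (p - 1)) (𝓝 0) (𝓝 (‖(0 : E)‖ ^ (p - 1))) :=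
      (continuous_norm.rpow_const (fun _ => Or.inr (by linarith))).tendsto _
    simpa [Real.zero_rpow (by linarith : p - 1 ≠ 0)] using this
  · have h0 : ‖x‖ ≠ 0 := norm_ne_zero_iff.mpr h
    exact (continuousAt_id.norm.rpow_const (Or.inl h0)).smul continuousAt_id

theorem pa_smul {p : ℝ} (hp : 1 < p) {t : ℝ} (ht : 0 < t) (ξ : E) :
    pa p (t • ξ) = t ^ (p - 1) • pa p ξ := by
  rw [pa, pa, norm_smul, Real.norm_of_nonneg ht.le, Real.mul_rpow ht.le (norm_nonneg _), smul_smul,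
    smul_smul]
  congr 1
  have : t ^ (p - 1) = t ^ (p - 2) * t := by
    nth_rewrite 3 [← Real.rpow_one t]
    rw [← Real.rpow_add ht]; ring_nf
  rw [this]; ring

theorem pa_isometry {p : ℝ} (σ : E ≃ₗᵢ[ℝ] E) (ξ : E) : pa p (σ ξ) = σ (pa p ξ) := by
  simp [pa]

theorem pow_young {q : ℝ} (hq : 1 < q) {x y τ : ℝ} (hx : 0 ≤ x) (hy : 0 ≤ y) (hτ : 0 < τ) :
    x ^ (q - 1) * y ≤ τ * x ^ q + τ ^ (1 - q) * y ^ q := by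
  have e1 : ∀ z : ℝ, 0 ≤ z → z ^ q = z ^ (q - 1) * z := by
    intro z hz
    rw [← Real.rpow_add_one' hz (by linarith)]; ring_nf
  rcases le_total y (τ * x) with h | h
  · have : x ^ (q - 1) * y ≤ x ^ (q - 1) * (τ * x) := by gcongr
    have h2 : 0 ≤ τ ^ (1 - q) * y ^ q := by positivity
    rw [e1 x hx]; nlinarith
  · have hx' : x ≤ y / τ := by rw [le_div_iff₀ hτ]; linarith
    have : x ^ (q - 1) * y ≤ (y / τ) ^ (q - 1) * y := by
      gcongr
    have h3 : (y / τ) ^ (q - 1) * y = τ ^ (1 - q) * y ^ q := by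
      rw [Real.div_rpow hy hτ.le, e1 y hy, show (1 - q) = -(q - 1) by ring, Real.rpow_neg hτ.le]
      field_simp
    have h2 : 0 ≤ τ * x ^ q := by positivity
    linarith

theorem picone_ineq {p : ℝ} (hp : 1 < p) (U V : E) :
    p * ⟪pa p V, U⟫ ≤ (p - 1) * ‖V‖ ^ p + ‖U‖ ^ p := by
  have h1 : ⟪pa p V, U⟫ ≤ ‖V‖ ^ (p - 1) * ‖U‖ := by
    rw [← norm_pa hp]; exact real_inner_le_norm _ _
  have hpq : (p / (p - 1)).HolderConjugate p :=
    (Real.HolderConjugate.conjExponent hp).symm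
  have h2 := Real.young_inequality_of_nonneg (a := ‖V‖ ^ (p - 1)) (b := ‖U‖)
    (by positivity) (norm_nonneg _) hpq
  rw [← Real.rpow_mul (norm_nonneg _)] at h2
  have hp1 : p - 1 ≠ 0 := by linarith
  rw [show (p - 1) * (p / (p - 1)) = p by field_simp] at h2
  have h3 : ‖V‖ ^ p / (p / (p - 1)) + ‖U‖ ^ p / p = ((p - 1) * ‖V‖ ^ p + ‖U‖ ^ p) / p := by
    field_simp
  rw [h3, le_div_iff₀ (by linarith)] at h2
  nlinarith

theorem pa_mono_formula {p : ℝ} (hp : 1 < p) (U V : E) :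
    ⟪pa p U - pa p V, U - V⟫ = (‖U‖ ^ (p - 1) - ‖V‖ ^ (p - 1)) * (‖U‖ - ‖V‖)
      + (‖U‖ ^ (p - 2) + ‖V‖ ^ (p - 2)) * (‖U‖ * ‖V‖ - ⟪U, V⟫) := by
  have e1 : ∀ z : E, ‖z‖ ^ (p - 1) * ‖z‖ = ‖z‖ ^ p := fun z => by
    rw [← Real.rpow_add_one' (norm_nonneg _) (by linarith)]; ring_nf
  have e2 : ∀ z : E, ‖z‖ ^ (p - 2) * ‖z‖ = ‖z‖ ^ (p - 1) := fun z => by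
    rw [← norm_pa hp, pa, norm_smul, Real.norm_of_nonneg (by positivity)]
  rw [inner_sub_left, inner_sub_right, inner_sub_right, inner_pa_self hp, inner_pa_self hp,
    pa, pa, real_inner_smul_left, real_inner_smul_left, real_inner_comm U V]
  rw [← e1 U, ← e1 V, ← e2 U, ← e2 V]
  ring

theorem rpow_sub_mul_nonneg {p : ℝ} (hp : 1 < p) {x y : ℝ} (hx : 0 ≤ x) (hy : 0 ≤ y) :
    0 ≤ (x ^ (p - 1) - y ^ (p - 1)) * (x - y) := by
  rcases le_total x y with h | h
  · have := Real.rpow_le_rpow hx h (by linarith : 0 ≤ p - 1)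
    nlinarith
  · have := Real.rpow_le_rpow hy h (by linarith : 0 ≤ p - 1)
    nlinarith

theorem pa_mono {p : ℝ} (hp : 1 < p) (U V : E) : 0 ≤ ⟪pa p U - pa p V, U - V⟫ := by
  rw [pa_mono_formula hp]
  have := real_inner_le_norm U V
  have h1 := rpow_sub_mul_nonneg hp (norm_nonneg U) (norm_nonneg V)
  have h2 : 0 ≤ (‖U‖ ^ (p - 2) + ‖V‖ ^ (p - 2)) * (‖U‖ * ‖V‖ - ⟪U, V⟫) :=
    mul_nonneg (by positivity) (by linarith)
  linarith

theorem norm_sub_sq_formula (U V : E) :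
    ‖U - V‖ ^ 2 = (‖U‖ - ‖V‖) ^ 2 + 2 * (‖U‖ * ‖V‖ - ⟪U, V⟫) := by
  rw [norm_sub_sq_real]; ring

theorem pa_mono_eq {p : ℝ} (hp : 1 < p) {U V : E} (h : ⟪pa p U - pa p V, U - V⟫ = 0) :
    U = V := by
  rw [pa_mono_formula hp] at h
  have h0 := real_inner_le_norm U V
  have h1 := rpow_sub_mul_nonneg hp (norm_nonneg U) (norm_nonneg V)
  have h2 : 0 ≤ (‖U‖ ^ (p - 2) + ‖V‖ ^ (p - 2)) * (‖U‖ * ‖V‖ - ⟪U, V⟫) :=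
    mul_nonneg (by positivity) (by linarith)
  have h3 : (‖U‖ ^ (p - 1) - ‖V‖ ^ (p - 1)) * (‖U‖ - ‖V‖) = 0 := by linarith
  have h4 : (‖U‖ ^ (p - 2) + ‖V‖ ^ (p - 2)) * (‖U‖ * ‖V‖ - ⟪U, V⟫) = 0 := by linarith
  have h5 : ‖U‖ = ‖V‖ := by
    rcases mul_eq_zero.mp h3 with h | h
    · exact (Real.rpow_left_inj (norm_nonneg _) (norm_nonneg _)
        (by linarith : p - 1 ≠ 0)).mp (by linarith)
    · linarith
  rcases eq_or_ne U 0 with rfl | hU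
  · rw [norm_zero] at h5
    exact (norm_eq_zero.mp h5.symm).symm
  have hU0 : 0 < ‖U‖ := norm_pos_iff.mpr hU
  have h6 : ‖U‖ * ‖V‖ - ⟪U, V⟫ = 0 := by
    rcases mul_eq_zero.mp h4 with h | h
    · have : 0 < ‖U‖ ^ (p - 2) := Real.rpow_pos_of_pos hU0 _
      have : 0 ≤ ‖V‖ ^ (p - 2) := by positivity
      linarith
    · exact h
  have h7 := norm_sub_sq_formula U V
  rw [h6, h5] at h7
  have : ‖U - V‖ = 0 := by nlinarith
  exact sub_eq_zero.mp (norm_eq_zero.mp this)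

/-- scalar two-sided bounds for powers on compact intervals of `(0,∞)`. -/
theorem rpow_lip (r : ℝ) {α β : ℝ} (hα : 0 < α) :
    ∃ M : ℝ, 0 ≤ M ∧ ∀ x y : ℝ, x ∈ Icc α β → y ∈ Icc α β → |x ^ r - y ^ r| ≤ M * |x - y| := by
  have hc : ContinuousOn (fun x : ℝ => r * x ^ (r - 1)) (Icc α β) := by
    apply ContinuousOn.mul continuousOn_const
    apply continuousOn_id.rpow_const
    intro x hx; left; exact (lt_of_lt_of_le hα hx.1).ne'
  obtain ⟨M, hM⟩ := isCompact_Icc.exists_bound_of_continuousOn hc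
  refine ⟨max M 0, le_max_right _ _, fun x y hx hy => ?_⟩
  have := (convex_Icc α β).norm_image_sub_le_of_norm_hasDerivWithin_le (f := fun x : ℝ => x ^ r)
    (f' := fun x : ℝ => r * x ^ (r - 1)) (C := max M 0) (x := y) (y := x)
    (fun z hz => (Real.hasDerivAt_rpow_const (Or.inl (lt_of_lt_of_le hα hz.1).ne')).hasDerivWithinAt)
    (fun z hz => (hM z hz).trans (le_max_left _ _)) hy hx
  simpa using this

theorem rpow_lower {p : ℝ} (hp : 1 < p) {α β : ℝ} (hα : 0 < α) :
    ∃ m : ℝ, 0 < m ∧ ∀ x y : ℝ, x ∈ Icc α β → y ∈ Icc α β →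
      m * (x - y) ^ 2 ≤ (x ^ (p - 1) - y ^ (p - 1)) * (x - y) := by
  rcases lt_or_ge β α with hβ | hβ
  · exact ⟨1, one_pos, fun x y hx => absurd (hx.1.trans hx.2) (by linarith)⟩
  have hc : ContinuousOn (fun x : ℝ => (p - 1) * x ^ (p - 1 - 1)) (Icc α β) := by
    apply ContinuousOn.mul continuousOn_const
    apply continuousOn_id.rpow_const
    intro x hx; left; exact (lt_of_lt_of_le hα hx.1).ne'
  obtain ⟨x0, hx0, hmin⟩ := isCompact_Icc.exists_isMinOn ⟨α, by simp [hβ]⟩ hc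
  have hx0' : 0 < x0 := lt_of_lt_of_le hα hx0.1
  refine ⟨(p - 1) * x0 ^ (p - 1 - 1), mul_pos (by linarith) (Real.rpow_pos_of_pos hx0' _), ?_⟩
  have key : ∀ x y : ℝ, x ∈ Icc α β → y ∈ Icc α β → x ≤ y →
      (p - 1) * x0 ^ (p - 1 - 1) * (y - x) ≤ y ^ (p - 1) - x ^ (p - 1) := by
    intro x y hx hy hxy
    rcases hxy.eq_or_lt with rfl | hlt
    · simp
    obtain ⟨c, hc, hce⟩ := exists_hasDerivAt_eq_slope (fun x : ℝ => x ^ (p - 1))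
      (fun x : ℝ => (p - 1) * x ^ (p - 1 - 1)) hlt
      (by
        apply continuousOn_id.rpow_const
        intro z hz; left; exact (lt_of_lt_of_le hα (hx.1.trans hz.1)).ne')
      (fun z hz => Real.hasDerivAt_rpow_const (Or.inl (lt_of_lt_of_le hα (hx.1.trans hz.1.le)).ne'))
    have := hmin (show c ∈ Icc α β from ⟨hx.1.trans hc.1.le, hc.2.le.trans hy.2⟩)
    simp only [Set.mem_ofPred_eq] at this
    rw [hce, le_div_iff₀ (by linarith)] at this
    exact this
  intro x y hx hy
  rcases le_total x y with h | h
  · have := key x y hx hy h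
    nlinarith
  · have := key y x hy hx h
    nlinarith

theorem pa_strong {p : ℝ} (hp : 1 < p) {α β : ℝ} (hα : 0 < α) :
    ∃ m M : ℝ, 0 < m ∧ 0 ≤ M ∧ ∀ U V : E, ‖U‖ ∈ Icc α β → ‖V‖ ∈ Icc α β →
      m * ‖U - V‖ ^ 2 ≤ ⟪pa p U - pa p V, U - V⟫ ∧ ‖pa p U - pa p V‖ ≤ M * ‖U - V‖ := by
  obtain ⟨m1, hm1, hm⟩ := rpow_lower hp (β := β) hα
  obtain ⟨M1, hM1, hM⟩ := rpow_lip (p - 2) (β := β) hα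
  have hc : ContinuousOn (fun x : ℝ => x ^ (p - 2)) (Icc α β) := by
    apply continuousOn_id.rpow_const
    intro x hx; left; exact (lt_of_lt_of_le hα hx.1).ne'
  obtain ⟨K, hK⟩ := isCompact_Icc.exists_bound_of_continuousOn hc
  rcases lt_or_ge β α with hβ | hβ
  · exact ⟨1, 1, one_pos, zero_le_one, fun U V hx => absurd (hx.1.trans hx.2) (by linarith)⟩
  obtain ⟨x0, hx0, hmin⟩ := isCompact_Icc.exists_isMinOn ⟨α, by simp [hβ]⟩ hc
  have hx0' : 0 < x0 ^ (p - 2) := Real.rpow_pos_of_pos (lt_of_lt_of_le hα hx0.1) _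
  have hK0 : 0 ≤ K := (norm_nonneg _).trans (hK x0 hx0)
  refine ⟨min m1 (x0 ^ (p - 2)), K + β * M1, lt_min hm1 hx0', by
    have : 0 ≤ β := by linarith
    positivity, fun U V hU hV => ⟨?_, ?_⟩⟩
  · rw [pa_mono_formula hp, norm_sub_sq_formula]
    have h1 := hm _ _ hU hV
    have h2 : x0 ^ (p - 2) ≤ ‖U‖ ^ (p - 2) := hmin hU
    have h3 : x0 ^ (p - 2) ≤ ‖V‖ ^ (p - 2) := hmin hV
    have h4 := real_inner_le_norm U V
    have h5 : min m1 (x0 ^ (p - 2)) * (‖U‖ - ‖V‖) ^ 2 ≤ m1 * (‖U‖ - ‖V‖) ^ 2 := by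
      gcongr; exact min_le_left _ _
    have h6 : min m1 (x0 ^ (p - 2)) * (2 * (‖U‖ * ‖V‖ - ⟪U, V⟫))
        ≤ x0 ^ (p - 2) * (2 * (‖U‖ * ‖V‖ - ⟪U, V⟫)) :=
      mul_le_mul_of_nonneg_right (min_le_right _ _) (by linarith)
    nlinarith
  · have e : pa p U - pa p V = ‖U‖ ^ (p - 2) • (U - V) + (‖U‖ ^ (p - 2) - ‖V‖ ^ (p - 2)) • V := by
      simp only [pa]; module
    rw [e]
    refine (norm_add_le _ _).trans ?_
    rw [norm_smul, norm_smul]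
    have h1 := hK _ hU
    have h2 := hM _ _ hU hV
    have h3 : |‖U‖ - ‖V‖| ≤ ‖U - V‖ := abs_norm_sub_norm_le U V
    rw [Real.norm_eq_abs (_ - _)]
    calc _ ≤ K * ‖U - V‖ + (M1 * ‖U - V‖) * β := by
          gcongr
          · exact h2.trans (by gcongr)
          · exact hV.2
      _ = _ := by ring
end PA

/-! ## Gradient calculus -/
section gradcalc
variable {E : Type*} [NormedAddCommGroup E] [InnerProductSpace ℝ E] [CompleteSpace E]

theorem hga_of_fderiv {f : E → ℝ} {f' x : E} {L : E →L[ℝ] ℝ} (h : HasFDerivAt f L x)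
    (hL : ∀ y, L y = ⟪f', y⟫) : HasGradientAt f f' x := by
  rw [hasGradientAt_iff_hasFDerivAt]
  have : (InnerProductSpace.toDual ℝ E) f' = L := by
    ext y; rw [InnerProductSpace.toDual_apply_apply, hL]
  rw [this]; exact h

theorem hga_mul {f g : E → ℝ} {f' g' x : E} (hf : HasGradientAt f f' x) (hg : HasGradientAt g g' x) :
    HasGradientAt (fun y => f y * g y) (f x • g' + g x • f') x := by
  refine hga_of_fderiv (hf.hasFDerivAt.mul hg.hasFDerivAt) fun y => ?_
  simp [inner_add_left, real_inner_smul_left]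

theorem hga_add {f g : E → ℝ} {f' g' x : E} (hf : HasGradientAt f f' x) (hg : HasGradientAt g g' x) :
    HasGradientAt (fun y => f y + g y) (f' + g') x := by
  refine hga_of_fderiv (hf.hasFDerivAt.add hg.hasFDerivAt) fun y => ?_
  simp [inner_add_left]

theorem hga_sub {f g : E → ℝ} {f' g' x : E} (hf : HasGradientAt f f' x) (hg : HasGradientAt g g' x) :
    HasGradientAt (fun y => f y - g y) (f' - g') x := by
  refine hga_of_fderiv (hf.hasFDerivAt.sub hg.hasFDerivAt) fun y => ?_
  simp [inner_sub_left]

theorem hga_const_mul {f : E → ℝ} {f' x : E} (c : ℝ) (hf : HasGradientAt f f' x) :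
    HasGradientAt (fun y => c * f y) (c • f') x := by
  refine hga_of_fderiv (hf.hasFDerivAt.const_mul c) fun y => ?_
  simp [real_inner_smul_left]

theorem hga_add_const {f : E → ℝ} {f' x : E} (c : ℝ) (hf : HasGradientAt f f' x) :
    HasGradientAt (fun y => f y + c) f' x := by
  refine hga_of_fderiv (hf.hasFDerivAt.add_const c) fun y => ?_
  simp

theorem hga_comp {F : ℝ → ℝ} {F' : ℝ} {f : E → ℝ} {f' x : E} (hF : HasDerivAt F F' (f x))
    (hf : HasGradientAt f f' x) : HasGradientAt (fun y => F (f y)) (F' • f') x := by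
  refine hga_of_fderiv (hF.comp_hasFDerivAt x hf.hasFDerivAt) fun y => ?_
  simp [real_inner_smul_left]

theorem hga_inner (a x : E) : HasGradientAt (fun y => ⟪a, y⟫) a x :=
  hga_of_fderiv (innerSL ℝ a).hasFDerivAt fun y => by simp

theorem hga_norm {x : E} (hx : x ≠ 0) : HasGradientAt (fun y : E => ‖y‖) (‖x‖⁻¹ • x) x := by
  have h1 : HasGradientAt (fun y : E => ‖y‖ ^ 2) ((2 : ℝ) • x) x := by
    refine hga_of_fderiv (hasStrictFDerivAt_norm_sq x).hasFDerivAt fun y => ?_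
    simp [real_inner_smul_left]
  have hx' : 0 < ‖x‖ := norm_pos_iff.mpr hx
  have h2 := hga_comp (f := fun y : E => ‖y‖ ^ 2) (F := fun t => √t) (Real.hasDerivAt_sqrt (by positivity : ‖x‖ ^ 2 ≠ 0)) h1
  have h3 : (fun y : E => √(‖y‖ ^ 2)) = fun y => ‖y‖ := by ext y; simp
  rw [h3] at h2
  rw [Real.sqrt_sq hx'.le, smul_smul] at h2
  have : 1 / (2 * ‖x‖) * 2 = ‖x‖⁻¹ := by field_simp
  rwa [this] at h2

theorem hga_isometry (σ : E ≃ₗᵢ[ℝ] E) {f : E → ℝ} {f' x : E} (hf : HasGradientAt f f' (σ x)) :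
    HasGradientAt (fun y => f (σ y)) (σ.symm f') x := by
  have h2 : HasFDerivAt (fun y => σ y) (σ.toContinuousLinearEquiv : E →L[ℝ] E) x :=
    σ.toContinuousLinearEquiv.hasFDerivAt
  refine hga_of_fderiv (hf.hasFDerivAt.comp x h2) fun y => ?_
  simp [LinearIsometryEquiv.inner_map_eq_flip]

theorem ContDiffOn.hga {f : E → ℝ} {D : Set E} (hf : ContDiffOn ℝ 1 f D) (hD : IsOpen D) {x : E}
    (hx : x ∈ D) : HasGradientAt f (gradient f x) x :=
  ((hf.differentiableOn one_ne_zero).differentiableAt (hD.mem_nhds hx)).hasGradientAt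

theorem ContDiffOn.cont_grad {f : E → ℝ} {D : Set E} (hf : ContDiffOn ℝ 1 f D) (hD : IsOpen D) :
    ContinuousOn (gradient f) D := by
  have := hf.continuousOn_fderiv_of_isOpen hD le_rfl
  exact (InnerProductSpace.toDual ℝ E).symm.continuous.comp_continuousOn this

theorem ContDiff.cont_grad {f : E → ℝ} (hf : ContDiff ℝ 1 f) : Continuous (gradient f) := by
  have := hf.continuous_fderiv one_ne_zero
  exact (InnerProductSpace.toDual ℝ E).symm.continuous.comp this

theorem hasDerivAt_posq {q : ℝ} (hq : 1 < q) (t : ℝ) :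
    HasDerivAt (fun t : ℝ => (max t 0) ^ q) (q * (max t 0) ^ (q - 1)) t := by
  rcases lt_trichotomy t 0 with h | h | h
  · rw [max_eq_right h.le, Real.zero_rpow (by linarith), mul_zero]
    apply (hasDerivAt_const t (0 : ℝ)).congr_of_eventuallyEq
    filter_upwards [Iio_mem_nhds h] with y hy
    rw [max_eq_right (le_of_lt hy), Real.zero_rpow (by linarith)]
  · subst h
    have key : ∀ y ≠ (0 : ℝ), HasDerivAt (fun t : ℝ => (max t 0) ^ q) (q * (max y 0) ^ (q - 1)) y := by
      intro y hy
      rcases lt_or_gt_of_ne hy with h | h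
      · rw [max_eq_right h.le, Real.zero_rpow (by linarith), mul_zero]
        apply (hasDerivAt_const y (0 : ℝ)).congr_of_eventuallyEq
        filter_upwards [Iio_mem_nhds h] with y hy
        rw [max_eq_right (le_of_lt hy), Real.zero_rpow (by linarith)]
      · rw [max_eq_left h.le]
        apply (Real.hasDerivAt_rpow_const (p := q) (Or.inl h.ne')).congr_of_eventuallyEq
        filter_upwards [Ioi_mem_nhds h] with y hy
        rw [max_eq_left (le_of_lt hy)]
    apply hasDerivAt_of_hasDerivAt_of_ne key
    · exact ((continuous_id.max continuous_const).rpow_const (fun _ => Or.inr (by linarith))).continuousAt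
    · exact (continuous_const.mul ((continuous_id.max continuous_const).rpow_const
        (fun _ => Or.inr (by linarith)))).continuousAt
  · rw [max_eq_left h.le]
    apply (Real.hasDerivAt_rpow_const (p := q) (Or.inl h.ne')).congr_of_eventuallyEq
    filter_upwards [Ioi_mem_nhds h] with y hy
    rw [max_eq_left (le_of_lt hy)]

theorem contDiff_posq {q : ℝ} (hq : 1 < q) : ContDiff ℝ 1 (fun t : ℝ => (max t 0) ^ q) := by
  rw [contDiff_one_iff_deriv]
  refine ⟨fun t => (hasDerivAt_posq hq t).differentiableAt, ?_⟩
  have : deriv (fun t : ℝ => (max t 0) ^ q) = fun t => q * (max t 0) ^ (q - 1) :=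
    funext fun t => (hasDerivAt_posq hq t).deriv
  rw [this]
  exact (continuous_const.mul ((continuous_id.max continuous_const).rpow_const
        (fun _ => Or.inr (by linarith))))

end gradcalc

/-! ## Test functions -/
section tests
variable {N : ℕ}

/-- `C¹` functions with compact support in `D`. -/
structure T1 (D : Set (EuclideanSpace ℝ (Fin N))) (φ : EuclideanSpace ℝ (Fin N) → ℝ) : Prop where
  cd : ContDiff ℝ 1 φ
  cs : HasCompactSupport φ
  sub : tsupport φ ⊆ D

theorem T1.of_compact {D K : Set (EuclideanSpace ℝ (Fin N))} {φ : EuclideanSpace ℝ (Fin N) → ℝ}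
    (hD : IsOpen D) (hφ : ContDiffOn ℝ 1 φ D) (hK : IsCompact K) (hKD : K ⊆ D)
    (h0 : ∀ x, x ∉ K → φ x = 0) : T1 D φ := by
  have hts : tsupport φ ⊆ K := by
    apply closure_minimal _ hK.isClosed
    intro x hx; by_contra h; exact hx (h0 x h)
  refine ⟨?_, HasCompactSupport.intro hK h0, hts.trans hKD⟩
  rw [contDiff_iff_contDiffAt]
  intro x
  by_cases hx : x ∈ tsupport φ
  · exact hφ.contDiffAt (hD.mem_nhds (hKD (hts hx)))
  · exact contDiffAt_const.congr_of_eventuallyEq (notMem_tsupport_iff_eventuallyEq.mp hx)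

theorem T1.mono {D D' : Set (EuclideanSpace ℝ (Fin N))} {φ : EuclideanSpace ℝ (Fin N) → ℝ}
    (h : T1 D φ) (hD : D ⊆ D') : T1 D' φ := ⟨h.cd, h.cs, h.sub.trans hD⟩

theorem gradient_eq_zero_off {φ : EuclideanSpace ℝ (Fin N) → ℝ} {x : EuclideanSpace ℝ (Fin N)}
    (hx : x ∉ tsupport φ) : gradient φ x = 0 := by
  have : φ =ᶠ[𝓝 x] fun _ => 0 := notMem_tsupport_iff_eventuallyEq.mp hx
  rw [this.gradient_eq]; simp

theorem mollify {D : Set (EuclideanSpace ℝ (Fin N))} (hD : IsOpen D)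
    {φ : EuclideanSpace ℝ (Fin N) → ℝ} (hφ : T1 D φ) :
    ∃ K, IsCompact K ∧ K ⊆ D ∧ tsupport φ ⊆ K ∧ ∀ ε > 0, ∃ ψ : EuclideanSpace ℝ (Fin N) → ℝ,
      ContDiff ℝ (⊤ : ℕ∞) ψ ∧ HasCompactSupport ψ ∧ tsupport ψ ⊆ K ∧
      ∀ x, |ψ x - φ x| ≤ ε ∧ ‖gradient ψ x - gradient φ x‖ ≤ ε := by
  obtain ⟨δ, hδ, hsub⟩ := hφ.cs.isCompact.exists_cthickening_subset_open hD hφ.sub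
  have hKc : IsCompact (cthickening δ (tsupport φ)) := hφ.cs.isCompact.cthickening
  refine ⟨cthickening δ (tsupport φ), hKc, hsub, self_subset_cthickening _, ?_⟩
  intro ε hε
  have huc1 : UniformContinuous φ := hφ.cs.uniformContinuous_of_continuous hφ.cd.continuous
  have huc2 : UniformContinuous (fderiv ℝ φ) :=
    (hφ.cs.fderiv ℝ).uniformContinuous_of_continuous (hφ.cd.continuous_fderiv one_ne_zero)
  obtain ⟨d1, hd1, h1⟩ := Metric.uniformContinuous_iff.mp huc1 ε hε
  obtain ⟨d2, hd2, h2⟩ := Metric.uniformContinuous_iff.mp huc2 ε hε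
  set r := min δ (min d1 d2) with hr
  have hr0 : 0 < r := by positivity
  let b : ContDiffBump (0 : EuclideanSpace ℝ (Fin N)) := ⟨r / 2, r, by positivity, by linarith⟩
  have hbr : b.rOut = r := rfl
  let ψ := MeasureTheory.convolution (b.normed volume) φ (ContinuousLinearMap.lsmul ℝ ℝ) volume
  have hfd : ∀ x, HasFDerivAt ψ (MeasureTheory.convolution (b.normed volume) (fderiv ℝ φ)
      (ContinuousLinearMap.lsmul ℝ ℝ) volume x) x := by
    intro x
    have := hφ.cs.hasFDerivAt_convolution_right (ContinuousLinearMap.lsmul ℝ ℝ) (μ := volume)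
      (f := b.normed volume) (b.continuous_normed.locallyIntegrable) hφ.cd x
    exact this
  have hts : tsupport ψ ⊆ cthickening δ (tsupport φ) := by
    apply closure_minimal _ isClosed_cthickening
    refine (support_convolution_subset _).trans ?_
    rw [b.support_normed_eq]
    rintro x ⟨y, hy, z, hz, rfl⟩
    apply mem_cthickening_of_dist_le _ z
    · exact subset_tsupport _ hz
    · have : ‖y‖ < r := by simpa [hbr] using hy
      have h3 : r ≤ δ := min_le_left _ _
      simp [dist_eq_norm]; linarith
  refine ⟨ψ, ?_, ?_, hts, ?_⟩
  · exact b.hasCompactSupport_normed.contDiff_convolution_left _ b.contDiff_normed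
      hφ.cd.continuous.locallyIntegrable
  · exact hKc.of_isClosed_subset (isClosed_tsupport _) hts
  · intro x
    constructor
    · rw [← Real.dist_eq]
      apply b.dist_normed_convolution_le hφ.cd.continuous.aestronglyMeasurable
      intro y hy
      refine (h1 ?_).le
      exact lt_of_lt_of_le hy ((min_le_right _ _).trans (min_le_left _ _))
    · rw [gradient, gradient, ← map_sub, LinearIsometryEquiv.norm_map, (hfd x).fderiv, ← dist_eq_norm]
      apply b.dist_normed_convolution_le (hφ.cd.continuous_fderiv one_ne_zero).aestronglyMeasurable
      intro y hy
      refine (h2 ?_).le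
      exact lt_of_lt_of_le hy ((min_le_right _ _).trans (min_le_right _ _))

theorem mollify_tendsto {D : Set (EuclideanSpace ℝ (Fin N))} (hD : IsOpen D)
    {φ : EuclideanSpace ℝ (Fin N) → ℝ} (hφ : T1 D φ) :
    ∃ ψ : ℕ → EuclideanSpace ℝ (Fin N) → ℝ, (∀ n, ContDiff ℝ (⊤ : ℕ∞) (ψ n)) ∧
      (∀ n, HasCompactSupport (ψ n)) ∧ (∀ n, tsupport (ψ n) ⊆ D) ∧
      ∀ F : EuclideanSpace ℝ (Fin N) → ℝ → EuclideanSpace ℝ (Fin N) → ℝ,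
        ContinuousOn (fun z : EuclideanSpace ℝ (Fin N) × ℝ × EuclideanSpace ℝ (Fin N) =>
          F z.1 z.2.1 z.2.2) (D ×ˢ univ) → (∀ x, F x 0 0 = 0) →
        Tendsto (fun n => ∫ x in D, F x (ψ n x) (gradient (ψ n) x)) atTop
          (𝓝 (∫ x in D, F x (φ x) (gradient φ x))) := by
  obtain ⟨K, hK, hKD, hφK, h⟩ := mollify hD hφ
  choose ψ h1 h2 h3 h4 using fun n : ℕ => h (1 / (n + 1 : ℝ)) (by positivity)
  refine ⟨ψ, h1, h2, fun n => (h3 n).trans hKD, ?_⟩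
  intro F hF hF0
  obtain ⟨A, hA⟩ := hφ.cd.continuous.bounded_above_of_compact_support hφ.cs
  have hgc : HasCompactSupport (gradient φ) := by
    apply HasCompactSupport.intro hφ.cs.isCompact
    intro x hx; exact gradient_eq_zero_off hx
  obtain ⟨B, hB⟩ := hφ.cd.cont_grad.bounded_above_of_compact_support hgc
  have hcomp : IsCompact (K ×ˢ (closedBall (0 : ℝ) (A + 1) ×ˢ
      closedBall (0 : EuclideanSpace ℝ (Fin N)) (B + 1))) :=
    hK.prod ((isCompact_closedBall _ _).prod (isCompact_closedBall _ _))
  obtain ⟨C, hC⟩ := hcomp.exists_bound_of_continuousOn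
    (hF.mono (prod_mono hKD (subset_univ _)))
  have hle1 : ∀ n : ℕ, (1 / (n + 1 : ℝ)) ≤ 1 := fun n => by
    rw [div_le_one (by positivity)]; linarith [Nat.cast_nonneg (α := ℝ) n]
  apply tendsto_integral_of_dominated_convergence (K.indicator fun _ => C)
  · intro n
    apply ContinuousOn.aestronglyMeasurable _ hD.measurableSet
    refine hF.comp (f := fun x => (x, ψ n x, gradient (ψ n) x)) ?_ (fun x hx => ⟨hx, mem_univ _⟩)
    have := ((h1 n).of_le (m := 1) (by exact_mod_cast le_top)).cont_grad
    have := (h1 n).continuous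
    fun_prop
  · apply Integrable.integrableOn
    rw [integrable_indicator_iff hK.measurableSet]
    exact integrableOn_const hK.measure_lt_top.ne
  · intro n
    filter_upwards with x
    by_cases hx : x ∈ K
    · rw [indicator_of_mem hx]
      refine hC (x, ψ n x, gradient (ψ n) x) ⟨hx, ?_, ?_⟩
      · rw [mem_closedBall, dist_zero_right]
        have := (h4 n x).1; rw [← Real.norm_eq_abs] at this
        have h5 := norm_le_norm_add_norm_sub' (ψ n x) (φ x)
        linarith [hA x, hle1 n]
      · rw [mem_closedBall, dist_zero_right]
        have := (h4 n x).2
        have h5 := norm_le_norm_add_norm_sub' (gradient (ψ n) x) (gradient φ x)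
        linarith [hB x, hle1 n]
    · rw [indicator_of_notMem hx, image_eq_zero_of_notMem_tsupport (fun h => hx (h3 n h)),
        gradient_eq_zero_off (fun h => hx (h3 n h)), hF0, norm_zero]
  · filter_upwards [ae_restrict_mem hD.measurableSet] with x hx
    have hc := hF.continuousAt (x := (x, φ x, gradient φ x))
      ((hD.prod isOpen_univ).mem_nhds ⟨hx, mem_univ _⟩)
    refine hc.tendsto.comp (f := fun n => (x, ψ n x, gradient (ψ n) x)) ?_
    have h0 := tendsto_one_div_add_atTop_nhds_zero_nat (𝕜 := ℝ)
    refine tendsto_const_nhds.prodMk_nhds (Tendsto.prodMk_nhds ?_ ?_)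
    · rw [tendsto_iff_norm_sub_tendsto_zero]
      exact squeeze_zero (fun _ => norm_nonneg _) (fun n => (h4 n x).1) h0
    · rw [tendsto_iff_norm_sub_tendsto_zero]
      exact squeeze_zero (fun _ => norm_nonneg _) (fun n => (h4 n x).2) h0

/-- Weak equations tested with smooth functions extend to `C¹` test functions. -/
theorem weak_ext {D : Set (EuclideanSpace ℝ (Fin N))} (hD : IsOpen D)
    {Z : EuclideanSpace ℝ (Fin N) → EuclideanSpace ℝ (Fin N)} {f : EuclideanSpace ℝ (Fin N) → ℝ}
    (hZ : ContinuousOn Z D) (hf : ContinuousOn f D)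
    (h : ∀ φ : EuclideanSpace ℝ (Fin N) → ℝ, ContDiff ℝ (⊤ : ℕ∞) φ → HasCompactSupport φ →
      tsupport φ ⊆ D → ∫ x in D, ⟪Z x, gradient φ x⟫ = ∫ x in D, f x * φ x)
    {φ : EuclideanSpace ℝ (Fin N) → ℝ} (hφ : T1 D φ) :
    ∫ x in D, ⟪Z x, gradient φ x⟫ = ∫ x in D, f x * φ x := by
  obtain ⟨ψ, h1, h2, h3, h4⟩ := mollify_tendsto hD hφ
  have hfst : MapsTo Prod.fst (D ×ˢ (univ : Set (ℝ × EuclideanSpace ℝ (Fin N)))) D :=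
    fun z hz => hz.1
  have a1 := h4 (fun x _ ξ => ⟪Z x, ξ⟫) (ContinuousOn.inner (hZ.comp continuousOn_fst hfst)
    (Continuous.continuousOn (by fun_prop))) (by simp)
  have a2 := h4 (fun x t _ => f x * t) (ContinuousOn.mul (hf.comp continuousOn_fst hfst)
    (Continuous.continuousOn (by fun_prop))) (by simp)
  refine tendsto_nhds_unique a1 (a2.congr fun n => ?_)
  exact (h (ψ n) (h1 n) (h2 n) (h3 n)).symm

theorem lam1_nonneg {p : ℝ} (Ω : Set (EuclideanSpace ℝ (Fin N))) : 0 ≤ lam1 p Ω := by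
  apply Real.sInf_nonneg
  rintro r ⟨u, -, -, -, -, rfl⟩
  apply div_nonneg <;> exact integral_nonneg fun x => by positivity

theorem lam1_le {p : ℝ} (hp : 1 < p) {Ω : Set (EuclideanSpace ℝ (Fin N))} (hΩ : IsOpen Ω)
    {w : EuclideanSpace ℝ (Fin N) → ℝ} (hw : T1 Ω w) :
    lam1 p Ω * ∫ x in Ω, |w x| ^ p ≤ ∫ x in Ω, ‖gradient w x‖ ^ p := by
  obtain ⟨ψ, h1, h2, h3, h4⟩ := mollify_tendsto hΩ hw
  have a1 := h4 (fun x _ ξ => ‖ξ‖ ^ p) (by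
    apply Continuous.continuousOn
    exact (by fun_prop : Continuous fun z : EuclideanSpace ℝ (Fin N) × ℝ × EuclideanSpace ℝ (Fin N) =>
      ‖z.2.2‖).rpow_const (fun _ => Or.inr (by linarith)))
    (by simp [Real.zero_rpow (by linarith : p ≠ 0)])
  have a2 := h4 (fun x t _ => |t| ^ p) (by
    apply Continuous.continuousOn
    exact (by fun_prop : Continuous fun z : EuclideanSpace ℝ (Fin N) × ℝ × EuclideanSpace ℝ (Fin N) =>
      |z.2.1|).rpow_const (fun _ => Or.inr (by linarith)))
    (by simp [Real.zero_rpow (by linarith : p ≠ 0)])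
  refine le_of_tendsto_of_tendsto' (a2.const_mul _) a1 fun n => ?_
  have hA : 0 ≤ ∫ x in Ω, |ψ n x| ^ p := integral_nonneg fun x => by positivity
  have hB : 0 ≤ ∫ x in Ω, ‖gradient (ψ n) x‖ ^ p := integral_nonneg fun x => by positivity
  rcases hA.eq_or_lt with h0 | h0
  · rw [← h0]; simpa using hB
  · rw [← le_div_iff₀ h0]
    apply csInf_le
    · refine ⟨0, ?_⟩
      rintro r ⟨u, -, -, -, -, rfl⟩
      apply div_nonneg <;> exact integral_nonneg fun x => by positivity
    · refine ⟨ψ n, h1 n, ?_, h2 n, h3 n, rfl⟩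
      intro h; rw [h] at h0; simp [Real.zero_rpow (by linarith : p ≠ 0)] at h0

end tests

section tools
variable {N : ℕ}

theorem intOn_of_compact {D K : Set (EuclideanSpace ℝ (Fin N))} {g : EuclideanSpace ℝ (Fin N) → ℝ}
    (hD : IsOpen D) (hg : ContinuousOn g D) (hK : IsCompact K) (hKD : K ⊆ D)
    (h0 : ∀ x ∈ D, x ∉ K → g x = 0) : IntegrableOn g D := by
  have h1 : IntegrableOn g K := (hg.mono hKD).integrableOn_compact hK
  refine h1.of_forall_sdiff_eq_zero hD.measurableSet fun x hx => h0 x hx.1 hx.2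

theorem T1.inner_integrable {D : Set (EuclideanSpace ℝ (Fin N))}
    {φ : EuclideanSpace ℝ (Fin N) → ℝ} (hφ : T1 D φ) (hD : IsOpen D)
    {Z : EuclideanSpace ℝ (Fin N) → EuclideanSpace ℝ (Fin N)} (hZ : ContinuousOn Z D) :
    IntegrableOn (fun x => ⟪Z x, gradient φ x⟫) D := by
  refine intOn_of_compact hD (hZ.inner hφ.cd.cont_grad.continuousOn) hφ.cs.isCompact hφ.sub ?_
  intro x _ hx
  rw [gradient_eq_zero_off hx, inner_zero_right]

theorem T1.mul_integrable {D : Set (EuclideanSpace ℝ (Fin N))}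
    {φ : EuclideanSpace ℝ (Fin N) → ℝ} (hφ : T1 D φ) (hD : IsOpen D)
    {f : EuclideanSpace ℝ (Fin N) → ℝ} (hf : ContinuousOn f D) :
    IntegrableOn (fun x => f x * φ x) D := by
  refine intOn_of_compact hD (hf.mul hφ.cd.continuous.continuousOn) hφ.cs.isCompact hφ.sub ?_
  intro x _ hx
  rw [image_eq_zero_of_notMem_tsupport hx, mul_zero]

theorem smooth_deriv (t : ℝ) :
    HasDerivAt Real.smoothTransition (deriv Real.smoothTransition t) t :=
  ((Real.smoothTransition.contDiff (n := 1)).differentiable one_ne_zero t).hasDerivAt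

theorem smooth_deriv_cont : Continuous (deriv Real.smoothTransition) :=
  (Real.smoothTransition.contDiff (n := 1)).continuous_deriv le_rfl

theorem smooth_deriv_zero {t : ℝ} (ht : t < 0 ∨ 1 < t) : deriv Real.smoothTransition t = 0 := by
  rcases ht with h | h
  · have : Real.smoothTransition =ᶠ[𝓝 t] fun _ => 0 := by
      filter_upwards [Iio_mem_nhds h] with y hy
      exact Real.smoothTransition.zero_of_nonpos (le_of_lt hy)
    rw [this.deriv_eq]; simp
  · have : Real.smoothTransition =ᶠ[𝓝 t] fun _ => 1 := by
      filter_upwards [Ioi_mem_nhds h] with y hy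
      exact Real.smoothTransition.one_of_one_le (le_of_lt hy)
    rw [this.deriv_eq]; simp

theorem smooth_deriv_nonneg (t : ℝ) : 0 ≤ deriv Real.smoothTransition t :=
  Real.smoothTransition.monotone.deriv_nonneg

theorem smooth_deriv_bdd : ∃ C : ℝ, 0 ≤ C ∧ ∀ t, |deriv Real.smoothTransition t| ≤ C := by
  obtain ⟨C, hC⟩ := (isCompact_Icc (a := (0:ℝ)) (b := 1)).exists_bound_of_continuousOn
    smooth_deriv_cont.continuousOn
  refine ⟨max C 0, le_max_right _ _, fun t => ?_⟩
  by_cases ht : t ∈ Icc (0:ℝ) 1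
  · exact (hC t ht).trans (le_max_left _ _)
  · rw [smooth_deriv_zero, abs_zero]; · exact le_max_right _ _
    by_contra h; push Not at h; exact ht h

theorem layer_vol {ρ : ℝ} : ∃ C : ℝ, 0 ≤ C ∧ ∀ k : ℝ, 0 < k → 2 / k < ρ →
    volume.real {x : EuclideanSpace ℝ (Fin N) | ρ - 2 / k ≤ ‖x‖ ∧ ‖x‖ ≤ ρ - 1 / k} ≤ C / k := by
  refine ⟨N * |ρ| ^ (N - 1) * volume.real (ball (0 : EuclideanSpace ℝ (Fin N)) 1), by positivity, ?_⟩
  intro k hk hkρ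
  have h12 : 1 / k ≤ 2 / k := by gcongr; norm_num
  have hk1 : 0 < 1 / k := by positivity
  have e : {x : EuclideanSpace ℝ (Fin N) | ρ - 2 / k ≤ ‖x‖ ∧ ‖x‖ ≤ ρ - 1 / k}
      = closedBall 0 (ρ - 1 / k) \ ball 0 (ρ - 2 / k) := by
    ext x; simp [and_comm]
  have hb : ball (0 : EuclideanSpace ℝ (Fin N)) (ρ - 2 / k) ⊆ closedBall 0 (ρ - 1 / k) :=
    ball_subset_closedBall.trans (closedBall_subset_closedBall (by linarith))
  have hv : ∀ r : ℝ, 0 < r → volume.real (ball (0 : EuclideanSpace ℝ (Fin N)) r) =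
      r ^ N * volume.real (ball (0 : EuclideanSpace ℝ (Fin N)) 1) := by
    intro r hr
    rw [measureReal_def, Measure.addHaar_ball_of_pos volume _ hr, ENNReal.toReal_mul,
      ENNReal.toReal_ofReal (by positivity), measureReal_def]
    simp
  have hv2 : volume.real (closedBall (0 : EuclideanSpace ℝ (Fin N)) (ρ - 1 / k)) =
      (ρ - 1 / k) ^ N * volume.real (ball (0 : EuclideanSpace ℝ (Fin N)) 1) := by
    have h0 : 0 ≤ ρ - 1 / k := by linarith
    rw [measureReal_def, Measure.addHaar_closedBall volume _ h0, ENNReal.toReal_mul,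
      ENNReal.toReal_ofReal (by positivity), measureReal_def]
    simp
  rw [e, measureReal_sdiff hb measurableSet_ball measure_closedBall_lt_top.ne, hv2, hv (ρ - 2 / k) (by linarith), ← sub_mul]
  have := abs_pow_sub_pow_le (ρ - 1 / k) (ρ - 2 / k) N
  have h3 : |(ρ - 1 / k) - (ρ - 2 / k)| = 1 / k := by
    rw [abs_of_nonneg (by linarith)]; ring
  have h4 : max |ρ - 1 / k| |ρ - 2 / k| ≤ |ρ| := by
    rw [abs_of_pos (by linarith : 0 < ρ - 1 / k), abs_of_pos (by linarith : 0 < ρ - 2 / k),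
      abs_of_pos (by linarith : 0 < ρ)]
    apply max_le <;> linarith
  have h5 : (ρ - 1 / k) ^ N - (ρ - 2 / k) ^ N ≤ 1 / k * N * |ρ| ^ (N - 1) := by
    refine (le_abs_self _).trans (this.trans ?_)
    rw [h3]; gcongr
  calc _ ≤ (1 / k * N * |ρ| ^ (N - 1)) * volume.real (ball (0 : EuclideanSpace ℝ (Fin N)) 1) := by gcongr
    _ = _ := by ring

theorem poincare_id {D : Set (EuclideanSpace ℝ (Fin N))} 
    {f : EuclideanSpace ℝ (Fin N) → ℝ} (hf : T1 D f) {a : EuclideanSpace ℝ (Fin N)} (ha : ‖a‖ = 1) :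
    ∫ x in D, f x = - ∫ x in D, ⟪a, x⟫ * ⟪a, gradient f x⟫ := by
  have hz : ∀ x, x ∉ D → f x = 0 := fun x hx => image_eq_zero_of_notMem_tsupport fun h => hx (hf.sub h)
  have hz' : ∀ x, x ∉ D → ⟪a, x⟫ * ⟪a, gradient f x⟫ = 0 := fun x hx => by
    rw [gradient_eq_zero_off fun h => hx (hf.sub h)]; simp
  rw [setIntegral_eq_integral_of_forall_compl_eq_zero hz,
    setIntegral_eq_integral_of_forall_compl_eq_zero hz']
  have h1 : ∀ x, fderiv ℝ (fun y : EuclideanSpace ℝ (Fin N) => ⟪a, y⟫) x a = 1 := by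
    intro x
    rw [(hga_inner a x).hasFDerivAt.fderiv]; simp [ha]
  have h2 : ∀ x, fderiv ℝ f x a = ⟪a, gradient f x⟫ := by
    intro x; rw [real_inner_comm, inner_gradient_left]
  have hInt0 : ∀ g : EuclideanSpace ℝ (Fin N) → ℝ, Continuous g → (∀ x, x ∉ tsupport f → g x = 0) →
      Integrable g := fun g hg h0 => hg.integrable_of_hasCompactSupport (HasCompactSupport.intro hf.cs.isCompact h0)
  have := integral_mul_fderiv_eq_neg_fderiv_mul_of_integrable (μ := volume)
    (f := fun y : EuclideanSpace ℝ (Fin N) => ⟪a, y⟫) (g := f) (v := a) ?_ ?_ ?_ ?_ ?_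
  · simp only [h1, h2, one_mul] at this
    rw [this, neg_neg]
  · simp only [h1, one_mul]
    exact hf.cd.continuous.integrable_of_hasCompactSupport hf.cs
  · simp only [h2]
    have := hf.cd.cont_grad
    refine hInt0 _ (by fun_prop) fun x hx => ?_
    rw [gradient_eq_zero_off hx]; simp
  · have := hf.cd.continuous
    refine hInt0 _ (by fun_prop) fun x hx => ?_
    rw [image_eq_zero_of_notMem_tsupport hx]; simp
  · intro x _; exact (hga_inner a x).differentiableAt
  · intro x _; exact hf.cd.differentiable one_ne_zero x

end tools

section loglemma
variable {N : ℕ}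

/-- angular/radial cutoff -/
noncomputable def psi (a : EuclideanSpace ℝ (Fin N)) (κ ρ1 : ℝ) (x : EuclideanSpace ℝ (Fin N)) : ℝ :=
  Real.smoothTransition (‖x‖ - ρ1) * Real.smoothTransition (⟪a, x⟫ - κ)

/-- outer cutoff -/
noncomputable def Tk (ρ0 k : ℝ) (x : EuclideanSpace ℝ (Fin N)) : ℝ :=
  Real.smoothTransition (k * (ρ0 - ‖x‖) - 1)

/-- half annulus -/
def HA (a : EuclideanSpace ℝ (Fin N)) (ρ ρ0 : ℝ) : Set (EuclideanSpace ℝ (Fin N)) :=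
  {x | 0 < ⟪a, x⟫ ∧ ρ < ‖x‖ ∧ ‖x‖ < ρ0}

theorem isOpen_HA (a : EuclideanSpace ℝ (Fin N)) (ρ ρ0 : ℝ) : IsOpen (HA a ρ ρ0) := by
  have h1 : IsOpen {x : EuclideanSpace ℝ (Fin N) | 0 < ⟪a, x⟫} := isOpen_lt (by fun_prop) (by fun_prop)
  have h2 : IsOpen {x : EuclideanSpace ℝ (Fin N) | ρ < ‖x‖} := isOpen_lt (by fun_prop) (by fun_prop)
  have h3 : IsOpen {x : EuclideanSpace ℝ (Fin N) | ‖x‖ < ρ0} := isOpen_lt (by fun_prop) (by fun_prop)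
  exact h1.inter (h2.inter h3)

theorem HA_finite (a : EuclideanSpace ℝ (Fin N)) (ρ ρ0 : ℝ) : volume (HA a ρ ρ0) ≠ ∞ := by
  refine ne_top_of_le_ne_top (measure_ball_lt_top (x := 0) (r := ρ0)).ne (measure_mono ?_)
  intro x hx; simpa using hx.2.2

theorem HA_ne {a : EuclideanSpace ℝ (Fin N)} {ρ ρ0 : ℝ} {x : EuclideanSpace ℝ (Fin N)}
    (hx : x ∈ HA a ρ ρ0) : x ≠ 0 := by
  rintro rfl; simpa using hx.1

theorem psi_nonneg (a : EuclideanSpace ℝ (Fin N)) (κ ρ1 : ℝ) (x) : 0 ≤ psi a κ ρ1 x :=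
  mul_nonneg (Real.smoothTransition.nonneg _) (Real.smoothTransition.nonneg _)

theorem psi_le_one (a : EuclideanSpace ℝ (Fin N)) (κ ρ1 : ℝ) (x) : psi a κ ρ1 x ≤ 1 :=
  mul_le_one₀ (Real.smoothTransition.le_one _) (Real.smoothTransition.nonneg _)
    (Real.smoothTransition.le_one _)

theorem psi_hga (a : EuclideanSpace ℝ (Fin N)) (κ ρ1 : ℝ) {x : EuclideanSpace ℝ (Fin N)}
    (hx : x ≠ 0) : HasGradientAt (psi a κ ρ1)
      (Real.smoothTransition (‖x‖ - ρ1) • (deriv Real.smoothTransition (⟪a, x⟫ - κ) • a) +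
       Real.smoothTransition (⟪a, x⟫ - κ) • (deriv Real.smoothTransition (‖x‖ - ρ1) • (‖x‖⁻¹ • x))) x := by
  have h1 := hga_comp (f := fun y : EuclideanSpace ℝ (Fin N) => ‖y‖ + -ρ1)
    (smooth_deriv _) (hga_add_const (-ρ1) (hga_norm hx))
  have h2 := hga_comp (f := fun y : EuclideanSpace ℝ (Fin N) => ⟪a, y⟫ + -κ)
    (smooth_deriv _) (hga_add_const (-κ) (hga_inner a x))
  exact hga_mul h1 h2

theorem Tk_hga (ρ0 k : ℝ) {x : EuclideanSpace ℝ (Fin N)}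
    (hx : x ≠ 0) : HasGradientAt (Tk ρ0 k)
      ((deriv Real.smoothTransition (k * (ρ0 - ‖x‖) - 1) * (-k)) • (‖x‖⁻¹ • x)) x := by
  have h0 : HasDerivAt (fun t : ℝ => k * (ρ0 - t) - 1) (-k) ‖x‖ := by
    have := (((hasDerivAt_id ‖x‖).const_sub ρ0).const_mul k).sub_const 1
    simpa using this
  have h1 : HasDerivAt (fun t : ℝ => Real.smoothTransition (k * (ρ0 - t) - 1))
      (deriv Real.smoothTransition (k * (ρ0 - ‖x‖) - 1) * (-k)) ‖x‖ :=
    (smooth_deriv _).comp ‖x‖ h0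
  exact hga_comp (f := fun y : EuclideanSpace ℝ (Fin N) => ‖y‖) h1 (hga_norm hx)

theorem contDiffOn_psi (a : EuclideanSpace ℝ (Fin N)) (κ ρ1 ρ ρ0 : ℝ) :
    ContDiffOn ℝ 1 (psi a κ ρ1) (HA a ρ ρ0) := by
  have hS : ContDiff ℝ 1 Real.smoothTransition := Real.smoothTransition.contDiff (n := 1)
  apply ContDiffOn.mul
  · refine hS.comp_contDiffOn (ContDiffOn.sub (contDiffOn_id.norm ℝ fun x hx => HA_ne hx) contDiffOn_const)
  · exact hS.comp_contDiffOn (ContDiffOn.sub (contDiff_const.inner ℝ contDiff_id).contDiffOn contDiffOn_const)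

theorem contDiffOn_Tk (a : EuclideanSpace ℝ (Fin N)) (k ρ ρ0 ρ2 : ℝ) :
    ContDiffOn ℝ 1 (Tk ρ2 k) (HA a ρ ρ0) := by
  have hS : ContDiff ℝ 1 Real.smoothTransition := Real.smoothTransition.contDiff (n := 1)
  refine hS.comp_contDiffOn (ContDiffOn.sub (contDiffOn_const.mul (ContDiffOn.sub contDiffOn_const
    (contDiffOn_id.norm ℝ fun x hx => HA_ne hx))) contDiffOn_const)

theorem psi_grad_norm {a : EuclideanSpace ℝ (Fin N)} (ha : ‖a‖ = 1) (κ ρ1 : ℝ) {S1 : ℝ}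
    (hS1 : ∀ t, |deriv Real.smoothTransition t| ≤ S1) {x : EuclideanSpace ℝ (Fin N)} (hx : x ≠ 0) :
    ‖gradient (psi a κ ρ1) x‖ ≤ 2 * S1 := by
  rw [(psi_hga a κ ρ1 hx).gradient]
  have hx' : ‖x‖ ≠ 0 := norm_ne_zero_iff.mpr hx
  refine (norm_add_le _ _).trans ?_
  rw [norm_smul, norm_smul, norm_smul, norm_smul, norm_smul, ha, norm_inv, norm_norm,
    inv_mul_cancel₀ hx', Real.norm_of_nonneg (Real.smoothTransition.nonneg _),
    Real.norm_of_nonneg (Real.smoothTransition.nonneg _), mul_one, mul_one, Real.norm_eq_abs,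
    Real.norm_eq_abs]
  have h1 := mul_le_mul (Real.smoothTransition.le_one (‖x‖ - ρ1)) (hS1 (⟪a, x⟫ - κ)) (abs_nonneg _) zero_le_one
  have h2 := mul_le_mul (Real.smoothTransition.le_one (⟪a, x⟫ - κ)) (hS1 (‖x‖ - ρ1)) (abs_nonneg _) zero_le_one
  linarith

theorem psi_grad_inner {a : EuclideanSpace ℝ (Fin N)} (κ ρ1 : ℝ)
    {x : EuclideanSpace ℝ (Fin N)} (hx : x ≠ 0) (hax : 0 ≤ ⟪a, x⟫) :
    0 ≤ ⟪a, gradient (psi a κ ρ1) x⟫ := by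
  rw [(psi_hga a κ ρ1 hx).gradient]
  simp only [inner_add_right, real_inner_smul_right, real_inner_self_eq_norm_sq]
  have := Real.smoothTransition.nonneg (‖x‖ - ρ1)
  have := Real.smoothTransition.nonneg (⟪a, x⟫ - κ)
  have := smooth_deriv_nonneg (‖x‖ - ρ1)
  have := smooth_deriv_nonneg (⟪a, x⟫ - κ)
  positivity

theorem HA_compact {a : EuclideanSpace ℝ (Fin N)} {κ ρ1 ρ2 : ℝ} :
    IsCompact {x : EuclideanSpace ℝ (Fin N) | κ ≤ ⟪a, x⟫ ∧ ρ1 ≤ ‖x‖ ∧ ‖x‖ ≤ ρ2} := by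
  refine (isCompact_closedBall (0 : EuclideanSpace ℝ (Fin N)) ρ2).of_isClosed_subset ?_ ?_
  · have h1 : IsClosed {x : EuclideanSpace ℝ (Fin N) | κ ≤ ⟪a, x⟫} := isClosed_le (by fun_prop) (by fun_prop)
    have h2 : IsClosed {x : EuclideanSpace ℝ (Fin N) | ρ1 ≤ ‖x‖} := isClosed_le (by fun_prop) (by fun_prop)
    have h3 : IsClosed {x : EuclideanSpace ℝ (Fin N) | ‖x‖ ≤ ρ2} := isClosed_le (by fun_prop) (by fun_prop)
    exact h1.inter (h2.inter h3)
  · intro x hx; simpa using hx.2.2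

theorem psiT_zero {a : EuclideanSpace ℝ (Fin N)} {κ ρ1 ρ0 k : ℝ} (hk : 0 < k)
    {x : EuclideanSpace ℝ (Fin N)}
    (hx : x ∉ {x : EuclideanSpace ℝ (Fin N) | κ ≤ ⟪a, x⟫ ∧ ρ1 ≤ ‖x‖ ∧ ‖x‖ ≤ ρ0 - 1 / k}) :
    psi a κ ρ1 x = 0 ∨ Tk ρ0 k x = 0 := by
  simp only [mem_ofPred_eq, not_and_or, not_le] at hx
  rcases hx with h | h | h
  · left; rw [psi, Real.smoothTransition.zero_of_nonpos (by linarith : ⟪a, x⟫ - κ ≤ 0), mul_zero]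
  · left; rw [psi, Real.smoothTransition.zero_of_nonpos (by linarith : ‖x‖ - ρ1 ≤ 0), zero_mul]
  · right
    apply Real.smoothTransition.zero_of_nonpos
    have : k * (ρ0 - ‖x‖) ≤ k * (1 / k) := by gcongr; linarith
    have h2 : k * (1 / k) = 1 := by field_simp
    linarith

set_option maxHeartbeats 1000000 in
theorem log_energy {q m M ρ ρ0 κ ρ1 : ℝ} (hq : 1 < q) (hm : 0 < m) (hM : 0 ≤ M)
    (h01 : ρ < ρ1) (h1 : 0 < ρ0) (hκ : 0 < κ)
    {a : EuclideanSpace ℝ (Fin N)} (ha : ‖a‖ = 1)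
    {z : EuclideanSpace ℝ (Fin N) → ℝ} {Z : EuclideanSpace ℝ (Fin N) → EuclideanSpace ℝ (Fin N)}
    (hz : ContDiffOn ℝ 1 z (HA a ρ ρ0)) (hz0 : ∀ x ∈ HA a ρ ρ0, 0 ≤ z x)
    (hZ : ContinuousOn Z (HA a ρ ρ0))
    (hZ1 : ∀ x ∈ HA a ρ ρ0, m * ‖gradient z x‖ ^ q ≤ ⟪Z x, gradient z x⟫)
    (hZ2 : ∀ x ∈ HA a ρ ρ0, ‖Z x‖ ≤ M * ‖gradient z x‖ ^ (q - 1))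
    (hZ0 : ∀ η > 0, ∃ τ > 0, ∀ x ∈ HA a ρ ρ0, ρ0 - τ < ‖x‖ → ‖Z x‖ ≤ η)
    (hw : ∀ φ, T1 (HA a ρ ρ0) φ → (∀ x, 0 ≤ φ x) → 0 ≤ ∫ x in HA a ρ ρ0, ⟪Z x, gradient φ x⟫) :
    ∃ C : ℝ, 0 ≤ C ∧ ∀ ε > 0, ∀ τ > 0, ∃ k > 0, 2 / k ≤ τ ∧
      ∫ x in HA a ρ ρ0, Tk ρ0 k x * (psi a κ ρ1 x * (‖gradient z x‖ / (z x + ε))) ^ q ≤ C := by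
  obtain ⟨S1, hS10, hS1⟩ := smooth_deriv_bdd
  obtain ⟨Cl, hCl0, hCl⟩ := layer_vol (N := N) (ρ := ρ0)
  set D := HA a ρ ρ0 with hDdef
  have hD : IsOpen D := isOpen_HA a ρ ρ0
  set Q := q * M * (2 * S1) with hQ
  have hQ0 : 0 ≤ Q := by positivity
  have hq1 : 0 < q - 1 := by linarith
  set c1 := (q - 1) * m / 2 with hc1
  have hc10 : 0 < c1 := by positivity
  set t0 := c1 / (Q + 1) with ht0
  have ht00 : 0 < t0 := by positivity
  have hQt : Q * t0 ≤ c1 := by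
    rw [ht0, mul_div_assoc', div_le_iff₀ (by positivity)]; nlinarith
  set Cc := Q * t0 ^ (1 - q) with hCc
  have hCc0 : 0 ≤ Cc := by positivity
  refine ⟨(Cc * volume.real D + 1) / c1, by positivity, ?_⟩
  intro ε hε τ hτ
  set η := 1 / (ε ^ (1 - q) * S1 * Cl + 1) with hη
  have hη0 : 0 < η := by positivity
  have hηs : ε ^ (1 - q) * S1 * Cl * η ≤ 1 := by
    rw [hη, mul_one_div, div_le_one (by positivity)]; linarith
  obtain ⟨τ', hτ', hZs⟩ := hZ0 η hη0
  set mm := min τ (min τ' ρ0) with hmm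
  have hmm0 : 0 < mm := by positivity
  have hm1 : mm ≤ τ := min_le_left _ _
  have hm2 : mm ≤ τ' := (min_le_right _ _).trans (min_le_left _ _)
  have hm3 : mm ≤ ρ0 := (min_le_right _ _).trans (min_le_right _ _)
  set k := 4 / mm with hk
  have hk0 : 0 < k := by positivity
  have h2k : 2 / k = mm / 2 := by rw [hk]; field_simp; norm_num
  refine ⟨k, hk0, by linarith, ?_⟩
  -- the test function
  set ψ := psi a κ ρ1 with hψ
  set T : EuclideanSpace ℝ (Fin N) → ℝ := Tk ρ0 k with hT
  set y := fun x => ‖gradient z x‖ / (z x + ε) with hy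
  have hψ0 := psi_nonneg a κ ρ1
  have hψ1 := psi_le_one a κ ρ1
  have hT0 : ∀ x, 0 ≤ T x := fun x => Real.smoothTransition.nonneg _
  have hT1 : ∀ x, T x ≤ 1 := fun x => Real.smoothTransition.le_one _
  set K := {x : EuclideanSpace ℝ (Fin N) | κ ≤ ⟪a, x⟫ ∧ ρ1 ≤ ‖x‖ ∧ ‖x‖ ≤ ρ0 - 1 / k} with hK
  have hKc : IsCompact K := HA_compact
  have hKD : K ⊆ D := by
    intro x hx
    refine ⟨lt_of_lt_of_le hκ hx.1, lt_of_lt_of_le h01 hx.2.1, lt_of_le_of_lt hx.2.2 ?_⟩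
    have : 0 < 1 / k := by positivity
    linarith
  set φ : EuclideanSpace ℝ (Fin N) → ℝ := fun x => (ψ x) ^ q * (max (z x) 0 + ε) ^ (1 - q) * T x with hφdef
  have hPpos : ∀ x ∈ D, 0 < z x + ε := fun x hx => by linarith [hz0 x hx]
  have hφT : T1 D φ := by
    refine T1.of_compact hD ?_ hKc hKD ?_
    · have : ContDiffOn ℝ 1 (fun x => (ψ x) ^ q * (z x + ε) ^ (1 - q) * T x) D := by
        refine ContDiffOn.mul (ContDiffOn.mul ?_ ?_) (contDiffOn_Tk a k ρ ρ0 ρ0)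
        · exact (contDiffOn_psi a κ ρ1 ρ ρ0).rpow_const_of_le (m := 1) (by exact_mod_cast hq.le)
        · exact (hz.add contDiffOn_const).rpow_const_of_ne fun x hx => (hPpos x hx).ne'
      refine this.congr fun x hx => ?_
      simp only [hφdef]; rw [max_eq_left (hz0 x hx)]
    · intro x hx
      rcases psiT_zero hk0 hx with h | h
      · simp only [hφdef, hψ]; rw [h, Real.zero_rpow (by linarith)]; simp
      · simp only [hφdef, hT]; rw [h]; simp
  have hφ0 : ∀ x, 0 ≤ φ x := by
    intro x
    have : 0 < max (z x) 0 + ε := by have := le_max_right (z x) 0; linarith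
    have := hψ0 x; have := hT0 x
    simp only [hφdef]; positivity
  have hgrad : ∀ x ∈ D, gradient φ x = ((ψ x) ^ q * (z x + ε) ^ (1 - q)) • gradient T x +
      T x • ((ψ x) ^ q • (((1 - q) * (z x + ε) ^ (1 - q - 1)) • gradient z x) +
        (z x + ε) ^ (1 - q) • ((q * (ψ x) ^ (q - 1)) • gradient ψ x)) := by
    intro x hx
    have hx0 := HA_ne hx
    have e : φ =ᶠ[𝓝 x] fun x => (ψ x) ^ q * (z x + ε) ^ (1 - q) * T x := by
      filter_upwards [hD.mem_nhds hx] with x hx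
      simp only [hφdef]; rw [max_eq_left (hz0 x hx)]
    rw [e.gradient_eq]
    apply HasGradientAt.gradient
    have g1 : HasGradientAt ψ (gradient ψ x) x := (psi_hga a κ ρ1 hx0).differentiableAt.hasGradientAt
    have g2 : HasGradientAt T (gradient T x) x := (Tk_hga ρ0 k hx0).differentiableAt.hasGradientAt
    have g3 := hga_add_const ε (hz.hga hD hx)
    have g4 := hga_comp (F := fun t => t ^ q) (Real.hasDerivAt_rpow_const (Or.inr hq.le)) g1
    have g5 := hga_comp (f := fun x => z x + ε) (F := fun t => t ^ (1 - q))
      (Real.hasDerivAt_rpow_const (Or.inl (hPpos x hx).ne')) g3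
    exact hga_mul (hga_mul g4 g5) g2
  set L := {x : EuclideanSpace ℝ (Fin N) | ρ0 - 2 / k ≤ ‖x‖ ∧ ‖x‖ ≤ ρ0 - 1 / k} with hL
  set B := ε ^ (1 - q) * η * k * S1 with hB
  have hB0 : 0 ≤ B := by positivity
  have hpt : ∀ x ∈ D, ⟪Z x, gradient φ x⟫ ≤ (L.indicator (fun _ => B) x + Cc) -
      c1 * (T x * (ψ x * y x) ^ q) := by
    intro x hx
    have hx0 := HA_ne hx
    have hP := hPpos x hx
    have hy0 : 0 ≤ y x := by simp only [hy]; positivity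
    have hψx := hψ0 x
    rw [hgrad x hx]
    simp only [inner_add_right, real_inner_smul_right]
    -- first term
    have t1 : (ψ x) ^ q * (z x + ε) ^ (1 - q) * ⟪Z x, gradient T x⟫ ≤ L.indicator (fun _ => B) x := by
      rw [(Tk_hga ρ0 k hx0).gradient]
      by_cases hxL : x ∈ L
      · rw [indicator_of_mem hxL]
        have hZx : ‖Z x‖ ≤ η := hZs x hx (by linarith [hxL.1])
        have i1 : ⟪Z x, (deriv Real.smoothTransition (k * (ρ0 - ‖x‖) - 1) * (-k)) • (‖x‖⁻¹ • x)⟫ ≤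
            η * (k * S1) := by
          refine (real_inner_le_norm _ _).trans ?_
          rw [norm_smul, norm_smul, norm_inv, norm_norm, inv_mul_cancel₀ (norm_ne_zero_iff.mpr hx0),
            mul_one, norm_mul, norm_neg, Real.norm_of_nonneg hk0.le, Real.norm_eq_abs, mul_comm _ k]
          exact mul_le_mul hZx (mul_le_mul_of_nonneg_left (hS1 _) hk0.le) (by positivity) hη0.le
        have i2 : (ψ x) ^ q ≤ 1 := Real.rpow_le_one hψx (hψ1 x) (by linarith)
        have i3 : (z x + ε) ^ (1 - q) ≤ ε ^ (1 - q) :=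
          Real.rpow_le_rpow_of_nonpos hε (by linarith [hz0 x hx]) (by linarith)
        have i4 : (ψ x) ^ q * (z x + ε) ^ (1 - q) ≤ ε ^ (1 - q) := by
          have : 0 < (z x + ε) ^ (1 - q) := by positivity
          nlinarith
        calc _ ≤ (ψ x) ^ q * (z x + ε) ^ (1 - q) * (η * (k * S1)) := by gcongr
          _ ≤ ε ^ (1 - q) * (η * (k * S1)) := by gcongr
          _ = B := by rw [hB]; ring
      · rw [indicator_of_notMem hxL, smooth_deriv_zero]
        · simp
        · simp only [hL, mem_ofPred_eq, not_and_or, not_le] at hxL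
          rcases hxL with h | h
          · right
            have : k * (2 / k) < k * (ρ0 - ‖x‖) := by gcongr; linarith
            have h2 : k * (2 / k) = 2 := by field_simp
            linarith
          · left
            have : k * (ρ0 - ‖x‖) < k * (1 / k) := by gcongr; linarith
            have h2 : k * (1 / k) = 1 := by field_simp
            linarith
    -- main terms
    have e1 : (ψ x) ^ q * ((1 - q) * (z x + ε) ^ (1 - q - 1) * ⟪Z x, gradient z x⟫) ≤
        -(2 * c1) * (ψ x * y x) ^ q := by
      have i1 := hZ1 x hx
      have i2 : (ψ x * y x) ^ q = (ψ x) ^ q * ((z x + ε) ^ (1 - q - 1) * ‖gradient z x‖ ^ q) := by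
        rw [Real.mul_rpow hψx hy0]
        simp only [hy]
        rw [Real.div_rpow (norm_nonneg _) hP.le, show 1 - q - 1 = -q by ring, Real.rpow_neg hP.le]
        ring
      rw [i2, hc1]
      have i3 : 0 ≤ (q - 1) * ((ψ x) ^ q * (z x + ε) ^ (1 - q - 1)) := by positivity
      have j := mul_le_mul_of_nonneg_left i1 i3
      have j1 : (ψ x) ^ q * ((1 - q) * (z x + ε) ^ (1 - q - 1) * ⟪Z x, gradient z x⟫) =
        -((q - 1) * ((ψ x) ^ q * (z x + ε) ^ (1 - q - 1)) * ⟪Z x, gradient z x⟫) := by ring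
      have j2 : -(2 * ((q - 1) * m / 2)) * ((ψ x) ^ q * ((z x + ε) ^ (1 - q - 1) * ‖gradient z x‖ ^ q)) =
        -((q - 1) * ((ψ x) ^ q * (z x + ε) ^ (1 - q - 1)) * (m * ‖gradient z x‖ ^ q)) := by ring
      rw [j1, j2]; exact neg_le_neg j
    have e2 : (z x + ε) ^ (1 - q) * (q * (ψ x) ^ (q - 1) * ⟪Z x, gradient ψ x⟫) ≤
        Q * (ψ x * y x) ^ (q - 1) := by
      have i1 : ⟪Z x, gradient ψ x⟫ ≤ M * ‖gradient z x‖ ^ (q - 1) * (2 * S1) := by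
        refine (real_inner_le_norm _ _).trans ?_
        exact mul_le_mul (hZ2 x hx) (psi_grad_norm ha κ ρ1 hS1 hx0) (norm_nonneg _) (by positivity)
      have i2 : (ψ x * y x) ^ (q - 1) = (ψ x) ^ (q - 1) * ((z x + ε) ^ (1 - q) * ‖gradient z x‖ ^ (q - 1)) := by
        rw [Real.mul_rpow hψx hy0]
        simp only [hy]
        rw [Real.div_rpow (norm_nonneg _) hP.le, show 1 - q = -(q - 1) by ring, Real.rpow_neg hP.le]
        ring
      rw [i2, hQ]
      have i3 : 0 ≤ (z x + ε) ^ (1 - q) * (q * (ψ x) ^ (q - 1)) := by positivity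
      have j := mul_le_mul_of_nonneg_left i1 i3
      refine le_trans (le_of_eq ?_) (j.trans (le_of_eq ?_)) <;> ring
    have e3 := pow_young hq (mul_nonneg hψx hy0) zero_le_one ht00
    rw [mul_one, Real.one_rpow, mul_one] at e3
    have e4 : (ψ x) ^ q * ((1 - q) * (z x + ε) ^ (1 - q - 1) * ⟪Z x, gradient z x⟫) +
        (z x + ε) ^ (1 - q) * (q * (ψ x) ^ (q - 1) * ⟪Z x, gradient ψ x⟫) ≤
        Cc - c1 * (ψ x * y x) ^ q := by
      have i5 : 0 ≤ (ψ x * y x) ^ q := by positivity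
      have i6 := mul_le_mul_of_nonneg_left e3 hQ0
      have i7 := mul_le_mul_of_nonneg_right hQt i5
      have i8 : Q * (t0 * (ψ x * y x) ^ q + t0 ^ (1 - q)) = Q * t0 * (ψ x * y x) ^ q + Cc := by
        rw [hCc]; ring
      linarith
    have e5 := mul_le_mul_of_nonneg_left e4 (hT0 x)
    have e6 : T x * Cc ≤ Cc := by nlinarith [hT1 x]
    have e7 : T x * (Cc - c1 * (ψ x * y x) ^ q) = T x * Cc - c1 * (T x * (ψ x * y x) ^ q) := by ring
    rw [e7] at e5
    linarith only [t1, e5, e6]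
  have hI1 : IntegrableOn (fun x => L.indicator (fun _ => B) x + Cc) D := by
    refine Integrable.add ?_ (integrableOn_const (HA_finite a ρ ρ0))
    have hLm : MeasurableSet L := by
      apply IsClosed.measurableSet
      have h2 : IsClosed {x : EuclideanSpace ℝ (Fin N) | ρ0 - 2 / k ≤ ‖x‖} := isClosed_le (by fun_prop) (by fun_prop)
      have h3 : IsClosed {x : EuclideanSpace ℝ (Fin N) | ‖x‖ ≤ ρ0 - 1 / k} := isClosed_le (by fun_prop) (by fun_prop)
      exact h2.inter h3
    exact (integrableOn_const (HA_finite a ρ ρ0)).indicator hLm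
  have hyc : ContinuousOn y D := by
    apply ContinuousOn.div (hz.cont_grad hD).norm (hz.continuousOn.add continuousOn_const)
    intro x hx; exact (hPpos x hx).ne'
  have hI2 : IntegrableOn (fun x => T x * (ψ x * y x) ^ q) D := by
    refine intOn_of_compact hD ?_ hKc hKD ?_
    · refine ContinuousOn.mul (contDiffOn_Tk a k ρ ρ0 ρ0).continuousOn ?_
      exact ((contDiffOn_psi a κ ρ1 ρ ρ0).continuousOn.mul hyc).rpow_const fun _ _ => Or.inr (by linarith)
    · intro x _ hx
      rcases psiT_zero hk0 hx with h | h
      · simp only [hψ]; rw [h, zero_mul, Real.zero_rpow (by linarith), mul_zero]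
      · simp only [hT]; rw [h, zero_mul]
  have hfin := (hw φ hφT hφ0).trans (setIntegral_mono_on (hφT.inner_integrable hD hZ)
    (hI1.sub (hI2.const_mul c1)) hD.measurableSet hpt)
  have hLm : MeasurableSet L := by
    apply IsClosed.measurableSet
    have h2 : IsClosed {x : EuclideanSpace ℝ (Fin N) | ρ0 - 2 / k ≤ ‖x‖} := isClosed_le (by fun_prop) (by fun_prop)
    have h3 : IsClosed {x : EuclideanSpace ℝ (Fin N) | ‖x‖ ≤ ρ0 - 1 / k} := isClosed_le (by fun_prop) (by fun_prop)
    exact h2.inter h3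
  have hI3 : IntegrableOn (L.indicator (fun _ => B)) D :=
    (integrableOn_const (HA_finite a ρ ρ0)).indicator hLm
  have hLfin : volume L ≠ ∞ := by
    refine ne_top_of_le_ne_top (measure_closedBall_lt_top (x := 0) (r := ρ0 - 1 / k)).ne (measure_mono ?_)
    intro x hx; simpa using hx.2
  have hLint : ∫ x in D, L.indicator (fun _ => B) x ≤ 1 := by
    rw [setIntegral_indicator hLm, setIntegral_const, smul_eq_mul]
    have j1 : volume.real (D ∩ L) ≤ Cl / k :=
      (measureReal_mono inter_subset_right hLfin).trans (hCl k hk0 (by linarith))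
    calc _ ≤ Cl / k * B := by gcongr
      _ = ε ^ (1 - q) * S1 * Cl * η := by rw [hB]; field_simp
      _ ≤ 1 := hηs
  simp only [Pi.sub_apply] at hfin
  rw [integral_sub hI1 (hI2.const_mul c1), integral_add hI3 (integrableOn_const (HA_finite a ρ ρ0)),
    setIntegral_const, smul_eq_mul, integral_const_mul] at hfin
  rw [le_div_iff₀ hc10]
  linarith
end loglemma

section loglemma2
variable {N : ℕ}

set_option maxHeartbeats 1000000 in
theorem log_poincare {q ρ ρ0 κ ρ1 C : ℝ} (hq : 1 < q)
    (h01 : ρ < ρ1) (h1 : 0 < ρ0) (hκ : 0 < κ) (hC : 0 ≤ C)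
    {a : EuclideanSpace ℝ (Fin N)} (ha : ‖a‖ = 1)
    {z : EuclideanSpace ℝ (Fin N) → ℝ}
    (hz : ContDiffOn ℝ 1 z (HA a ρ ρ0)) (hz0 : ∀ x ∈ HA a ρ ρ0, 0 ≤ z x)
    (hz1 : ∀ η > 0, ∃ τ > 0, ∀ x ∈ HA a ρ ρ0, ρ0 - τ < ‖x‖ → z x ≤ η)
    (hE : ∀ ε > 0, ∀ τ > 0, ∃ k > 0, 2 / k ≤ τ ∧
      ∫ x in HA a ρ ρ0, Tk ρ0 k x * (psi a κ ρ1 x * (‖gradient z x‖ / (z x + ε))) ^ q ≤ C) :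
    ∃ C6 : ℝ, 0 ≤ C6 ∧ ∀ ε > 0, IntegrableOn (fun x => (psi a κ ρ1 x) ^ q *
      (max (Real.log (z x + ε) - Real.log ε - 1) 0) ^ q) (HA a ρ ρ0) ∧
      ∫ x in HA a ρ ρ0, (psi a κ ρ1 x) ^ q * (max (Real.log (z x + ε) - Real.log ε - 1) 0) ^ q ≤ C6 := by
  set D := HA a ρ ρ0 with hDdef
  have hD : IsOpen D := isOpen_HA a ρ ρ0
  set ψ := psi a κ ρ1 with hψ
  set t := 1 / (2 * (ρ0 * q)) with ht
  have ht0 : 0 < t := by positivity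
  refine ⟨2 * (ρ0 * q * t ^ (1 - q) * C), by positivity, ?_⟩
  intro ε hε
  have hψ0 := psi_nonneg a κ ρ1
  obtain ⟨τ, hτ, hτz⟩ := hz1 ε hε
  obtain ⟨k, hk0, hkτ, hkC⟩ := hE ε hε τ hτ
  have hPpos : ∀ x ∈ D, 0 < z x + ε := fun x hx => by linarith [hz0 x hx]
  set w1 := fun x => max (Real.log (z x + ε) - Real.log ε - 1) 0 with hw1
  have hw10 : ∀ x, 0 ≤ w1 x := fun x => le_max_right _ _
  have hw1z : ∀ x ∈ D, ρ0 - τ < ‖x‖ → w1 x = 0 := by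
    intro x hx hx2
    apply max_eq_right
    have h2 : Real.log (z x + ε) ≤ Real.log (2 * ε) :=
      Real.log_le_log (hPpos x hx) (by linarith [hτz x hx hx2])
    rw [Real.log_mul two_ne_zero hε.ne'] at h2
    have := Real.log_two_lt_d9
    linarith
  set f : EuclideanSpace ℝ (Fin N) → ℝ := D.indicator fun x => (ψ x) ^ q * (w1 x) ^ q with hf
  set K := {x : EuclideanSpace ℝ (Fin N) | κ ≤ ⟪a, x⟫ ∧ ρ1 ≤ ‖x‖ ∧ ‖x‖ ≤ ρ0 - τ} with hK
  have hKc : IsCompact K := HA_compact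
  have hKD : K ⊆ D := by
    intro x hx
    exact ⟨lt_of_lt_of_le hκ hx.1, lt_of_lt_of_le h01 hx.2.1, lt_of_le_of_lt hx.2.2 (by linarith)⟩
  have hlog : ContDiffOn ℝ 1 (fun x => Real.log (z x + ε) - Real.log ε - 1) D := by
    refine ((ContDiffOn.log (hz.add contDiffOn_const) fun x hx => (hPpos x hx).ne').sub
      contDiffOn_const).sub contDiffOn_const
  have hff : ContDiffOn ℝ 1 (fun x => (ψ x) ^ q * (w1 x) ^ q) D := by
    refine ContDiffOn.mul ?_ ((contDiff_posq hq).comp_contDiffOn hlog)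
    exact (contDiffOn_psi a κ ρ1 ρ ρ0).rpow_const_of_le (m := 1) (by exact_mod_cast hq.le)
  have hfT : T1 D f := by
    refine T1.of_compact hD ?_ hKc hKD ?_
    · exact hff.congr fun x hx => indicator_of_mem hx _
    · intro x hx
      by_cases hxD : x ∈ D
      · rw [hf, indicator_of_mem hxD]
        simp only [hK, mem_ofPred_eq, not_and_or, not_le] at hx
        rcases hx with h | h | h
        · rw [hψ, psi, Real.smoothTransition.zero_of_nonpos (by linarith : ⟪a, x⟫ - κ ≤ 0), mul_zero,
            Real.zero_rpow (by linarith), zero_mul]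
        · rw [hψ, psi, Real.smoothTransition.zero_of_nonpos (by linarith : ‖x‖ - ρ1 ≤ 0), zero_mul,
            Real.zero_rpow (by linarith), zero_mul]
        · rw [hw1z x hxD h, Real.zero_rpow (by linarith), mul_zero]
      · rw [hf, indicator_of_notMem hxD]
  have hgrad : ∀ x ∈ D, gradient f x = (ψ x) ^ q • ((q * (w1 x) ^ (q - 1)) • ((z x + ε)⁻¹ • gradient z x)) +
      (w1 x) ^ q • ((q * (ψ x) ^ (q - 1)) • gradient ψ x) := by
    intro x hx
    have hx0 := HA_ne hx
    have e : f =ᶠ[𝓝 x] fun x => (ψ x) ^ q * (w1 x) ^ q := by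
      filter_upwards [hD.mem_nhds hx] with x hx
      exact indicator_of_mem hx _
    rw [e.gradient_eq]
    apply HasGradientAt.gradient
    have g1 : HasGradientAt ψ (gradient ψ x) x := (psi_hga a κ ρ1 hx0).differentiableAt.hasGradientAt
    have g3 := hga_add_const ε (hz.hga hD hx)
    have g4 := hga_comp (F := fun t => t ^ q) (Real.hasDerivAt_rpow_const (Or.inr hq.le)) g1
    have g5 := hga_comp (f := fun x => z x + ε) (F := Real.log)
      (Real.hasDerivAt_log (hPpos x hx).ne') g3
    have g6 := hga_add_const (-1) (hga_add_const (-Real.log ε) g5)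
    have g7 := hga_comp (F := fun t : ℝ => (max t 0) ^ q) (hasDerivAt_posq hq _) g6
    exact hga_mul g4 g7
  set y := fun x => ‖gradient z x‖ / (z x + ε) with hy
  have hyc : ContinuousOn y D := by
    apply ContinuousOn.div (hz.cont_grad hD).norm (hz.continuousOn.add continuousOn_const)
    intro x hx; exact (hPpos x hx).ne'
  set T : EuclideanSpace ℝ (Fin N) → ℝ := Tk ρ0 k with hT
  have hT0 : ∀ x, 0 ≤ T x := fun x => Real.smoothTransition.nonneg _
  have hpt : ∀ x ∈ D, -(⟪a, x⟫ * ⟪a, gradient f x⟫) ≤ 1 / 2 * f x +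
      ρ0 * q * t ^ (1 - q) * (T x * (ψ x * y x) ^ q) := by
    intro x hx
    have hx0 := HA_ne hx
    have hP := hPpos x hx
    have hy0 : 0 ≤ y x := by simp only [hy]; positivity
    have hψx : 0 ≤ ψ x := hψ0 x
    have hwx : 0 ≤ w1 x := hw10 x
    have hTx := hT0 x
    have hfx : f x = (ψ x) ^ q * (w1 x) ^ q := by rw [hf, indicator_of_mem hx]
    rw [hgrad x hx]
    simp only [inner_add_right, real_inner_smul_right]
    have hax : 0 < ⟪a, x⟫ := hx.1
    have haρ : ⟪a, x⟫ ≤ ρ0 := by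
      refine (real_inner_le_norm a x).trans ?_
      rw [ha, one_mul]; exact hx.2.2.le
    rcases hwx.eq_or_lt with h | h
    · rw [hfx, ← h, Real.zero_rpow (by linarith), Real.zero_rpow (by linarith)]
      simp
      positivity
    · have hxτ : ‖x‖ ≤ ρ0 - τ := by
        by_contra h2; push Not at h2; exact h.ne' (hw1z x hx h2)
      have hT1 : T x = 1 := by
        apply Real.smoothTransition.one_of_one_le
        have : k * (2 / k) ≤ k * (ρ0 - ‖x‖) := by gcongr; linarith
        have h2 : k * (2 / k) = 2 := by field_simp
        linarith
      have j1 : 0 ≤ ⟪a, gradient ψ x⟫ := psi_grad_inner κ ρ1 hx0 hax.le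
      have j2 : -((z x + ε)⁻¹ * ⟪a, gradient z x⟫) ≤ y x := by
        have := neg_le_of_abs_le (abs_real_inner_le_norm a (gradient z x))
        rw [ha, one_mul] at this
        simp only [hy]
        rw [div_eq_inv_mul, ← mul_neg]
        gcongr; linarith
      have j3 := pow_young hq (mul_nonneg hψx hwx) (mul_nonneg hψx hy0) ht0
      have j4 : (ψ x * w1 x) ^ (q - 1) * (ψ x * y x) = (ψ x) ^ q * (w1 x) ^ (q - 1) * y x := by
        rw [Real.mul_rpow hψx hwx]
        have : (ψ x) ^ q = (ψ x) ^ (q - 1) * ψ x := by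
          rw [← Real.rpow_add_one' hψx (by linarith)]; ring_nf
        rw [this]; ring
      have j5 : (ψ x * w1 x) ^ q = f x := by rw [hfx, Real.mul_rpow hψx hwx]
      rw [j4, j5] at j3
      rw [hT1, one_mul]
      have j6 : 0 ≤ ⟪a, x⟫ * ((w1 x) ^ q * (q * (ψ x) ^ (q - 1) * ⟪a, gradient ψ x⟫)) := by positivity
      have j7 : -(⟪a, x⟫ * ((ψ x) ^ q * (q * (w1 x) ^ (q - 1) * ((z x + ε)⁻¹ * ⟪a, gradient z x⟫)))) ≤
          ρ0 * q * ((ψ x) ^ q * (w1 x) ^ (q - 1) * y x) := by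
        calc _ = (⟪a, x⟫ * ((ψ x) ^ q * (q * (w1 x) ^ (q - 1)))) * (-((z x + ε)⁻¹ * ⟪a, gradient z x⟫)) := by ring
          _ ≤ (⟪a, x⟫ * ((ψ x) ^ q * (q * (w1 x) ^ (q - 1)))) * y x := by gcongr
          _ ≤ (ρ0 * ((ψ x) ^ q * (q * (w1 x) ^ (q - 1)))) * y x := by gcongr
          _ = _ := by ring
      have j8 := mul_le_mul_of_nonneg_left j3 (by positivity : 0 ≤ ρ0 * q)
      have j9 : ρ0 * q * t = 1 / 2 := by rw [ht]; field_simp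
      have j10 : ρ0 * q * (t * f x + t ^ (1 - q) * (ψ x * y x) ^ q) = 1 / 2 * f x +
          ρ0 * q * t ^ (1 - q) * (ψ x * y x) ^ q := by
        rw [← j9]; ring
      rw [j10] at j8
      rw [mul_add, neg_add]
      linarith only [j6, j7, j8]
  set K2 := {x : EuclideanSpace ℝ (Fin N) | κ ≤ ⟪a, x⟫ ∧ ρ1 ≤ ‖x‖ ∧ ‖x‖ ≤ ρ0 - 1 / k} with hK2
  have hK2c : IsCompact K2 := HA_compact
  have hK2D : K2 ⊆ D := by
    intro x hx
    refine ⟨lt_of_lt_of_le hκ hx.1, lt_of_lt_of_le h01 hx.2.1, lt_of_le_of_lt hx.2.2 ?_⟩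
    have : 0 < 1 / k := by positivity
    linarith
  have hI2 : IntegrableOn (fun x => T x * (ψ x * y x) ^ q) D := by
    refine intOn_of_compact hD ?_ hK2c hK2D ?_
    · refine ContinuousOn.mul (contDiffOn_Tk a k ρ ρ0 ρ0).continuousOn ?_
      exact ((contDiffOn_psi a κ ρ1 ρ ρ0).continuousOn.mul hyc).rpow_const fun _ _ => Or.inr (by linarith)
    · intro x _ hx
      rcases psiT_zero hk0 hx with h | h
      · simp only [hψ]; rw [h, zero_mul, Real.zero_rpow (by linarith), mul_zero]
      · simp only [hT]; rw [h, zero_mul]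
  have hIf : IntegrableOn f D := (hfT.cd.continuous.integrable_of_hasCompactSupport hfT.cs).integrableOn
  have hI0 : IntegrableOn (fun x => -(⟪a, x⟫ * ⟪a, gradient f x⟫)) D := by
    refine Integrable.neg ?_
    refine intOn_of_compact hD ?_ hfT.cs.isCompact hfT.sub ?_
    · have := hfT.cd.cont_grad
      exact Continuous.continuousOn (by fun_prop)
    · intro x _ hx; rw [gradient_eq_zero_off hx]; simp
  have hmain := setIntegral_mono_on hI0 ((hIf.const_mul (1 / 2)).add
    (hI2.const_mul (ρ0 * q * t ^ (1 - q)))) hD.measurableSet hpt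
  simp only [Pi.add_apply] at hmain
  rw [integral_neg, ← poincare_id hfT ha, integral_add (hIf.const_mul (1 / 2))
    (hI2.const_mul (ρ0 * q * t ^ (1 - q))), integral_const_mul, integral_const_mul] at hmain
  have hle := mul_le_mul_of_nonneg_left hkC (by positivity : 0 ≤ ρ0 * q * t ^ (1 - q))
  have heq : ∫ x in D, (ψ x) ^ q * (w1 x) ^ q = ∫ x in D, f x :=
    setIntegral_congr_fun hD.measurableSet fun x hx => by
      simp only [hf]; rw [indicator_of_mem hx]
  refine ⟨?_, ?_⟩
  · exact hIf.congr_fun (fun x hx => indicator_of_mem hx _) hD.measurableSet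
  · rw [heq]; linarith

set_option maxHeartbeats 1000000 in
theorem log_lemma {q m M ρ ρ0 : ℝ} (hq : 1 < q) (hm : 0 < m) (hM : 0 ≤ M)
    (h1 : 0 < ρ0) {a : EuclideanSpace ℝ (Fin N)} (ha : ‖a‖ = 1)
    {z : EuclideanSpace ℝ (Fin N) → ℝ} {Z : EuclideanSpace ℝ (Fin N) → EuclideanSpace ℝ (Fin N)}
    (hz : ContDiffOn ℝ 1 z (HA a ρ ρ0)) (hz0 : ∀ x ∈ HA a ρ ρ0, 0 ≤ z x)
    (hZ : ContinuousOn Z (HA a ρ ρ0))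
    (hZ1 : ∀ x ∈ HA a ρ ρ0, m * ‖gradient z x‖ ^ q ≤ ⟪Z x, gradient z x⟫)
    (hZ2 : ∀ x ∈ HA a ρ ρ0, ‖Z x‖ ≤ M * ‖gradient z x‖ ^ (q - 1))
    (hZ0 : ∀ η > 0, ∃ τ > 0, ∀ x ∈ HA a ρ ρ0, ρ0 - τ < ‖x‖ → ‖Z x‖ ≤ η)
    (hz1 : ∀ η > 0, ∃ τ > 0, ∀ x ∈ HA a ρ ρ0, ρ0 - τ < ‖x‖ → z x ≤ η)
    (hw : ∀ φ, T1 (HA a ρ ρ0) φ → (∀ x, 0 ≤ φ x) → 0 ≤ ∫ x in HA a ρ ρ0, ⟪Z x, gradient φ x⟫) :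
    ∀ x ∈ HA a ρ ρ0, z x = 0 := by
  intro x0 hx0
  by_contra hne
  have hzx : 0 < z x0 := lt_of_le_of_ne (hz0 x0 hx0) (Ne.symm hne)
  have hD : IsOpen (HA a ρ ρ0) := isOpen_HA a ρ ρ0
  set κ := ⟪a, x0⟫ / 2 with hκ
  set ρ1 := (ρ + ‖x0‖) / 2 with hρ1
  have hκ0 : 0 < κ := by have := hx0.1; positivity
  have h01 : ρ < ρ1 := by have := hx0.2.1; rw [hρ1]; linarith
  obtain ⟨C, hC0, hC⟩ := log_energy hq hm hM h01 h1 hκ0 ha hz hz0 hZ hZ1 hZ2 hZ0 hw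
  obtain ⟨C6, hC60, hC6⟩ := log_poincare hq h01 h1 hκ0 hC0 ha hz hz0 hz1 hC
  have hψx : 0 < psi a κ ρ1 x0 := by
    apply mul_pos <;> apply Real.smoothTransition.pos_of_pos
    · have := hx0.2.1; rw [hρ1]; linarith
    · have := hx0.1; rw [hκ]; linarith
  have hc1 : ContinuousAt z x0 := hz.continuousOn.continuousAt (hD.mem_nhds hx0)
  have hc2 : ContinuousAt (psi a κ ρ1) x0 :=
    (contDiffOn_psi a κ ρ1 ρ ρ0).continuousOn.continuousAt (hD.mem_nhds hx0)
  have hev : ∀ᶠ x in 𝓝 x0, x ∈ HA a ρ ρ0 ∧ z x0 / 2 < z x ∧ psi a κ ρ1 x0 / 2 < psi a κ ρ1 x :=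
    (hD.eventually_mem hx0).and ((hc1.eventually (lt_mem_nhds (by linarith))).and
      (hc2.eventually (lt_mem_nhds (by linarith))))
  obtain ⟨r, hr, hball⟩ := Metric.eventually_nhds_iff_ball.mp hev
  set v := volume.real (ball x0 r) with hv
  have hv0 : 0 < v := by
    rw [hv, measureReal_def]
    exact ENNReal.toReal_pos (measure_ball_pos _ _ hr).ne' measure_ball_lt_top.ne
  set c := (psi a κ ρ1 x0 / 2) ^ q with hc
  have hc0 : 0 < c := by positivity
  set L := 1 + C6 / (c * v) with hL
  have hL1 : 1 ≤ L := by rw [hL]; have : 0 ≤ C6 / (c * v) := by positivity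
                         linarith
  set ε := z x0 / 2 * Real.exp (-(1 + L)) with hε
  have hε0 : 0 < ε := by positivity
  obtain ⟨hInt0, hle⟩ := hC6 ε hε0
  have hsub : ball x0 r ⊆ HA a ρ ρ0 := fun x hx => (hball x hx).1
  have hpt : ∀ x ∈ ball x0 r, c * L ≤ (psi a κ ρ1 x) ^ q *
      (max (Real.log (z x + ε) - Real.log ε - 1) 0) ^ q := by
    intro x hx
    obtain ⟨hxD, hxz, hxψ⟩ := hball x hx
    have hw : L ≤ Real.log (z x + ε) - Real.log ε - 1 := by
      have e1 : Real.log (z x0 / 2) ≤ Real.log (z x + ε) := Real.log_le_log (by positivity) (by linarith)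
      have e2 : Real.log ε = Real.log (z x0 / 2) - (1 + L) := by
        rw [hε, Real.log_mul (by positivity) (by positivity), Real.log_exp]; ring
      linarith
    have i1 : c ≤ (psi a κ ρ1 x) ^ q := Real.rpow_le_rpow (by positivity) hxψ.le (by linarith)
    have i2 : L ≤ (max (Real.log (z x + ε) - Real.log ε - 1) 0) ^ q := by
      have : L ≤ L ^ q := by
        conv_lhs => rw [← Real.rpow_one L]
        exact Real.rpow_le_rpow_of_exponent_le hL1 hq.le
      refine this.trans (Real.rpow_le_rpow (by linarith) (hw.trans (le_max_left _ _)) (by linarith))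
    exact mul_le_mul i1 i2 (by linarith) (Real.rpow_nonneg (psi_nonneg a κ ρ1 x) q)
  have h2 : v * (c * L) ≤ ∫ x in ball x0 r, (psi a κ ρ1 x) ^ q *
      (max (Real.log (z x + ε) - Real.log ε - 1) 0) ^ q := by
    have := setIntegral_mono_on (integrableOn_const measure_ball_lt_top.ne)
      (hInt0.mono_set hsub) measurableSet_ball hpt
    rwa [setIntegral_const, smul_eq_mul] at this
  have h3 := setIntegral_mono_set hInt0 (ae_of_all _ fun x =>
    mul_nonneg (Real.rpow_nonneg (psi_nonneg a κ ρ1 x) q)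
      (Real.rpow_nonneg (le_max_right (Real.log (z x + ε) - Real.log ε - 1) 0) q))
    (hsub.eventuallyLE)
  have h4 : v * (c * L) = v * c + C6 := by rw [hL]; field_simp
  have : 0 < v * c := by positivity
  linarith
end loglemma2

section PF
variable {N : ℕ}

theorem picone_pt {p : ℝ} (hp : 1 < p) {P Q θ r : ℝ} (hP : 0 < P) (hQ : 0 < Q)
    (U V : EuclideanSpace ℝ (Fin N)) :
    P ^ p * (2 * θ * r) * ⟪pa p U - pa p V, U - V⟫ ≤
      ⟪pa p (P • U), P • (θ ^ 2 • U + (2 * θ * r) • (U - V))⟫ -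
      ⟪pa p (Q • V), (P ^ p * Q ^ (1 - p)) • (θ ^ 2 • (p • U + (1 - p) • V) + (2 * θ * r) • (U - V))⟫ := by
  have hPp : P ^ (p - 1) * P = P ^ p := by rw [← Real.rpow_add_one hP.ne']; ring_nf
  have hQp : Q ^ (p - 1) * Q ^ (1 - p) = 1 := by rw [← Real.rpow_add hQ]; simp
  have hpi := picone_ineq hp U V
  rw [pa_smul hp hP, pa_smul hp hQ]
  simp only [inner_smul_left, inner_smul_right, inner_add_right, inner_sub_left, inner_sub_right,
    inner_pa_self hp, conj_trivial]
  have h1 : P ^ p * θ ^ 2 * (p * ⟪pa p V, U⟫) ≤ P ^ p * θ ^ 2 * ((p - 1) * ‖V‖ ^ p + ‖U‖ ^ p) :=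
    mul_le_mul_of_nonneg_left hpi (by positivity)
  have e1 : ∀ X : ℝ, P ^ (p - 1) * (P * X) = P ^ p * X := by intro X; rw [← mul_assoc, hPp]
  have e2 : ∀ X : ℝ, Q ^ (p - 1) * (P ^ p * Q ^ (1 - p) * X) = P ^ p * X := by
    intro X
    calc _ = (Q ^ (p - 1) * Q ^ (1 - p)) * (P ^ p * X) := by ring
      _ = _ := by rw [hQp, one_mul]
  have e3 : P * (θ ^ 2 * (P ^ (p - 1) * ‖U‖ ^ p) + 2 * θ * r * (P ^ (p - 1) * ‖U‖ ^ p
      - P ^ (p - 1) * ⟪pa p U, V⟫)) = P ^ p * (θ ^ 2 * ‖U‖ ^ p + 2 * θ * r * (‖U‖ ^ p - ⟪pa p U, V⟫)) := by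
    refine Eq.trans ?_ (e1 _); ring
  have e4 : P ^ p * Q ^ (1 - p) *
        (θ ^ 2 * (p * (Q ^ (p - 1) * ⟪pa p V, U⟫) + (1 - p) * (Q ^ (p - 1) * ‖V‖ ^ p)) +
          2 * θ * r * (Q ^ (p - 1) * ⟪pa p V, U⟫ - Q ^ (p - 1) * ‖V‖ ^ p)) =
      P ^ p * (θ ^ 2 * (p * ⟪pa p V, U⟫ + (1 - p) * ‖V‖ ^ p) + 2 * θ * r * (⟪pa p V, U⟫ - ‖V‖ ^ p)) := by
    refine Eq.trans ?_ (e2 _); ring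
  rw [e3, e4]
  nlinarith [h1]

theorem hga_congr {f : EuclideanSpace ℝ (Fin N) → ℝ} {f' g' x : EuclideanSpace ℝ (Fin N)}
    (h : HasGradientAt f f' x) (e : f' = g') : HasGradientAt f g' x := e ▸ h

/-- ratio cut-off -/
noncomputable def cut (κ P Q : ℝ) : ℝ := max (1 - κ * Q / P) 0

theorem cut_nonneg (κ P Q : ℝ) : 0 ≤ cut κ P Q := le_max_right _ _

theorem cut_le_one {κ P Q : ℝ} (hκ : 0 ≤ κ) (hP : 0 < P) (hQ : 0 < Q) : cut κ P Q ≤ 1 := by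
  have : 0 ≤ κ * Q / P := by positivity
  exact max_le (by linarith) zero_le_one

theorem hga_cut {κ : ℝ} {P Q : EuclideanSpace ℝ (Fin N) → ℝ} {x U V : EuclideanSpace ℝ (Fin N)}
    (hP : 0 < P x) (hQ : 0 < Q x)
    (h1 : HasGradientAt P (P x • U) x) (h2 : HasGradientAt Q (Q x • V) x) :
    HasGradientAt (fun y => cut κ (P y) (Q y) ^ (2 : ℝ))
      ((2 * cut κ (P x) (Q x) * (κ * Q x / P x)) • (U - V)) x := by
  have hi : HasGradientAt (fun y => (P y)⁻¹) ((-((P x) ^ 2)⁻¹) • (P x • U)) x :=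
    hga_comp (hasDerivAt_inv hP.ne') h1
  have h3 := hga_const_mul (-1) (hga_mul (hga_const_mul κ h2) hi)
  have h4 := hga_add_const 1 h3
  have h5 := hga_comp (hasDerivAt_posq (q := 2) one_lt_two _) h4
  have e : ∀ y, -1 * (κ * Q y * (P y)⁻¹) + 1 = 1 - κ * Q y / P y := fun y => by ring
  simp only [e] at h5
  refine hga_congr h5 ?_
  simp only [cut]
  rw [show (2 : ℝ) - 1 = 1 by norm_num, Real.rpow_one]
  simp only [smul_smul, smul_add, smul_sub]
  have : P x ≠ 0 := hP.ne'
  match_scalars <;> field_simp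

set_option maxHeartbeats 1000000 in
theorem compare_abs {p lam M : ℝ} (hp : 1 < p) (hl : 0 ≤ lam) {D : Set (EuclideanSpace ℝ (Fin N))}
    (hD : IsOpen D) (hDv : volume D ≠ ∞) {u v : EuclideanSpace ℝ (Fin N) → ℝ}
    (hu : ContDiffOn ℝ 1 u D) (hv : ContDiffOn ℝ 1 v D)
    (hu0 : ∀ x ∈ D, 0 < u x) (hv0 : ∀ x ∈ D, 0 < v x) (huM : ∀ x ∈ D, u x ≤ M)
    {κ : ℝ} (hκ : 1 < κ) (hK : ∀ δ > 0, IsCompact {x | x ∈ D ∧ δ ≤ u x - κ * v x})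
    (hwu : ∀ φ, T1 D φ → ∫ x in D, ⟪pa p (gradient u x), gradient φ x⟫ =
      ∫ x in D, lam * u x ^ (p - 1) * φ x)
    (hwv : ∀ φ, T1 D φ → ∫ x in D, ⟪pa p (gradient v x), gradient φ x⟫ =
      ∫ x in D, lam * v x ^ (p - 1) * φ x)
    {x0 : EuclideanSpace ℝ (Fin N)} (hx0 : x0 ∈ D) (hlt : κ * v x0 < u x0) :
    (u x0)⁻¹ • gradient u x0 = (v x0)⁻¹ • gradient v x0 := by
  have hgu := hu.cont_grad hD
  have hgv := hv.cont_grad hD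
  have huc := hu.continuousOn
  have hvc := hv.continuousOn
  have hpac := continuous_pa (E := EuclideanSpace ℝ (Fin N)) hp
  set J : ℝ → EuclideanSpace ℝ (Fin N) → ℝ := fun ε x =>
    (u x + ε) ^ p * (2 * cut κ (u x + ε) (v x + ε) * (κ * (v x + ε) / (u x + ε))) *
      ⟪pa p ((u x + ε)⁻¹ • gradient u x) - pa p ((v x + ε)⁻¹ • gradient v x),
        (u x + ε)⁻¹ • gradient u x - (v x + ε)⁻¹ • gradient v x⟫ with hJ
  set G : ℝ → EuclideanSpace ℝ (Fin N) → ℝ := fun ε x =>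
    lam * ((u x + ε) ^ p * cut κ (u x + ε) (v x + ε) ^ (2 : ℝ)) *
      ((u x / (u x + ε)) ^ (p - 1) - (v x / (v x + ε)) ^ (p - 1)) with hG
  have hJ0 : ∀ ε ≥ 0, ∀ x ∈ D, 0 ≤ J ε x := by
    intro ε hε x hx
    have := hu0 x hx
    have := hv0 x hx
    have := cut_nonneg κ (u x + ε) (v x + ε)
    have h3 := pa_mono hp ((u x + ε)⁻¹ • gradient u x) ((v x + ε)⁻¹ • gradient v x)
    simp only [hJ]
    positivity
  -- the main inequality
  have key : ∀ ε > 0, IntegrableOn (J ε) D ∧ ∫ x in D, J ε x ≤ ∫ x in D, G ε x := by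
    intro ε hε
    set K := {x | x ∈ D ∧ ε * (κ - 1) ≤ u x - κ * v x} with hKdef
    have hKc : IsCompact K := hK _ (by nlinarith)
    have hKD : K ⊆ D := fun x hx => hx.1
    have hP0 : ∀ x ∈ D, 0 < u x + ε := fun x hx => by have := hu0 x hx; linarith
    have hQ0 : ∀ x ∈ D, 0 < v x + ε := fun x hx => by have := hv0 x hx; linarith
    have hcut0 : ∀ x ∈ D, x ∉ K → cut κ (u x + ε) (v x + ε) = 0 := by
      intro x hx hxK
      have h1 : ¬ ε * (κ - 1) ≤ u x - κ * v x := fun h => hxK ⟨hx, h⟩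
      push Not at h1
      apply max_eq_right
      have : 1 ≤ κ * (v x + ε) / (u x + ε) := by
        rw [le_div_iff₀ (hP0 x hx)]; linarith
      linarith
    have hPcd : ContDiffOn ℝ 1 (fun x => u x + ε) D := hu.add contDiffOn_const
    have hQcd : ContDiffOn ℝ 1 (fun x => v x + ε) D := hv.add contDiffOn_const
    have hθcd : ContDiffOn ℝ 1 (fun x => cut κ (u x + ε) (v x + ε) ^ (2 : ℝ)) D := by
      refine (contDiff_posq (q := 2) one_lt_two).comp_contDiffOn
        (f := fun x => 1 - κ * (v x + ε) / (u x + ε)) ?_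
      exact contDiffOn_const.sub ((contDiffOn_const.mul hQcd).div hPcd fun x hx => (hP0 x hx).ne')
    have hθc : ContinuousOn (fun x => cut κ (u x + ε) (v x + ε)) D := by
      unfold cut
      exact ContinuousOn.sup (continuousOn_const.sub ((continuousOn_const.mul hQcd.continuousOn).div
        hPcd.continuousOn fun x hx => (hP0 x hx).ne')) continuousOn_const
    set f1 : EuclideanSpace ℝ (Fin N) → ℝ := fun x =>
      (u x + ε) * cut κ (u x + ε) (v x + ε) ^ (2 : ℝ) with hf1
    set f2 : EuclideanSpace ℝ (Fin N) → ℝ := fun x =>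
      ((u x + ε) ^ p * (v x + ε) ^ (1 - p)) * cut κ (u x + ε) (v x + ε) ^ (2 : ℝ) with hf2
    have ind : ∀ f : EuclideanSpace ℝ (Fin N) → ℝ, ContDiffOn ℝ 1 f D →
        (∀ x ∈ D, x ∉ K → f x = 0) → T1 D (D.indicator f) ∧
        ∀ x ∈ D, gradient (D.indicator f) x = gradient f x := by
      intro f hf h0
      refine ⟨T1.of_compact hD (hf.congr fun x hx => indicator_of_mem hx _) hKc hKD ?_, ?_⟩
      · intro x hx
        by_cases hxD : x ∈ D
        · rw [indicator_of_mem hxD, h0 x hxD hx]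
        · exact indicator_of_notMem hxD _
      · intro x hx
        refine ((hf.hga hD hx).congr_of_eventuallyEq ?_).gradient
        filter_upwards [hD.mem_nhds hx] with y hy
        exact indicator_of_mem hy _
    obtain ⟨t1, g1⟩ := ind f1 (hPcd.mul hθcd) (fun x hx hxK => by
      simp [hf1, hcut0 x hx hxK])
    obtain ⟨t2, g2⟩ := ind f2 (((hPcd.rpow_const_of_ne fun x hx => (hP0 x hx).ne').mul
      (hQcd.rpow_const_of_ne fun x hx => (hQ0 x hx).ne')).mul hθcd) (fun x hx hxK => by
      simp [hf2, hcut0 x hx hxK])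
    have w1 := hwu _ t1
    have w2 := hwv _ t2
    have hZu : ContinuousOn (fun x => pa p (gradient u x)) D := hpac.comp_continuousOn hgu
    have hZv : ContinuousOn (fun x => pa p (gradient v x)) D := hpac.comp_continuousOn hgv
    have i1 := t1.inner_integrable hD hZu
    have i2 := t2.inner_integrable hD hZv
    have hfu : ContinuousOn (fun x => lam * u x ^ (p - 1)) D :=
      continuousOn_const.mul (huc.rpow_const fun x hx => Or.inl (hu0 x hx).ne')
    have hfv : ContinuousOn (fun x => lam * v x ^ (p - 1)) D :=
      continuousOn_const.mul (hvc.rpow_const fun x hx => Or.inl (hv0 x hx).ne')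
    have i3 := t1.mul_integrable hD hfu
    have i4 := t2.mul_integrable hD hfv
    have hJc : ContinuousOn (J ε) D := by
      have a1 : ContinuousOn (fun x => (u x + ε)⁻¹ • gradient u x) D :=
        (hPcd.continuousOn.inv₀ fun x hx => (hP0 x hx).ne').smul hgu
      have a2 : ContinuousOn (fun x => (v x + ε)⁻¹ • gradient v x) D :=
        (hQcd.continuousOn.inv₀ fun x hx => (hQ0 x hx).ne').smul hgv
      refine (ContinuousOn.mul (hPcd.continuousOn.rpow_const fun x hx => Or.inl (hP0 x hx).ne')
        ((continuousOn_const.mul hθc).mul ((continuousOn_const.mul hQcd.continuousOn).div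
        hPcd.continuousOn fun x hx => (hP0 x hx).ne'))).mul ?_
      exact ((hpac.comp_continuousOn a1).sub (hpac.comp_continuousOn a2)).inner (a1.sub a2)
    have iJ : IntegrableOn (J ε) D := intOn_of_compact hD hJc hKc hKD fun x hx hxK => by
      simp [hJ, hcut0 x hx hxK]
    refine ⟨iJ, ?_⟩
    have hle : ∫ x in D, J ε x ≤ ∫ x in D, (⟪pa p (gradient u x), gradient (D.indicator f1) x⟫ -
        ⟪pa p (gradient v x), gradient (D.indicator f2) x⟫) := by
      refine setIntegral_mono_on iJ (i1.sub i2) hD.measurableSet fun x hx => ?_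
      have hP := hP0 x hx
      have hQ := hQ0 x hx
      set U := (u x + ε)⁻¹ • gradient u x with hU
      set V := (v x + ε)⁻¹ • gradient v x with hV
      have eU : (u x + ε) • U = gradient u x := by rw [hU, smul_smul, mul_inv_cancel₀ hP.ne', one_smul]
      have eV : (v x + ε) • V = gradient v x := by rw [hV, smul_smul, mul_inv_cancel₀ hQ.ne', one_smul]
      have h1 : HasGradientAt (fun y => u y + ε) ((u x + ε) • U) x := by
        rw [eU]; exact hga_add_const ε (hu.hga hD hx)
      have h2 : HasGradientAt (fun y => v y + ε) ((v x + ε) • V) x := by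
        rw [eV]; exact hga_add_const ε (hv.hga hD hx)
      have h3 := hga_cut (κ := κ) (P := fun y => u y + ε) (Q := fun y => v y + ε) hP hQ h1 h2
      have hc := cut_nonneg κ (u x + ε) (v x + ε)
      have esq : cut κ (u x + ε) (v x + ε) ^ (2 : ℝ) = cut κ (u x + ε) (v x + ε) ^ 2 :=
        Real.rpow_two _
      have eg1 : gradient f1 x = (u x + ε) • (cut κ (u x + ε) (v x + ε) ^ 2 • U +
          (2 * cut κ (u x + ε) (v x + ε) * (κ * (v x + ε) / (u x + ε))) • (U - V)) := by
        rw [(hga_mul h1 h3).gradient, esq]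
        module
      have h4 := hga_comp (F := fun t => t ^ p) (f := fun y => u y + ε) (Real.hasDerivAt_rpow_const (p := p) (Or.inl hP.ne')) h1
      have h5 := hga_comp (F := fun t => t ^ (1 - p)) (f := fun y => v y + ε)
        (Real.hasDerivAt_rpow_const (p := 1 - p) (Or.inl hQ.ne')) h2
      have eg2 : gradient f2 x = ((u x + ε) ^ p * (v x + ε) ^ (1 - p)) •
          (cut κ (u x + ε) (v x + ε) ^ 2 • (p • U + (1 - p) • V) +
          (2 * cut κ (u x + ε) (v x + ε) * (κ * (v x + ε) / (u x + ε))) • (U - V)) := by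
        rw [(hga_mul (hga_mul h4 h5) h3).gradient, esq]
        have b1 : (u x + ε) ^ (p - 1) * (u x + ε) = (u x + ε) ^ p := by
          rw [← Real.rpow_add_one hP.ne']; ring_nf
        have b2 : (v x + ε) ^ (1 - p - 1) * (v x + ε) = (v x + ε) ^ (1 - p) := by
          rw [← Real.rpow_add_one hQ.ne']; ring_nf
        simp only [smul_smul, smul_add, smul_sub]
        rw [mul_assoc p, b1, mul_assoc (1 - p), b2]
        module
      rw [g1 x hx, g2 x hx, eg1, eg2, ← eU, ← eV]
      simp only [hJ]
      rw [← hU, ← hV]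
      exact picone_pt hp hP hQ U V
    rw [integral_sub i1 i2, w1, w2, ← integral_sub i3 i4] at hle
    refine hle.trans (le_of_eq (setIntegral_congr_fun hD.measurableSet fun x hx => ?_))
    have hP := hP0 x hx
    have hQ := hQ0 x hx
    simp only [hG, hf1, hf2, indicator_of_mem hx]
    rw [Real.div_rpow (hu0 x hx).le hP.le, Real.div_rpow (hv0 x hx).le hQ.le]
    have b1 : (u x + ε) ^ p = (u x + ε) ^ (p - 1) * (u x + ε) := by
      rw [← Real.rpow_add_one hP.ne']; ring_nf
    have b2 : (v x + ε) ^ (1 - p) = ((v x + ε) ^ (p - 1))⁻¹ := by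
      rw [← Real.rpow_neg hQ.le]; ring_nf
    rw [b2]
    have c1 : (u x + ε) ^ (p - 1) ≠ 0 := by positivity
    have c2 : (u x + ε) ^ p / (u x + ε) ^ (p - 1) = u x + ε := by rw [b1]; field_simp
    calc _ = lam * cut κ (u x + ε) (v x + ε) ^ (2 : ℝ) * (u x ^ (p - 1) * (u x + ε) -
          v x ^ (p - 1) * (u x + ε) ^ p * ((v x + ε) ^ (p - 1))⁻¹) := by ring
      _ = lam * cut κ (u x + ε) (v x + ε) ^ (2 : ℝ) * (u x ^ (p - 1) *
          ((u x + ε) ^ p / (u x + ε) ^ (p - 1)) -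
          v x ^ (p - 1) * (u x + ε) ^ p * ((v x + ε) ^ (p - 1))⁻¹) := by rw [c2]
      _ = _ := by ring
  have hcutc : ∀ {X : Type} [TopologicalSpace X] {P Q : X → ℝ} {x : X}, ContinuousAt P x →
      ContinuousAt Q x → P x ≠ 0 → ContinuousAt (fun y => cut κ (P y) (Q y)) x := by
    intro X _ P Q x h1 h2 h3
    unfold cut
    exact ContinuousAt.sup (continuousAt_const.sub ((continuousAt_const.mul h2).div h1 h3))
      continuousAt_const
  have hGc : ∀ {ε : ℝ} {x : EuclideanSpace ℝ (Fin N)}, 0 ≤ ε → x ∈ D →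
      ContinuousAt (fun z : ℝ × EuclideanSpace ℝ (Fin N) => G z.1 z.2) (ε, x) := by
    intro ε x hε hx
    have hux := hu0 x hx
    have hvx := hv0 x hx
    have cu : ContinuousAt (fun z : ℝ × EuclideanSpace ℝ (Fin N) => u z.2) (ε, x) :=
      ContinuousAt.comp (f := Prod.snd) (huc.continuousAt (hD.mem_nhds hx)) continuousAt_snd
    have cv : ContinuousAt (fun z : ℝ × EuclideanSpace ℝ (Fin N) => v z.2) (ε, x) :=
      ContinuousAt.comp (f := Prod.snd) (hvc.continuousAt (hD.mem_nhds hx)) continuousAt_snd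
    have cP : ContinuousAt (fun z : ℝ × EuclideanSpace ℝ (Fin N) => u z.2 + z.1) (ε, x) :=
      cu.add continuousAt_fst
    have cQ : ContinuousAt (fun z : ℝ × EuclideanSpace ℝ (Fin N) => v z.2 + z.1) (ε, x) :=
      cv.add continuousAt_fst
    have hP : u x + ε ≠ 0 := by linarith
    have hQ : v x + ε ≠ 0 := by linarith
    exact (continuousAt_const.mul ((cP.rpow_const (Or.inl hP)).mul ((hcutc cP cQ hP).rpow_const
      (Or.inr (by norm_num))))).mul (((cu.div cP hP).rpow_const (Or.inr (by linarith))).sub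
      ((cv.div cQ hQ).rpow_const (Or.inr (by linarith))))
  have hJc : ContinuousAt (fun z : ℝ × EuclideanSpace ℝ (Fin N) => J z.1 z.2) (0, x0) := by
    have hx := hx0
    have hux := hu0 x0 hx
    have hvx := hv0 x0 hx
    have cu : ContinuousAt (fun z : ℝ × EuclideanSpace ℝ (Fin N) => u z.2) (0, x0) :=
      ContinuousAt.comp (f := Prod.snd) (huc.continuousAt (hD.mem_nhds hx)) continuousAt_snd
    have cv : ContinuousAt (fun z : ℝ × EuclideanSpace ℝ (Fin N) => v z.2) (0, x0) :=
      ContinuousAt.comp (f := Prod.snd) (hvc.continuousAt (hD.mem_nhds hx)) continuousAt_snd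
    have cgu : ContinuousAt (fun z : ℝ × EuclideanSpace ℝ (Fin N) => gradient u z.2) (0, x0) :=
      ContinuousAt.comp (f := Prod.snd) (hgu.continuousAt (hD.mem_nhds hx)) continuousAt_snd
    have cgv : ContinuousAt (fun z : ℝ × EuclideanSpace ℝ (Fin N) => gradient v z.2) (0, x0) :=
      ContinuousAt.comp (f := Prod.snd) (hgv.continuousAt (hD.mem_nhds hx)) continuousAt_snd
    have cP : ContinuousAt (fun z : ℝ × EuclideanSpace ℝ (Fin N) => u z.2 + z.1) (0, x0) :=
      cu.add continuousAt_fst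
    have cQ : ContinuousAt (fun z : ℝ × EuclideanSpace ℝ (Fin N) => v z.2 + z.1) (0, x0) :=
      cv.add continuousAt_fst
    have hP : u x0 + 0 ≠ 0 := by linarith
    have hQ : v x0 + 0 ≠ 0 := by linarith
    have a1 := (cP.inv₀ hP).smul cgu
    have a2 := (cQ.inv₀ hQ).smul cgv
    refine ((cP.rpow_const (Or.inl hP)).mul ((continuousAt_const.mul (hcutc cP cQ hP)).mul
      ((continuousAt_const.mul cQ).div cP hP))).mul ?_
    exact ((hpac.continuousAt.comp a1).sub (hpac.continuousAt.comp a2)).inner (a1.sub a2)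
  have hlim : Tendsto (fun ε => ∫ x in D, G ε x) (𝓝[>] 0) (𝓝 (∫ _ in D, (0 : ℝ))) := by
    refine tendsto_integral_filter_of_dominated_convergence (fun _ => lam * (M + 1) ^ p) ?_ ?_
      (integrableOn_const hDv) ?_
    · filter_upwards [self_mem_nhdsWithin] with ε hε
      refine ContinuousOn.aestronglyMeasurable (fun x hx => ?_) hD.measurableSet
      have := hGc (le_of_lt hε) hx
      exact (ContinuousAt.comp (f := fun y : EuclideanSpace ℝ (Fin N) => (ε, y)) this
        (by fun_prop)).continuousWithinAt
    · filter_upwards [Ioo_mem_nhdsGT zero_lt_one] with ε hε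
      filter_upwards [ae_restrict_mem hD.measurableSet] with x hx
      have hux := hu0 x hx
      have hvx := hv0 x hx
      have h01 : ∀ t > 0, 0 ≤ (t / (t + ε)) ^ (p - 1) ∧ (t / (t + ε)) ^ (p - 1) ≤ 1 := by
        intro t ht
        have := hε.1
        refine ⟨by positivity, Real.rpow_le_one (by positivity) ?_ (by linarith)⟩
        rw [div_le_one (by linarith)]; linarith
      have q1 := h01 _ hux
      have q2 := h01 _ hvx
      have q3 : (u x + ε) ^ p ≤ (M + 1) ^ p :=
        Real.rpow_le_rpow (by linarith [hε.1]) (by linarith [huM x hx, hε.2]) (by linarith)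
      have q4 : 0 ≤ (u x + ε) ^ p := by have := hε.1; positivity
      have q5 := cut_nonneg κ (u x + ε) (v x + ε)
      have q6 := cut_le_one (κ := κ) (P := u x + ε) (Q := v x + ε) (by linarith)
        (by linarith [hε.1]) (by linarith [hε.1])
      have q7 : cut κ (u x + ε) (v x + ε) ^ (2 : ℝ) ≤ 1 := Real.rpow_le_one q5 q6 (by norm_num)
      have q8 : 0 ≤ cut κ (u x + ε) (v x + ε) ^ (2 : ℝ) := Real.rpow_nonneg q5 _
      simp only [hG]
      rw [norm_mul, Real.norm_of_nonneg (by positivity), Real.norm_eq_abs]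
      have q9 : |(u x / (u x + ε)) ^ (p - 1) - (v x / (v x + ε)) ^ (p - 1)| ≤ 1 :=
        abs_le.mpr ⟨by linarith [q1.1, q2.2], by linarith [q1.2, q2.1]⟩
      have q10 : (u x + ε) ^ p * cut κ (u x + ε) (v x + ε) ^ (2 : ℝ) ≤ (M + 1) ^ p * 1 :=
        mul_le_mul q3 q7 q8 (q4.trans q3)
      have q11 : 0 ≤ (M + 1) ^ p := q4.trans q3
      calc _ ≤ lam * ((M + 1) ^ p * 1) * 1 := by gcongr
        _ = _ := by ring
    · filter_upwards [ae_restrict_mem hD.measurableSet] with x hx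
      have h1 := hGc le_rfl hx
      have h2 : Tendsto (fun ε : ℝ => G ε x) (𝓝 0) (𝓝 (G 0 x)) :=
        ContinuousAt.comp (f := fun ε : ℝ => (ε, x)) h1 (by fun_prop)
      have h3 : G 0 x = 0 := by
        simp [hG, div_self (hu0 x hx).ne', div_self (hv0 x hx).ne']
      rw [h3] at h2
      exact h2.mono_left nhdsWithin_le_nhds
  rw [integral_zero] at hlim
  -- conclusion
  apply pa_mono_eq hp
  by_contra hne
  have hux := hu0 x0 hx0
  have hvx := hv0 x0 hx0
  have hJpos : 0 < J 0 x0 := by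
    have h1 := lt_of_le_of_ne (pa_mono hp ((u x0)⁻¹ • gradient u x0) ((v x0)⁻¹ • gradient v x0)) (Ne.symm hne)
    have h2 : 0 < cut κ (u x0) (v x0) := by
      apply lt_max_of_lt_left
      have : κ * v x0 / u x0 < 1 := by rwa [div_lt_one hux]
      linarith
    simp only [hJ, add_zero]
    positivity
  have hev : ∀ᶠ z : ℝ × EuclideanSpace ℝ (Fin N) in 𝓝 (0, x0), J 0 x0 / 2 < J z.1 z.2 :=
    hJc.eventually (lt_mem_nhds (show J 0 x0 / 2 < J 0 x0 by linarith))
  rw [nhds_prod_eq] at hev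
  obtain ⟨pε, hpε, px, hpx, hJlt⟩ := eventually_prod_iff.mp hev
  obtain ⟨r, hr, hball⟩ := Metric.eventually_nhds_iff_ball.mp (hpx.and (hD.eventually_mem hx0))
  set b := volume.real (ball x0 r) with hb
  have hb0 : 0 < b := by
    rw [hb, measureReal_def]
    exact ENNReal.toReal_pos (measure_ball_pos _ _ hr).ne' measure_ball_lt_top.ne
  have hsmall : ∀ᶠ ε in 𝓝[>] (0 : ℝ), ∫ x in D, G ε x < b * (J 0 x0 / 2) :=
    hlim.eventually (gt_mem_nhds (by positivity))
  obtain ⟨ε, ⟨hε1, hε2⟩, hε3⟩ := ((hsmall.and (hpε.filter_mono nhdsWithin_le_nhds)).and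
    self_mem_nhdsWithin).exists
  obtain ⟨iJ, hle⟩ := key ε hε3
  have hsub : ball x0 r ⊆ D := fun x hx => (hball x hx).2
  have h2 : b * (J 0 x0 / 2) ≤ ∫ x in ball x0 r, J ε x := by
    have := setIntegral_mono_on (integrableOn_const measure_ball_lt_top.ne)
      (iJ.mono_set hsub) measurableSet_ball fun x hx => (hJlt hε2 (hball x hx).1).le
    rwa [setIntegral_const, smul_eq_mul] at this
  have h3 : ∫ x in ball x0 r, J ε x ≤ ∫ x in D, J ε x :=
    setIntegral_mono_set iJ (by
      filter_upwards [ae_restrict_mem hD.measurableSet] with x hx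
      exact hJ0 ε (le_of_lt hε3) x hx) hsub.eventuallyLE
  linarith
end PF

section PG
variable {N : ℕ}

theorem norm_e1 (hN : 2 ≤ N) : ‖e1 N‖ = 1 := by
  have : e1 N = EuclideanSpace.single (⟨0, by omega⟩ : Fin N) (1 : ℝ) := by
    ext i
    simp [e1, EuclideanSpace.single, Fin.ext_iff]
  rw [this]; simp

theorem mem_Om {R₀ R₁ s : ℝ} (hR₀ : 0 < R₀) {x : EuclideanSpace ℝ (Fin N)} :
    x ∈ Om N R₀ R₁ s ↔ ‖x‖ < R₁ ∧ R₀ < ‖x - s • e1 N‖ := by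
  rw [Om, closure_ball _ hR₀.ne', Set.mem_sdiff, mem_ball_zero_iff, mem_closedBall, dist_eq_norm, not_le]

theorem isOpen_Om {R₀ R₁ s : ℝ} : IsOpen (Om N R₀ R₁ s) := isOpen_ball.sdiff isClosed_closure

theorem Om_finite {R₀ R₁ s : ℝ} : volume (Om N R₀ R₁ s) ≠ ∞ :=
  ((measure_mono sdiff_subset).trans_lt measure_ball_lt_top).ne

/-- Working form of the eigenfunction hypotheses. -/
structure EF (N : ℕ) (R₀ R₁ s p lam : ℝ) (u : EuclideanSpace ℝ (Fin N) → ℝ) : Prop where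
  hN : 2 ≤ N
  hR₀ : 0 < R₀
  hR : R₀ < R₁
  hp : 1 < p
  hs : 0 < s
  hs' : s < R₁ - R₀
  hl : 0 ≤ lam
  hV : ∃ V : Set (EuclideanSpace ℝ (Fin N)), IsOpen V ∧
    (∀ x, ‖x‖ ≤ R₁ → R₀ ≤ ‖x - s • e1 N‖ → x ∈ V) ∧ ContDiffOn ℝ 1 u V
  pos : ∀ x ∈ Om N R₀ R₁ s, 0 < u x
  zo : ∀ x, ‖x‖ = R₁ → u x = 0
  zi : ∀ x, ‖x - s • e1 N‖ = R₀ → u x = 0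
  we : ∀ φ, T1 (Om N R₀ R₁ s) φ →
    ∫ x in Om N R₀ R₁ s, ⟪pa p (gradient u x), gradient φ x⟫ =
      ∫ x in Om N R₀ R₁ s, lam * u x ^ (p - 1) * φ x

theorem far_of_norm {R₀ s : ℝ} (hN : 2 ≤ N) (hs : 0 < s) {x : EuclideanSpace ℝ (Fin N)}
    (hx : R₀ + s < ‖x‖) : R₀ < ‖x - s • e1 N‖ := by
  have := norm_sub_norm_le x (s • e1 N)
  rw [norm_smul, norm_e1 hN, Real.norm_of_nonneg hs.le] at this
  linarith

theorem near_of_norm {R₀ s : ℝ} (hN : 2 ≤ N) (hs : 0 < s) {x : EuclideanSpace ℝ (Fin N)}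
    (hx : ‖x - s • e1 N‖ ≤ R₀) : ‖x‖ ≤ R₀ + s := by
  have := norm_sub_norm_le x (s • e1 N)
  rw [norm_smul, norm_e1 hN, Real.norm_of_nonneg hs.le] at this
  linarith

theorem EF.of {R₀ R₁ : ℝ} (hN : 2 ≤ N) (hR₀ : 0 < R₀) (hR : R₀ < R₁)
    {p : ℝ} (hp : 1 < p) {s : ℝ} (hs : 0 < s) (hs' : s < R₁ - R₀)
    {u : EuclideanSpace ℝ (Fin N) → ℝ}
    (hu : IsFirstEigenfunction p (Om N R₀ R₁ s) (lam1 p (Om N R₀ R₁ s)) u) :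
    EF N R₀ R₁ s p (lam1 p (Om N R₀ R₁ s)) u := by
  obtain ⟨⟨V, hVo, hVs, hVc⟩, hpos, hzero, hw⟩ := hu
  have c1 : ∀ x : EuclideanSpace ℝ (Fin N), ‖x‖ = R₁ → x ∈ closure (Om N R₀ R₁ s) := by
    intro x hx
    have ht : Tendsto (fun t : ℝ => (1 - t) • x) (𝓝[>] 0) (𝓝 x) := by
      have : ContinuousAt (fun t : ℝ => (1 - t) • x) 0 := by fun_prop
      have h2 := this.tendsto
      simp only [sub_zero, one_smul] at h2
      exact h2.mono_left nhdsWithin_le_nhds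
    refine mem_closure_of_tendsto ht ?_
    have h3 : ∀ᶠ t in 𝓝[>] (0 : ℝ), R₀ + s < ‖(1 - t) • x‖ :=
      ht.norm.eventually (lt_mem_nhds (by linarith))
    filter_upwards [h3, Ioo_mem_nhdsGT zero_lt_one] with t ht1 ht2
    refine (mem_Om hR₀).2 ⟨?_, far_of_norm hN hs ht1⟩
    rw [norm_smul, Real.norm_of_nonneg (by linarith [ht2.2]), hx]
    nlinarith [ht2.1]
  have c2 : ∀ x : EuclideanSpace ℝ (Fin N), ‖x - s • e1 N‖ = R₀ → x ∈ closure (Om N R₀ R₁ s) := by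
    intro x hx
    have ht : Tendsto (fun t : ℝ => s • e1 N + (1 + t) • (x - s • e1 N)) (𝓝[>] 0) (𝓝 x) := by
      have : ContinuousAt (fun t : ℝ => s • e1 N + (1 + t) • (x - s • e1 N)) 0 := by fun_prop
      have h2 := this.tendsto
      simp only [add_zero, one_smul, add_sub_cancel] at h2
      exact h2.mono_left nhdsWithin_le_nhds
    refine mem_closure_of_tendsto ht ?_
    have hxn : ‖x‖ < R₁ := by linarith [near_of_norm hN hs hx.le]
    have h3 := ht.norm.eventually (gt_mem_nhds hxn)
    filter_upwards [h3, self_mem_nhdsWithin] with t ht1 ht2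
    refine (mem_Om hR₀).2 ⟨ht1, ?_⟩
    have ht2 : 0 < t := ht2
    rw [add_sub_cancel_left, norm_smul, Real.norm_of_nonneg (by linarith), hx]
    nlinarith
  have hfr : ∀ x, x ∈ closure (Om N R₀ R₁ s) → x ∉ Om N R₀ R₁ s → u x = 0 := fun x h1 h2 =>
    hzero x (by rw [frontier, isOpen_Om.interior_eq]; exact ⟨h1, h2⟩)
  have hsub : Om N R₀ R₁ s ⊆ V := subset_closure.trans hVs
  refine ⟨hN, hR₀, hR, hp, hs, hs', lam1_nonneg _, ⟨V, hVo, ?_, hVc⟩, hpos, ?_, ?_, ?_⟩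
  · intro x h1 h2
    rcases h1.lt_or_eq with h1 | h1
    · rcases h2.lt_or_eq with h2 | h2
      · exact hsub ((mem_Om hR₀).2 ⟨h1, h2⟩)
      · exact hVs (c2 x h2.symm)
    · exact hVs (c1 x h1)
  · exact fun x hx => hfr x (c1 x hx) fun h => ((mem_Om hR₀).1 h).1.ne hx
  · exact fun x hx => hfr x (c2 x hx) fun h => ((mem_Om hR₀).1 h).2.ne' hx
  · intro φ hφ
    refine weak_ext isOpen_Om ((continuous_pa hp).comp_continuousOn
      ((hVc.mono hsub).cont_grad isOpen_Om)) (continuousOn_const.mul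
      ((hVc.mono hsub).continuousOn.rpow_const fun x hx => Or.inl (hpos x hx).ne')) ?_ hφ
    intro φ h1 h2 h3
    have := hw φ h1 h2 h3
    rw [← integral_const_mul] at this
    refine Eq.trans ?_ (this.trans ?_)
    · congr 1; ext x
      exact real_inner_smul_left _ _ _
    · congr 1; ext x
      exact (mul_assoc _ _ _).symm

/-- reflection across the hyperplane orthogonal to `a` -/
noncomputable def rfl_ (a : EuclideanSpace ℝ (Fin N)) :
    EuclideanSpace ℝ (Fin N) ≃ₗᵢ[ℝ] EuclideanSpace ℝ (Fin N) := (ℝ ∙ a)ᗮ.reflection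

theorem rfl_apply {a : EuclideanSpace ℝ (Fin N)} (ha : ‖a‖ = 1) (x : EuclideanSpace ℝ (Fin N)) :
    rfl_ a x = x - (2 * ⟪a, x⟫) • a := by
  rw [rfl_, Submodule.reflection_orthogonal_apply, Submodule.reflection_singleton_apply, ha]
  simp [two_smul, two_mul, add_smul]

theorem rfl_rfl (a x : EuclideanSpace ℝ (Fin N)) : rfl_ a (rfl_ a x) = x :=
  Submodule.reflection_reflection _ _

theorem rfl_symm (a : EuclideanSpace ℝ (Fin N)) : (rfl_ a).symm = rfl_ a :=
  Submodule.reflection_symm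

theorem norm_rfl_sub {a : EuclideanSpace ℝ (Fin N)} (ha : ‖a‖ = 1) (x y : EuclideanSpace ℝ (Fin N)) :
    ‖rfl_ a x - y‖ ^ 2 = ‖x - y‖ ^ 2 + 4 * (⟪a, x⟫ * ⟪a, y⟫) := by
  rw [norm_sub_sq_real, norm_sub_sq_real, LinearIsometryEquiv.norm_map, rfl_apply ha, inner_sub_left,
    real_inner_smul_left]
  ring

theorem T1.comp_isometry {D D' : Set (EuclideanSpace ℝ (Fin N))} {φ : EuclideanSpace ℝ (Fin N) → ℝ}
    (hφ : T1 D φ) (σ : EuclideanSpace ℝ (Fin N) ≃ₗᵢ[ℝ] EuclideanSpace ℝ (Fin N))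
    (h : ∀ x, σ x ∈ D → x ∈ D') : T1 D' (fun x => φ (σ x)) := by
  have e : tsupport (fun x => φ (σ x)) = σ ⁻¹' (tsupport φ) := by
    exact tsupport_comp_eq_preimage φ σ.toHomeomorph
  refine ⟨hφ.cd.comp σ.contDiff, ?_, ?_⟩
  · exact hφ.cs.comp_homeomorph σ.toHomeomorph
  · rw [e]; exact fun x hx => h x (hφ.sub hx)

theorem we_isometry {p lam : ℝ} {Ω D : Set (EuclideanSpace ℝ (Fin N))}
    (hΩ : IsOpen Ω) {u : EuclideanSpace ℝ (Fin N) → ℝ} (hu : ContDiffOn ℝ 1 u Ω)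
    (we : ∀ φ, T1 Ω φ → ∫ x in Ω, ⟪pa p (gradient u x), gradient φ x⟫ =
      ∫ x in Ω, lam * u x ^ (p - 1) * φ x)
    (σ : EuclideanSpace ℝ (Fin N) ≃ₗᵢ[ℝ] EuclideanSpace ℝ (Fin N)) (hσ : ∀ x ∈ D, σ x ∈ Ω)
    {φ : EuclideanSpace ℝ (Fin N) → ℝ} (hφ : T1 D φ) :
    ∫ x in D, ⟪pa p (gradient (fun y => u (σ y)) x), gradient φ x⟫ =
      ∫ x in D, lam * u (σ x) ^ (p - 1) * φ x := by
  have hψ : T1 Ω (fun x => φ (σ.symm x)) := hφ.comp_isometry σ.symm fun x hx => by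
    simpa using hσ _ hx
  have hg : ∀ y, gradient (fun x => φ (σ.symm x)) y = σ (gradient φ (σ.symm y)) := fun y => by
    have := hga_isometry σ.symm (x := y)
      ((hφ.cd.contDiffOn (s := univ)).hga isOpen_univ (mem_univ (σ.symm y)))
    exact this.gradient
  have w := we _ hψ
  rw [setIntegral_eq_integral_of_forall_compl_eq_zero, setIntegral_eq_integral_of_forall_compl_eq_zero] at w ⊢
  · rw [← (σ.measurePreserving).integral_comp σ.toHomeomorph.measurableEmbedding] at w
    rw [← (σ.measurePreserving).integral_comp σ.toHomeomorph.measurableEmbedding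
      (fun x => lam * u x ^ (p - 1) * φ (σ.symm x))] at w
    simp only [hg, LinearIsometryEquiv.symm_apply_apply] at w
    rw [← w]
    congr 1; ext x
    by_cases hx : x ∈ D
    · have := hga_isometry σ (x := x) (hu.hga hΩ (hσ x hx))
      rw [this.gradient, pa_isometry]
      conv_rhs => rw [← LinearIsometryEquiv.inner_map_map σ.symm]
      simp
    · have : gradient φ x = 0 := gradient_eq_zero_off fun h => hx (hφ.sub h)
      simp [this]
  all_goals
    intro x hx
  · rw [image_eq_zero_of_notMem_tsupport fun h => hx (hφ.sub h)]; simp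
  · have : φ (σ.symm x) = 0 := image_eq_zero_of_notMem_tsupport (f := fun x => φ (σ.symm x))
      fun h => hx (hψ.sub h)
    simp [this]
  · rw [gradient_eq_zero_off fun h => hx (hφ.sub h)]; simp
  · rw [gradient_eq_zero_off fun h => hx (hψ.sub h)]; simp

theorem isClosed_KC {R₀ R₁ s : ℝ} :
    IsClosed {x : EuclideanSpace ℝ (Fin N) | ‖x‖ ≤ R₁ ∧ R₀ ≤ ‖x - s • e1 N‖} := by
  have h1 : IsClosed {x : EuclideanSpace ℝ (Fin N) | ‖x‖ ≤ R₁} :=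
    isClosed_le continuous_norm continuous_const
  have h2 : IsClosed {x : EuclideanSpace ℝ (Fin N) | R₀ ≤ ‖x - s • e1 N‖} :=
    isClosed_le continuous_const (by fun_prop)
  exact h1.inter h2

theorem EF.bdd {R₀ R₁ s p lam : ℝ} {u : EuclideanSpace ℝ (Fin N) → ℝ} (h : EF N R₀ R₁ s p lam u) :
    ∃ M : ℝ, 0 < M ∧ ∀ x, ‖x‖ ≤ R₁ → R₀ ≤ ‖x - s • e1 N‖ → |u x| ≤ M ∧ ‖gradient u x‖ ≤ M := by
  obtain ⟨V, hVo, hV, hVc⟩ := h.hV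
  have hKc : IsCompact {x : EuclideanSpace ℝ (Fin N) | ‖x‖ ≤ R₁ ∧ R₀ ≤ ‖x - s • e1 N‖} := by
    refine (isCompact_closedBall (0 : EuclideanSpace ℝ (Fin N)) R₁).of_isClosed_subset
      isClosed_KC ?_
    intro x hx; simpa using hx.1
  have hsub : {x : EuclideanSpace ℝ (Fin N) | ‖x‖ ≤ R₁ ∧ R₀ ≤ ‖x - s • e1 N‖} ⊆ V :=
    fun x hx => hV x hx.1 hx.2
  obtain ⟨A, hA⟩ := hKc.exists_bound_of_continuousOn (hVc.continuousOn.mono hsub)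
  obtain ⟨B, hB⟩ := hKc.exists_bound_of_continuousOn ((hVc.cont_grad hVo).mono hsub)
  refine ⟨max (max A B) 1, by positivity, fun x h1 h2 => ⟨?_, ?_⟩⟩
  · exact (hA x ⟨h1, h2⟩).trans ((le_max_left _ _).trans (le_max_left _ _))
  · exact (hB x ⟨h1, h2⟩).trans ((le_max_right _ _).trans (le_max_left _ _))

theorem EF.nonneg {R₀ R₁ s p lam : ℝ} {u : EuclideanSpace ℝ (Fin N) → ℝ} (h : EF N R₀ R₁ s p lam u)
    {x : EuclideanSpace ℝ (Fin N)} (h1 : ‖x‖ ≤ R₁) (h2 : R₀ ≤ ‖x - s • e1 N‖) : 0 ≤ u x := by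
  rcases h1.lt_or_eq with h1 | h1
  · rcases h2.lt_or_eq with h2 | h2
    · exact (h.pos x ((mem_Om h.hR₀).2 ⟨h1, h2⟩)).le
    · exact (h.zi x h2.symm).ge
  · exact (h.zo x h1).ge

theorem EF.cdOm {R₀ R₁ s p lam : ℝ} {u : EuclideanSpace ℝ (Fin N) → ℝ} (h : EF N R₀ R₁ s p lam u) :
    ContDiffOn ℝ 1 u (Om N R₀ R₁ s) := by
  obtain ⟨V, hVo, hV, hVc⟩ := h.hV
  exact hVc.mono fun x hx => hV x ((mem_Om h.hR₀).1 hx).1.le ((mem_Om h.hR₀).1 hx).2.le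

set_option maxHeartbeats 1000000 in
theorem EF.refl_le {R₀ R₁ s p lam : ℝ} {u : EuclideanSpace ℝ (Fin N) → ℝ} (h : EF N R₀ R₁ s p lam u)
    {a : EuclideanSpace ℝ (Fin N)} (ha : ‖a‖ = 1) (hae : 0 < ⟪a, e1 N⟫)
    {x0 : EuclideanSpace ℝ (Fin N)} (hx0 : x0 ∈ Om N R₀ R₁ s) (hax0 : 0 < ⟪a, x0⟫) :
    u x0 ≤ u (rfl_ a x0) := by
  by_contra hlt
  push Not at hlt
  obtain ⟨V, hVo, hV, hVc⟩ := h.hV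
  obtain ⟨M, hM0, hM⟩ := h.bdd
  have hs := h.hs
  have hcd := h.cdOm
  set σ := rfl_ a with hσ
  set D := {x | x ∈ Om N R₀ R₁ s ∧ 0 < ⟪a, x⟫} with hDdef
  have hD : IsOpen D := by
    have h1 : IsOpen {x : EuclideanSpace ℝ (Fin N) | 0 < ⟪a, x⟫} :=
      isOpen_lt continuous_const (by fun_prop)
    exact isOpen_Om.inter h1
  have hfar : ∀ x : EuclideanSpace ℝ (Fin N), 0 ≤ ⟪a, x⟫ → ‖x - s • e1 N‖ ≤ ‖σ x - s • e1 N‖ := by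
    intro x hx
    apply le_of_sq_le_sq ?_ (norm_nonneg _)
    rw [norm_rfl_sub ha, real_inner_smul_right]
    have : 0 ≤ ⟪a, x⟫ * (s * ⟪a, e1 N⟫) := by positivity
    linarith
  have hfar' : ∀ x : EuclideanSpace ℝ (Fin N), 0 < ⟪a, x⟫ → ‖x - s • e1 N‖ < ‖σ x - s • e1 N‖ := by
    intro x hx
    apply lt_of_pow_lt_pow_left₀ 2 (norm_nonneg _)
    rw [norm_rfl_sub ha, real_inner_smul_right]
    have : 0 < ⟪a, x⟫ * (s * ⟪a, e1 N⟫) := by positivity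
    linarith
  have hσn : ∀ x, ‖σ x‖ = ‖x‖ := fun x => σ.norm_map x
  have hσD : ∀ x ∈ D, σ x ∈ Om N R₀ R₁ s := by
    intro x hx
    obtain ⟨h1, h2⟩ := (mem_Om h.hR₀).1 hx.1
    exact (mem_Om h.hR₀).2 ⟨by rwa [hσn], h2.trans (hfar' x hx.2)⟩
  have hx0D : x0 ∈ D := ⟨hx0, hax0⟩
  have hv0 : 0 < u (σ x0) := h.pos _ (hσD x0 hx0D)
  obtain ⟨κ, hκ1, hκ2⟩ : ∃ κ : ℝ, 1 < κ ∧ κ < u x0 / u (σ x0) :=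
    exists_between ((one_lt_div hv0).2 hlt)
  have hκ3 : κ * u (σ x0) < u x0 := (lt_div_iff₀ hv0).1 hκ2
  have hvcd : ContDiffOn ℝ 1 (fun x => u (σ x)) D :=
    hcd.comp σ.contDiff.contDiffOn hσD
  have hucd : ContDiffOn ℝ 1 u D := hcd.mono fun x hx => hx.1
  have hup : ∀ x ∈ D, 0 < u x := fun x hx => h.pos x hx.1
  have hvp : ∀ x ∈ D, 0 < u (σ x) := fun x hx => h.pos _ (hσD x hx)
  have hK : ∀ δ > 0, IsCompact {x | x ∈ D ∧ δ ≤ u x - κ * u (σ x)} := by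
    intro δ hδ
    set C := {x : EuclideanSpace ℝ (Fin N) | (‖x‖ ≤ R₁ ∧ R₀ ≤ ‖x - s • e1 N‖) ∧ 0 ≤ ⟪a, x⟫} with hC
    have hCcl : IsClosed C := by
      have h1 : IsClosed {x : EuclideanSpace ℝ (Fin N) | 0 ≤ ⟪a, x⟫} :=
        isClosed_le continuous_const (by fun_prop)
      exact isClosed_KC.inter h1
    have hCc : IsCompact C := (isCompact_closedBall (0 : EuclideanSpace ℝ (Fin N)) R₁).of_isClosed_subset
      hCcl fun x hx => by simpa using hx.1.1
    have hcu : ContinuousOn u C := hVc.continuousOn.mono fun x hx => hV x hx.1.1 hx.1.2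
    have hσC : ∀ x ∈ C, ‖σ x‖ ≤ R₁ ∧ R₀ ≤ ‖σ x - s • e1 N‖ := fun x hx =>
      ⟨by rw [hσn]; exact hx.1.1, hx.1.2.trans (hfar x hx.2)⟩
    have hcv : ContinuousOn (fun x => u (σ x)) C := hVc.continuousOn.comp σ.continuous.continuousOn
      fun x hx => hV _ (hσC x hx).1 (hσC x hx).2
    have hcl : IsClosed (C ∩ (fun x => u x - κ * u (σ x)) ⁻¹' Ici δ) :=
      (hcu.sub (continuousOn_const.mul hcv)).preimage_isClosed_of_isClosed hCcl isClosed_Ici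
    have he : {x | x ∈ D ∧ δ ≤ u x - κ * u (σ x)} = C ∩ (fun x => u x - κ * u (σ x)) ⁻¹' Ici δ := by
      ext x
      constructor
      · rintro ⟨h1, h2⟩
        obtain ⟨h3, h4⟩ := (mem_Om h.hR₀).1 h1.1
        exact ⟨⟨⟨h3.le, h4.le⟩, h1.2.le⟩, h2⟩
      · rintro ⟨h1, h2⟩
        have h2 : δ ≤ u x - κ * u (σ x) := h2
        refine ⟨⟨(mem_Om h.hR₀).2 ⟨?_, ?_⟩, ?_⟩, h2⟩
        · refine h1.1.1.lt_of_ne fun h3 => ?_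
          rw [h.zo x h3, h.zo (σ x) (by rw [hσn, h3])] at h2
          linarith
        · refine h1.1.2.lt_of_ne fun h3 => ?_
          rw [h.zi x h3.symm] at h2
          have := h.nonneg (hσC x h1).1 (hσC x h1).2
          have : 0 ≤ κ * u (σ x) := by positivity
          linarith
        · refine h1.2.lt_of_ne fun h3 => ?_
          have h4 : σ x = x := by rw [hσ, rfl_apply ha, ← h3]; simp
          rw [h4] at h2
          have := h.nonneg h1.1.1 h1.1.2
          nlinarith
    rw [he]
    exact hCc.of_isClosed_subset hcl inter_subset_left
  have hDv : volume D ≠ ∞ := ((measure_mono fun x hx => hx.1).trans_lt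
    (Om_finite (N := N) (R₀ := R₀) (R₁ := R₁) (s := s)).lt_top).ne
  have hwu : ∀ φ, T1 D φ → ∫ x in D, ⟪pa p (gradient u x), gradient φ x⟫ =
      ∫ x in D, lam * u x ^ (p - 1) * φ x := by
    intro φ hφ
    exact we_isometry isOpen_Om hcd h.we (LinearIsometryEquiv.refl ℝ _) (fun x hx => hx.1) hφ
  have hlog := fun x (hx : x ∈ D) (hx2 : κ * u (σ x) < u x) =>
    compare_abs (M := M) h.hp h.hl hD hDv hucd hvcd hup hvp
    (fun x hx => by
      obtain ⟨h3, h4⟩ := (mem_Om h.hR₀).1 hx.1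
      exact (le_abs_self _).trans (hM x h3.le h4.le).1)
    hκ1 hK hwu (fun φ hφ => we_isometry isOpen_Om hcd h.we σ hσD hφ) hx hx2
  set H := {x : EuclideanSpace ℝ (Fin N) | ‖x‖ < R₁ ∧ 0 < ⟪a, x⟫} with hH
  have hHo : IsOpen H := by
    have h1 : IsOpen {x : EuclideanSpace ℝ (Fin N) | 0 < ⟪a, x⟫} :=
      isOpen_lt continuous_const (by fun_prop)
    have h2 : IsOpen {x : EuclideanSpace ℝ (Fin N) | ‖x‖ < R₁} :=
      isOpen_lt continuous_norm continuous_const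
    exact h2.inter h1
  have hHconv : Convex ℝ H := by
    have h1 : Convex ℝ {x : EuclideanSpace ℝ (Fin N) | ‖x‖ < R₁} := by
      have h2 := convex_ball (0 : EuclideanSpace ℝ (Fin N)) R₁
      rwa [show ball (0 : EuclideanSpace ℝ (Fin N)) R₁ = {x | ‖x‖ < R₁} by ext x; simp] at h2
    exact h1.inter (convex_halfSpace_gt ⟨fun x y => inner_add_right _ _ _,
      fun c x => real_inner_smul_right _ _ _⟩ 0)
  set f : EuclideanSpace ℝ (Fin N) → ℝ := D.indicator
    (fun x => max (u x * (u (σ x))⁻¹ + -κ) 0 ^ (2 : ℝ)) with hf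
  have hfd : ∀ x ∈ H, HasGradientAt f 0 x := by
    intro x hx
    by_cases hxD : x ∈ D
    · have hv := hvp x hxD
      have g1 := hucd.hga hD hxD
      have g2 := hvcd.hga hD hxD
      have g3 := hga_comp (F := fun t => t⁻¹) (f := fun x => u (σ x)) (hasDerivAt_inv hv.ne') g2
      have g4 := hga_comp (F := fun t => max t 0 ^ (2 : ℝ)) (f := fun x => u x * (u (σ x))⁻¹ + -κ)
        (hasDerivAt_posq one_lt_two _) (hga_add_const (-κ) (hga_mul g1 g3))
      have g5 := g4.congr_of_eventuallyEq (f₁ := f) (by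
        filter_upwards [hD.mem_nhds hxD] with y hy
        exact indicator_of_mem hy _)
      refine hga_congr g5 ?_
      rcases le_or_gt (u x) (κ * u (σ x)) with hle | hgt
      · have : max (u x * (u (σ x))⁻¹ + -κ) 0 = 0 := by
          apply max_eq_right
          have : u x * (u (σ x))⁻¹ ≤ κ := by rw [← div_eq_mul_inv, div_le_iff₀ hv]; exact hle
          linarith
        rw [this, Real.zero_rpow (by norm_num)]; simp
      · have e := hlog x hxD hgt
        have hux := hup x hxD
        have e2 : gradient u x = (u x * (u (σ x))⁻¹) • gradient (fun x => u (σ x)) x := by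
          rw [mul_smul, ← e, smul_smul, mul_inv_cancel₀ hux.ne', one_smul]
        rw [e2]
        have : (u x • (-(u (σ x) ^ 2)⁻¹) • gradient (fun x => u (σ x)) x +
          (u (σ x))⁻¹ • (u x * (u (σ x))⁻¹) • gradient (fun x => u (σ x)) x) = 0 := by
          simp only [smul_smul, ← add_smul]
          have : u x * -(u (σ x) ^ 2)⁻¹ + (u (σ x))⁻¹ * (u x * (u (σ x))⁻¹) = 0 := by
            field_simp; ring
          rw [this, zero_smul]
        rw [this, smul_zero]
    · have hxh : ‖x - s • e1 N‖ ≤ R₀ := by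
        by_contra h1; push Not at h1
        exact hxD ⟨(mem_Om h.hR₀).2 ⟨hx.1, h1⟩, hx.2⟩
      have hz : ∀ᶠ y in 𝓝 x, f y = 0 := by
        rcases hxh.lt_or_eq with h1 | h1
        · have : ∀ᶠ y in 𝓝 x, ‖y - s • e1 N‖ < R₀ :=
            (isOpen_lt (by fun_prop) (by fun_prop)).mem_nhds h1
          filter_upwards [this] with y hy
          exact indicator_of_notMem (fun h2 => ((mem_Om h.hR₀).1 h2.1).2.not_gt hy) _
        · have hσx : σ x ∈ Om N R₀ R₁ s := (mem_Om h.hR₀).2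
            ⟨by rw [hσn]; exact hx.1, h1 ▸ hfar' x hx.2⟩
          have c1 : ContinuousAt u x := hVc.continuousOn.continuousAt (hVo.mem_nhds (hV x hx.1.le h1.ge))
          have c2 : ContinuousAt (fun y => u (σ y)) x := ContinuousAt.comp (f := σ)
            (hcd.continuousOn.continuousAt (isOpen_Om.mem_nhds hσx)) σ.continuous.continuousAt
          have hvx := h.pos _ hσx
          have h2 : u x - κ * u (σ x) < 0 := by
            rw [h.zi x h1]
            have : 0 < κ * u (σ x) := by positivity
            linarith
          have h3 : ∀ᶠ y in 𝓝 x, u y - κ * u (σ y) < 0 :=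
            (c1.sub (continuousAt_const.mul c2)).eventually (gt_mem_nhds h2)
          filter_upwards [h3] with y hy
          by_cases hyD : y ∈ D
          · rw [hf, indicator_of_mem hyD]
            have : max (u y * (u (σ y))⁻¹ + -κ) 0 = 0 := by
              apply max_eq_right
              have : u y * (u (σ y))⁻¹ ≤ κ := by
                rw [← div_eq_mul_inv, div_le_iff₀ (hvp y hyD)]; linarith
              linarith
            rw [this, Real.zero_rpow (by norm_num)]
          · exact indicator_of_notMem hyD _
      exact (hasGradientAt_const x (0 : ℝ)).congr_of_eventuallyEq hz
  have hxc : s • e1 N ∈ H := by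
    refine ⟨?_, ?_⟩
    · rw [norm_smul, norm_e1 h.hN, Real.norm_of_nonneg hs.le]
      linarith [h.hs', h.hR₀]
    · rw [real_inner_smul_right]; positivity
  have hx0H : x0 ∈ H := ⟨((mem_Om h.hR₀).1 hx0).1, hax0⟩
  have hconst := hHo.is_const_of_fderiv_eq_zero (𝕜 := ℝ) (f := f) hHconv.isPreconnected
    (fun x hx => (hfd x hx).hasFDerivAt.differentiableAt.differentiableWithinAt)
    (fun x hx => by rw [(hfd x hx).hasFDerivAt.fderiv]; simp) hx0H hxc
  have e1' : f (s • e1 N) = 0 := indicator_of_notMem (fun h2 => by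
    have := ((mem_Om h.hR₀).1 h2.1).2
    rw [sub_self, norm_zero] at this
    linarith [h.hR₀]) _
  rw [e1', hf, indicator_of_mem hx0D] at hconst
  have : 0 < max (u x0 * (u (σ x0))⁻¹ + -κ) 0 := by
    apply lt_max_of_lt_left
    rw [← div_eq_mul_inv]; linarith
  have := Real.rpow_pos_of_pos this 2
  linarith

theorem EF.mono {R₀ R₁ s p lam : ℝ} {u : EuclideanSpace ℝ (Fin N) → ℝ} (h : EF N R₀ R₁ s p lam u)
    {x y : EuclideanSpace ℝ (Fin N)} (hx : x ∈ Om N R₀ R₁ s) (hxy : ‖x‖ = ‖y‖)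
    (hlt : ⟪e1 N, y⟫ < ⟪e1 N, x⟫) : u x ≤ u y := by
  have hne : x - y ≠ 0 := by
    intro h0; rw [sub_eq_zero.mp h0] at hlt; exact lt_irrefl _ hlt
  have hd : 0 < ‖x - y‖ := norm_pos_iff.mpr hne
  set a := ‖x - y‖⁻¹ • (x - y) with ha
  have hn : ‖a‖ = 1 := by rw [ha, norm_smul, norm_inv, norm_norm, inv_mul_cancel₀ hd.ne']
  have hi : ⟪x - y, x⟫ = ‖x - y‖ ^ 2 / 2 := by
    rw [norm_sub_sq_real, inner_sub_left, real_inner_self_eq_norm_sq, ← hxy, real_inner_comm]; ring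
  have hax : ⟪a, x⟫ = ‖x - y‖ / 2 := by
    rw [ha, real_inner_smul_left, hi]; field_simp
  have hr : rfl_ a x = y := by
    rw [rfl_apply hn, hax, ha, smul_smul]
    have : 2 * (‖x - y‖ / 2) * ‖x - y‖⁻¹ = 1 := by field_simp
    rw [this, one_smul]; abel
  rw [← hr]
  refine h.refl_le hn ?_ hx ?_
  · rw [ha, real_inner_smul_left, inner_sub_left, real_inner_comm, real_inner_comm (e1 N) y]
    have : 0 < ⟪e1 N, x⟫ - ⟪e1 N, y⟫ := by linarith
    positivity
  · rw [hax]; positivity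
end PG

section PH
variable {N : ℕ}

/-- derivative of the shape perturbation -/
noncomputable def DPhi (t : ℝ) (g e : EuclideanSpace ℝ (Fin N)) :
    EuclideanSpace ℝ (Fin N) →L[ℝ] EuclideanSpace ℝ (Fin N) :=
  ContinuousLinearMap.id ℝ _ + (t • innerSL ℝ g).smulRight e

theorem DPhi_apply (t : ℝ) (g e v : EuclideanSpace ℝ (Fin N)) :
    DPhi t g e v = v + (t * ⟪g, v⟫) • e := by
  simp [DPhi]

theorem DPhi_det (t : ℝ) (g e : EuclideanSpace ℝ (Fin N)) :
    (DPhi t g e).det = 1 + t * ⟪g, e⟫ := by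
  have h := LinearMap.transvection.det
    (((t • innerSL ℝ g : EuclideanSpace ℝ (Fin N) →L[ℝ] ℝ) :
      EuclideanSpace ℝ (Fin N) →ₗ[ℝ] ℝ)) e
  have h2 : ((DPhi t g e : EuclideanSpace ℝ (Fin N) →L[ℝ] EuclideanSpace ℝ (Fin N)) :
      EuclideanSpace ℝ (Fin N) →ₗ[ℝ] EuclideanSpace ℝ (Fin N)) =
      LinearMap.transvection (((t • innerSL ℝ g : EuclideanSpace ℝ (Fin N) →L[ℝ] ℝ) :
      EuclideanSpace ℝ (Fin N) →ₗ[ℝ] ℝ)) e := by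
    ext1 v
    simp [DPhi_apply, LinearMap.transvection.apply]
  rw [ContinuousLinearMap.det, h2, h]
  simp

theorem abs_inner_le_half {t L : ℝ} {g e : EuclideanSpace ℝ (Fin N)} (he : ‖e‖ = 1)
    (hg : ‖g‖ ≤ L) (ht : |t| * L ≤ 1 / 2) : |t * ⟪g, e⟫| ≤ 1 / 2 := by
  rw [abs_mul]
  have := abs_real_inner_le_norm g e
  rw [he, mul_one] at this
  exact (mul_le_mul_of_nonneg_left (this.trans hg) (abs_nonneg t)).trans ht

theorem shape_homeo {η : EuclideanSpace ℝ (Fin N) → ℝ} (hη : ContDiff ℝ 1 η) {L t : ℝ}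
    {e : EuclideanSpace ℝ (Fin N)} (he : ‖e‖ = 1)
    (hL : ∀ x, ‖gradient η x‖ ≤ L) (ht : |t| * L ≤ 1 / 2) :
    ∃ Φ : EuclideanSpace ℝ (Fin N) ≃ₜ EuclideanSpace ℝ (Fin N),
      (∀ y, Φ y = y + (t * η y) • e) ∧ ContDiff ℝ 1 Φ.symm ∧
      ∀ x, HasFDerivAt Φ (DPhi t (gradient η x) e) x := by
  have hL0 : 0 ≤ L := (norm_nonneg _).trans (hL 0)
  have hgr : ∀ x, HasGradientAt η (gradient η x) x := fun x =>
    (hη.differentiable one_ne_zero x).hasGradientAt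
  have hlip : ∀ x y, |η x - η y| ≤ L * ‖x - y‖ := by
    intro x y
    have := Convex.norm_image_sub_le_of_norm_hasFDerivWithin_le (f := η)
      (f' := fun x => innerSL ℝ (gradient η x)) (C := L) (s := univ) (x := y) (y := x)
      (fun z _ => (hgr z).hasFDerivAt.hasFDerivWithinAt)
      (fun z _ => by rw [innerSL_apply_norm]; exact hL z) convex_univ trivial trivial
    simpa using this
  have hap : ApproximatesLinearOn (fun y => y + (t * η y) • e)
      ((ContinuousLinearEquiv.refl ℝ (EuclideanSpace ℝ (Fin N))) :
        EuclideanSpace ℝ (Fin N) →L[ℝ] EuclideanSpace ℝ (Fin N)) univ (1 / 2) := by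
    intro x _ y _
    have : x + (t * η x) • e - (y + (t * η y) • e) -
        ((ContinuousLinearEquiv.refl ℝ (EuclideanSpace ℝ (Fin N))) :
        EuclideanSpace ℝ (Fin N) →L[ℝ] EuclideanSpace ℝ (Fin N)) (x - y) =
        (t * (η x - η y)) • e := by
      simp only [ContinuousLinearEquiv.coe_refl, ContinuousLinearMap.coe_id', id, mul_sub, sub_smul]
      abel
    rw [this, norm_smul, he, mul_one, Real.norm_eq_abs, abs_mul]
    have h1 := mul_le_mul_of_nonneg_left (hlip x y) (abs_nonneg t)
    have h2 := mul_le_mul_of_nonneg_right ht (norm_nonneg (x - y))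
    push_cast
    linarith
  have hc : Subsingleton (EuclideanSpace ℝ (Fin N)) ∨ (1 / 2 : NNReal) <
      ‖((ContinuousLinearEquiv.refl ℝ (EuclideanSpace ℝ (Fin N))).symm :
        EuclideanSpace ℝ (Fin N) →L[ℝ] EuclideanSpace ℝ (Fin N))‖₊⁻¹ := by
    right
    have : Nontrivial (EuclideanSpace ℝ (Fin N)) := ⟨e, 0, by
      intro h; rw [h, norm_zero] at he; exact zero_ne_one he⟩
    have h1 : ‖((ContinuousLinearEquiv.refl ℝ (EuclideanSpace ℝ (Fin N))).symm :
        EuclideanSpace ℝ (Fin N) →L[ℝ] EuclideanSpace ℝ (Fin N))‖₊ = 1 := by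
      have : ((ContinuousLinearEquiv.refl ℝ (EuclideanSpace ℝ (Fin N))).symm :
        EuclideanSpace ℝ (Fin N) →L[ℝ] EuclideanSpace ℝ (Fin N)) =
          ContinuousLinearMap.id ℝ _ := rfl
      rw [this]; ext; simp
    rw [h1, inv_one]; 
    rw [← NNReal.coe_lt_coe]; push_cast; norm_num
  have hΦ : ∀ y, (hap.toHomeomorph _ hc) y = y + (t * η y) • e := fun y => rfl
  have hD : ∀ x, HasFDerivAt (hap.toHomeomorph _ hc) (DPhi t (gradient η x) e) x := by
    intro x
    have h1 : HasFDerivAt (fun y => y + (t * η y) • e) (DPhi t (gradient η x) e) x := by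
      have h2 := (hasFDerivAt_id x).add
        (((hgr x).hasFDerivAt.const_mul t).smul_const e)
      exact h2
    exact h1
  have hdet : ∀ x, (DPhi t (gradient η x) e).det ≠ 0 := by
    intro x
    rw [DPhi_det]
    have := (abs_le.1 (abs_inner_le_half he (hL x) ht)).1
    linarith
  refine ⟨hap.toHomeomorph _ hc, hΦ, ?_, hD⟩
  refine Homeomorph.contDiff_symm _ (f₀' := fun x =>
    (DPhi t (gradient η x) e).toContinuousLinearEquivOfDetNeZero (hdet x)) ?_ ?_
  · intro x
    rw [ContinuousLinearMap.coe_toContinuousLinearEquivOfDetNeZero]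
    exact hD x
  · have : ContDiff ℝ 1 (fun y => y + (t * η y) • e) := by fun_prop
    exact this

theorem shape1 {p : ℝ} (hp : 1 < p) {η : EuclideanSpace ℝ (Fin N) → ℝ} {L t : ℝ}
    {e : EuclideanSpace ℝ (Fin N)} (he : ‖e‖ = 1)
    (hL : ∀ x, ‖gradient η x‖ ≤ L) (ht : |t| * L ≤ 1 / 2)
    {Ω Ω' : Set (EuclideanSpace ℝ (Fin N))} (hΩ' : IsOpen Ω')
    {Φ : EuclideanSpace ℝ (Fin N) ≃ₜ EuclideanSpace ℝ (Fin N)}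
    (hΦs : ContDiff ℝ 1 Φ.symm)
    (hΦd : ∀ x, HasFDerivAt Φ (DPhi t (gradient η x) e) x)
    (hm : ∀ x ∈ Ω, Φ x ∈ Ω') {w : EuclideanSpace ℝ (Fin N) → ℝ} (hw : T1 Ω w) :
    lam1 p Ω' * ∫ x in Ω, |w x| ^ p * (1 + t * ⟪gradient η x, e⟫) ≤
      ∫ x in Ω, ‖gradient w x - (t * ⟪gradient w x, e⟫ / (1 + t * ⟪gradient η x, e⟫)) •
        gradient η x‖ ^ p * (1 + t * ⟪gradient η x, e⟫) := by
  have hp0 : p ≠ 0 := by linarith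
  have hd : ∀ x, 0 < 1 + t * ⟪gradient η x, e⟫ := by
    intro x
    have := (abs_le.1 (abs_inner_le_half he (hL x) ht)).1
    linarith
  have hW : T1 Ω' (fun y => w (Φ.symm y)) := by
    refine T1.of_compact (K := Φ '' tsupport w) hΩ' (hw.cd.comp hΦs).contDiffOn
      (hw.cs.isCompact.image Φ.continuous) ?_ ?_
    · rintro _ ⟨x, hx, rfl⟩
      exact hm x (hw.sub hx)
    · intro y hy
      apply image_eq_zero_of_notMem_tsupport
      intro h
      exact hy ⟨Φ.symm y, h, by simp⟩
  have hgrad : ∀ x, gradient (fun y => w (Φ.symm y)) (Φ x) = gradient w x -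
      (t * ⟪gradient w x, e⟫ / (1 + t * ⟪gradient η x, e⟫)) • gradient η x := by
    intro x
    set g := gradient (fun y => w (Φ.symm y)) (Φ x) with hg
    have h1 : HasGradientAt (fun y => w (Φ.symm y)) g (Φ x) :=
      (hW.cd.differentiable one_ne_zero _).hasGradientAt
    have h2 := h1.hasFDerivAt.comp x (hΦd x)
    have h3 : ((fun y => w (Φ.symm y)) ∘ Φ) = w := by ext y; simp
    rw [h3] at h2
    have h4 : gradient w x = g + (t * ⟪g, e⟫) • gradient η x := by
      refine (hga_of_fderiv h2 ?_).gradient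
      intro v
      simp [DPhi_apply, inner_add_left, inner_add_right, inner_smul_left, inner_smul_right]
      ring
    have h5 : ⟪gradient w x, e⟫ = ⟪g, e⟫ * (1 + t * ⟪gradient η x, e⟫) := by
      rw [h4, inner_add_left, inner_smul_left]; simp; ring
    rw [h5, mul_div_assoc, mul_div_assoc, div_self (hd x).ne', mul_one, h4]
    simp
  have hcv : ∀ F : EuclideanSpace ℝ (Fin N) → ℝ, ∫ y, F y =
      ∫ x, F (Φ x) * (1 + t * ⟪gradient η x, e⟫) := by
    intro F
    have := integral_image_eq_integral_abs_det_fderiv_smul volume (s := univ) (f := Φ)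
      MeasurableSet.univ (fun x _ => (hΦd x).hasFDerivWithinAt) Φ.injective.injOn F
    rw [image_univ, Φ.surjective.range_eq, setIntegral_univ, setIntegral_univ] at this
    rw [this]
    congr 1; ext x
    rw [DPhi_det, abs_of_pos (hd x), smul_eq_mul, mul_comm]
  have h := lam1_le hp hΩ' hW
  have e1 : ∫ x in Ω', |w (Φ.symm x)| ^ p = ∫ x in Ω, |w x| ^ p * (1 + t * ⟪gradient η x, e⟫) := by
    rw [setIntegral_eq_integral_of_forall_compl_eq_zero, hcv,
      setIntegral_eq_integral_of_forall_compl_eq_zero]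
    · simp
    · intro x hx
      rw [image_eq_zero_of_notMem_tsupport (fun h => hx (hw.sub h)), abs_zero, Real.zero_rpow hp0,
        zero_mul]
    · intro x hx
      have := image_eq_zero_of_notMem_tsupport (fun h => hx (hW.sub h))
      rw [this, abs_zero, Real.zero_rpow hp0]
  have e2 : ∫ x in Ω', ‖gradient (fun y => w (Φ.symm y)) x‖ ^ p =
      ∫ x in Ω, ‖gradient w x - (t * ⟪gradient w x, e⟫ / (1 + t * ⟪gradient η x, e⟫)) •
        gradient η x‖ ^ p * (1 + t * ⟪gradient η x, e⟫) := by
    rw [setIntegral_eq_integral_of_forall_compl_eq_zero, hcv,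
      setIntegral_eq_integral_of_forall_compl_eq_zero]
    · simp_rw [hgrad]
    · intro x hx
      rw [gradient_eq_zero_off (fun h => hx (hw.sub h))]
      simp [Real.zero_rpow hp0]
    · intro x hx
      rw [gradient_eq_zero_off (fun h => hx (hW.sub h)), norm_zero, Real.zero_rpow hp0]
  rw [e1, e2] at h
  exact h

end PH

section PI
variable {N : ℕ}

theorem dct_mul {Ω : Set (EuclideanSpace ℝ (Fin N))} (hΩ : IsOpen Ω) (hf : volume Ω ≠ ∞)
    {b : ℝ → EuclideanSpace ℝ (Fin N) → ℝ} {b0 F : EuclideanSpace ℝ (Fin N) → ℝ} {C M : ℝ}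
    (hb : ∀ ε, 0 < ε → ε < 1 → ContinuousOn (b ε) Ω)
    (hbC : ∀ ε, 0 < ε → ε < 1 → ∀ x ∈ Ω, |b ε x| ≤ C)
    (hF : ContinuousOn F Ω) (hFM : ∀ x ∈ Ω, |F x| ≤ M)
    (hlim : ∀ x ∈ Ω, Tendsto (fun ε => b ε x) (𝓝[>] 0) (𝓝 (b0 x))) :
    Tendsto (fun ε => ∫ x in Ω, b ε x * F x) (𝓝[>] 0) (𝓝 (∫ x in Ω, b0 x * F x)) := by
  have hev : ∀ᶠ ε in 𝓝[>] (0:ℝ), 0 < ε ∧ ε < 1 := Ioo_mem_nhdsGT one_pos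
  refine tendsto_integral_filter_of_dominated_convergence (fun _ => C * M) ?_ ?_ ?_ ?_
  · filter_upwards [hev] with ε hε
    exact ((hb ε hε.1 hε.2).mul hF).aestronglyMeasurable hΩ.measurableSet
  · filter_upwards [hev] with ε hε
    refine (ae_restrict_mem hΩ.measurableSet).mono fun x hx => ?_
    rw [Real.norm_eq_abs, abs_mul]
    have h1 := hbC ε hε.1 hε.2 x hx
    exact mul_le_mul h1 (hFM x hx) (abs_nonneg _) ((abs_nonneg _).trans h1)
  · have : IsFiniteMeasure (volume.restrict Ω) := ⟨by simpa using hf.lt_top⟩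
    exact integrable_const _
  · refine (ae_restrict_mem hΩ.measurableSet).mono fun x hx => ?_
    exact (hlim x hx).mul_const _

open Classical in
/-- truncated eigenfunction -/
noncomputable def weps (Ω : Set (EuclideanSpace ℝ (Fin N))) (u : EuclideanSpace ℝ (Fin N) → ℝ) (ε : ℝ) :
    EuclideanSpace ℝ (Fin N) → ℝ :=
  fun x => if x ∈ Ω then (max (u x - ε) 0) ^ (1 + ε) else 0

theorem EF.weps_T1 {R₀ R₁ s p lam : ℝ} {u : EuclideanSpace ℝ (Fin N) → ℝ} (h : EF N R₀ R₁ s p lam u)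
    {ε : ℝ} (hε : 0 < ε) : T1 (Om N R₀ R₁ s) (weps (Om N R₀ R₁ s) u ε) := by
  obtain ⟨V, hVo, hV, hVc⟩ := h.hV
  have hKc : IsCompact {x : EuclideanSpace ℝ (Fin N) | ‖x‖ ≤ R₁ ∧ R₀ ≤ ‖x - s • e1 N‖} := by
    refine (isCompact_closedBall (0 : EuclideanSpace ℝ (Fin N)) R₁).of_isClosed_subset
      isClosed_KC ?_
    intro x hx; simpa using hx.1
  have hsub : {x : EuclideanSpace ℝ (Fin N) | ‖x‖ ≤ R₁ ∧ R₀ ≤ ‖x - s • e1 N‖} ⊆ V :=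
    fun x hx => hV x hx.1 hx.2
  have hKcl : IsClosed ({x : EuclideanSpace ℝ (Fin N) | ‖x‖ ≤ R₁ ∧ R₀ ≤ ‖x - s • e1 N‖} ∩ u ⁻¹' Ici ε) :=
    (hVc.continuousOn.mono hsub).preimage_isClosed_of_isClosed isClosed_KC isClosed_Ici
  refine T1.of_compact (K := {x : EuclideanSpace ℝ (Fin N) | ‖x‖ ≤ R₁ ∧ R₀ ≤ ‖x - s • e1 N‖} ∩ u ⁻¹' Ici ε)
    isOpen_Om ?_ (hKc.of_isClosed_subset hKcl inter_subset_left) ?_ ?_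
  · have h1 : ContDiffOn ℝ 1 (fun x => (max (u x - ε) 0) ^ (1 + ε)) (Om N R₀ R₁ s) :=
      (contDiff_posq (by linarith : 1 < 1 + ε)).comp_contDiffOn (h.cdOm.sub contDiffOn_const)
    refine h1.congr fun x hx => ?_
    simp [weps, hx]
  · rintro x ⟨⟨h1, h2⟩, h3⟩
    have h3 : ε ≤ u x := h3
    rw [mem_Om h.hR₀]
    refine ⟨lt_of_le_of_ne h1 fun h4 => ?_, lt_of_le_of_ne h2 fun h4 => ?_⟩
    · rw [h.zo x h4] at h3; linarith
    · rw [h.zi x h4.symm] at h3; linarith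
  · intro x hx
    by_cases hxo : x ∈ Om N R₀ R₁ s
    · have h1 := (mem_Om h.hR₀).1 hxo
      have h2 : u x < ε := by
        by_contra hc
        exact hx ⟨⟨h1.1.le, h1.2.le⟩, not_lt.1 hc⟩
      simp only [weps, hxo, if_true]
      rw [max_eq_right (by linarith), Real.zero_rpow (by linarith)]
    · simp [weps, hxo]

theorem EF.weps_grad {R₀ R₁ s p lam : ℝ} {u : EuclideanSpace ℝ (Fin N) → ℝ} (h : EF N R₀ R₁ s p lam u)
    {ε : ℝ} (hε : 0 < ε) {x : EuclideanSpace ℝ (Fin N)} (hx : x ∈ Om N R₀ R₁ s) :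
    gradient (weps (Om N R₀ R₁ s) u ε) x = ((1 + ε) * (max (u x - ε) 0) ^ ε) • gradient u x := by
  have h1 := h.cdOm.hga isOpen_Om hx
  have h2 : HasGradientAt (fun y => u y - ε) (gradient u x) x := by
    simpa [sub_eq_add_neg] using hga_add_const (-ε) h1
  have h3 := hga_comp (F := fun t => (max t 0) ^ (1 + ε)) (f := fun y => u y - ε)
    (hasDerivAt_posq (by linarith : 1 < 1 + ε) (u x - ε)) h2
  have h4 : weps (Om N R₀ R₁ s) u ε =ᶠ[𝓝 x] fun y => (max (u y - ε) 0) ^ (1 + ε) := by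
    filter_upwards [isOpen_Om.mem_nhds hx] with y hy
    simp [weps, hy]
  have h5 := (h3.congr_of_eventuallyEq h4).gradient
  rw [h5]; congr 2
  ring_nf

theorem tendsto_c {a : ℝ} (ha : 0 < a) :
    Tendsto (fun ε : ℝ => (1 + ε) * (max (a - ε) 0) ^ ε) (𝓝[>] 0) (𝓝 1) := by
  have h1 : ContinuousAt (fun ε : ℝ => (1 + ε) * (max (a - ε) 0) ^ ε) 0 := by
    refine ContinuousAt.mul (by fun_prop) ?_
    refine ContinuousAt.rpow (by fun_prop) continuousAt_id ?_
    left
    simpa using ha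
  have h2 := h1.tendsto.mono_left (nhdsWithin_le_nhds (s := Ioi 0))
  simpa using h2

theorem tendsto_w {a : ℝ} (ha : 0 < a) :
    Tendsto (fun ε : ℝ => (max (a - ε) 0) ^ (1 + ε)) (𝓝[>] 0) (𝓝 a) := by
  have h1 : ContinuousAt (fun ε : ℝ => (max (a - ε) 0) ^ (1 + ε)) 0 := by
    refine ContinuousAt.rpow (by fun_prop) (by fun_prop) ?_
    left
    simpa using ha
  have h2 := h1.tendsto.mono_left (nhdsWithin_le_nhds (s := Ioi 0))
  simpa [max_eq_left ha.le] using h2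

theorem posq_bound {a M q ε : ℝ} (h0 : 0 < ε) (ha : a ≤ M) (hM : 0 < M) (hq : 0 ≤ q) (hq2 : q ≤ 2) :
    0 ≤ (max (a - ε) 0) ^ q ∧ (max (a - ε) 0) ^ q ≤ (1 + M) ^ (2 : ℝ) := by
  have h1 : 0 ≤ max (a - ε) 0 := le_max_right _ _
  refine ⟨by positivity, ?_⟩
  have h2 : max (a - ε) 0 ≤ 1 + M := max_le (by linarith) (by linarith)
  exact (Real.rpow_le_rpow h1 h2 hq).trans
    (Real.rpow_le_rpow_of_exponent_le (by linarith) hq2)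

/-- limits of integrals of weights -/
theorem EF.lim_c {R₀ R₁ s p lam : ℝ} {u : EuclideanSpace ℝ (Fin N) → ℝ} (h : EF N R₀ R₁ s p lam u)
    {F : EuclideanSpace ℝ (Fin N) → ℝ} {q A : ℝ} (hq : 0 < q)
    (hF : ContinuousOn F (Om N R₀ R₁ s)) (hFM : ∀ x ∈ Om N R₀ R₁ s, |F x| ≤ A) :
    Tendsto (fun ε => ∫ x in Om N R₀ R₁ s, ((1 + ε) * (max (u x - ε) 0) ^ ε) ^ q * F x) (𝓝[>] 0)
      (𝓝 (∫ x in Om N R₀ R₁ s, F x)) := by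
  obtain ⟨M, hM, hb⟩ := h.bdd
  have h1 := dct_mul (b := fun ε x => ((1 + ε) * (max (u x - ε) 0) ^ ε) ^ q) (b0 := fun _ => 1)
    (C := (2 * (1 + M) ^ (2:ℝ)) ^ q)
    isOpen_Om (Om_finite (N := N) (R₀ := R₀) (R₁ := R₁) (s := s)) ?_ ?_ hF hFM ?_
  · simpa using h1
  · intro ε h0 h1
    have hc := h.cdOm.continuousOn
    refine ContinuousOn.rpow_const (continuousOn_const.mul (ContinuousOn.rpow_const ?_ ?_)) ?_
    · exact (hc.sub continuousOn_const).sup continuousOn_const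
    · exact fun x _ => Or.inr h0.le
    · exact fun x _ => Or.inr hq.le
  · intro ε h0 h1 x hx
    have hx' := (mem_Om h.hR₀).1 hx
    have h2 := posq_bound h0 ((le_abs_self _).trans (hb x hx'.1.le hx'.2.le).1) hM h0.le
      (by linarith : ε ≤ 2)
    have h3 : 0 ≤ (1 + ε) * (max (u x - ε) 0) ^ ε := mul_nonneg (by linarith) h2.1
    rw [abs_of_nonneg (by positivity)]
    refine Real.rpow_le_rpow h3 ?_ hq.le
    exact mul_le_mul (by linarith) h2.2 h2.1 (by norm_num)
  · intro x hx
    have := (tendsto_c (h.pos x hx)).rpow_const (p := q) (Or.inr hq.le)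
    simpa using this

theorem EF.lim_w {R₀ R₁ s p lam : ℝ} {u : EuclideanSpace ℝ (Fin N) → ℝ} (h : EF N R₀ R₁ s p lam u)
    {F : EuclideanSpace ℝ (Fin N) → ℝ} {q A : ℝ} (hq : 0 < q)
    (hF : ContinuousOn F (Om N R₀ R₁ s)) (hFM : ∀ x ∈ Om N R₀ R₁ s, |F x| ≤ A) :
    Tendsto (fun ε => ∫ x in Om N R₀ R₁ s, |weps (Om N R₀ R₁ s) u ε x| ^ q * F x) (𝓝[>] 0)
      (𝓝 (∫ x in Om N R₀ R₁ s, |u x| ^ q * F x)) := by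
  obtain ⟨M, hM, hb⟩ := h.bdd
  refine dct_mul (C := ((1 + M) ^ (2:ℝ)) ^ q)
    isOpen_Om (Om_finite (N := N) (R₀ := R₀) (R₁ := R₁) (s := s)) ?_ ?_ hF hFM ?_
  · intro ε h0 h1
    refine ContinuousOn.rpow_const (h.weps_T1 h0).cd.continuous.abs.continuousOn ?_
    exact fun x _ => Or.inr hq.le
  · intro ε h0 h1 x hx
    have hx' := (mem_Om h.hR₀).1 hx
    have h2 := posq_bound h0 ((le_abs_self _).trans (hb x hx'.1.le hx'.2.le).1) hM
      (by linarith : 0 ≤ 1 + ε) (by linarith : 1 + ε ≤ 2)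
    rw [abs_of_nonneg (by positivity)]
    refine Real.rpow_le_rpow (abs_nonneg _) ?_ hq.le
    simp only [weps, hx, if_true]
    rw [abs_of_nonneg h2.1]; exact h2.2
  · intro x hx
    have := ((tendsto_w (h.pos x hx)).abs).rpow_const (p := q) (Or.inr hq.le)
    simpa [weps, hx] using this

theorem EF.energy {R₀ R₁ s p lam : ℝ} {u : EuclideanSpace ℝ (Fin N) → ℝ} (h : EF N R₀ R₁ s p lam u) :
    ∫ x in Om N R₀ R₁ s, ‖gradient u x‖ ^ p = lam * ∫ x in Om N R₀ R₁ s, |u x| ^ p := by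
  have hp := h.hp
  obtain ⟨M, hM, hb⟩ := h.bdd
  have hgc := h.cdOm.cont_grad isOpen_Om
  have hc := h.cdOm.continuousOn
  have l1 := h.lim_c (q := 1) (F := fun x => ‖gradient u x‖ ^ p) (A := M ^ p) one_pos
    (hgc.norm.rpow_const fun x _ => Or.inr (by linarith)) (by
      intro x hx
      have hx' := (mem_Om h.hR₀).1 hx
      rw [abs_of_nonneg (by positivity)]
      exact Real.rpow_le_rpow (norm_nonneg _) (hb x hx'.1.le hx'.2.le).2 (by linarith))
  have l2 := h.lim_w (q := 1) (F := fun x => lam * u x ^ (p - 1)) (A := lam * M ^ (p - 1)) one_pos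
    (continuousOn_const.mul (hc.rpow_const fun x _ => Or.inr (by linarith))) (by
      intro x hx
      have hx' := (mem_Om h.hR₀).1 hx
      have hu := (h.pos x hx).le
      have hl := h.hl
      rw [abs_of_nonneg (by positivity)]
      refine mul_le_mul_of_nonneg_left ?_ hl
      exact Real.rpow_le_rpow hu ((le_abs_self _).trans (hb x hx'.1.le hx'.2.le).1) (by linarith))
  have heq : ∀ᶠ ε in 𝓝[>] (0:ℝ), (∫ x in Om N R₀ R₁ s, |weps (Om N R₀ R₁ s) u ε x| ^ (1:ℝ) * (lam * u x ^ (p - 1))) =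
      ∫ x in Om N R₀ R₁ s, ((1 + ε) * (max (u x - ε) 0) ^ ε) ^ (1:ℝ) * ‖gradient u x‖ ^ p := by
    filter_upwards [self_mem_nhdsWithin] with ε hε
    have hε : 0 < ε := hε
    have := h.we _ (h.weps_T1 hε)
    rw [setIntegral_congr_fun isOpen_Om.measurableSet (g := fun x => |weps (Om N R₀ R₁ s) u ε x| ^ (1:ℝ) * (lam * u x ^ (p - 1))) (f := fun x => lam * u x ^ (p - 1) * weps (Om N R₀ R₁ s) u ε x)] at this
    · rw [← this]
      refine setIntegral_congr_fun isOpen_Om.measurableSet fun x hx => ?_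
      rw [h.weps_grad hε hx, inner_smul_right, inner_pa_self hp, Real.rpow_one]
    · intro x hx
      simp only [weps, hx, if_true, Real.rpow_one]
      rw [abs_of_nonneg (by positivity)]; ring
  have l3 := tendsto_nhds_unique (l2.congr' heq) l1
  rw [← l3, ← integral_const_mul]
  refine setIntegral_congr_fun isOpen_Om.measurableSet fun x hx => ?_
  have hu := h.pos x hx
  simp only [Real.rpow_one]
  rw [abs_of_pos hu]
  have : u x ^ p = u x * u x ^ (p - 1) := by
    rw [← Real.rpow_one_add' hu.le (by linarith)]; congr 1; ring
  rw [this]; ring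

end PI

section PJ
variable {N : ℕ}

/-- transformed gradient -/
noncomputable def XX (t : ℝ) (U G e : EuclideanSpace ℝ (Fin N)) : EuclideanSpace ℝ (Fin N) :=
  U - (t * ⟪U, e⟫ / (1 + t * ⟪G, e⟫)) • G

theorem XX_smul (t c : ℝ) (U G e : EuclideanSpace ℝ (Fin N)) :
    XX t (c • U) G e = c • XX t U G e := by
  simp only [XX, inner_smul_left, smul_sub, smul_smul]
  congr 2
  simp; ring

theorem XX_bound {t L M : ℝ} {U G e : EuclideanSpace ℝ (Fin N)} (he : ‖e‖ = 1)
    (hG : ‖G‖ ≤ L) (ht : |t| * L ≤ 1 / 2) (hU : ‖U‖ ≤ M) : ‖XX t U G e‖ ≤ 2 * M := by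
  have hJ := (abs_le.1 (abs_inner_le_half he hG ht)).1
  have hb := abs_real_inner_le_norm U e
  rw [he, mul_one] at hb
  have h1 : ‖(t * ⟪U, e⟫ / (1 + t * ⟪G, e⟫)) • G‖ ≤ M := by
    rw [norm_smul, Real.norm_eq_abs, abs_div, abs_mul, abs_of_pos (by linarith : 0 < 1 + t * ⟪G, e⟫),
      div_mul_eq_mul_div, div_le_iff₀ (by linarith)]
    have h2 : |t| * |⟪U, e⟫| * ‖G‖ ≤ |t| * L * M := by
      have : |⟪U, e⟫| * ‖G‖ ≤ M * L := mul_le_mul (hb.trans hU) hG (norm_nonneg _)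
        ((norm_nonneg _).trans hU)
      have := mul_le_mul_of_nonneg_left this (abs_nonneg t)
      linarith
    have hM : 0 ≤ M := (norm_nonneg _).trans hU
    nlinarith
  unfold XX
  exact (norm_sub_le _ _).trans (by linarith)

theorem EF.shape_u {R₀ R₁ s p lam : ℝ} {u : EuclideanSpace ℝ (Fin N) → ℝ} (h : EF N R₀ R₁ s p lam u)
    {η : EuclideanSpace ℝ (Fin N) → ℝ} (hη : ContDiff ℝ 1 η) {L t : ℝ}
    {e : EuclideanSpace ℝ (Fin N)} (he : ‖e‖ = 1)
    (hL : ∀ x, ‖gradient η x‖ ≤ L) (ht : |t| * L ≤ 1 / 2)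
    {Ω' : Set (EuclideanSpace ℝ (Fin N))} (hΩ' : IsOpen Ω')
    {Φ : EuclideanSpace ℝ (Fin N) ≃ₜ EuclideanSpace ℝ (Fin N)}
    (hΦs : ContDiff ℝ 1 Φ.symm)
    (hΦd : ∀ x, HasFDerivAt Φ (DPhi t (gradient η x) e) x)
    (hm : ∀ x ∈ Om N R₀ R₁ s, Φ x ∈ Ω') :
    lam1 p Ω' * ∫ x in Om N R₀ R₁ s, |u x| ^ p * (1 + t * ⟪gradient η x, e⟫) ≤
      ∫ x in Om N R₀ R₁ s, ‖XX t (gradient u x) (gradient η x) e‖ ^ p *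
        (1 + t * ⟪gradient η x, e⟫) := by
  have hp := h.hp
  obtain ⟨M, hM, hb⟩ := h.bdd
  have hgc := h.cdOm.cont_grad isOpen_Om
  have hηc := hη.cont_grad
  have hJ : ∀ x, |1 + t * ⟪gradient η x, e⟫| ≤ 2 ∧ 0 < 1 + t * ⟪gradient η x, e⟫ := by
    intro x
    have := abs_le.1 (abs_inner_le_half he (hL x) ht)
    refine ⟨?_, by linarith⟩
    rw [abs_of_pos (by linarith)]; linarith
  have hJc : Continuous fun x => 1 + t * ⟪gradient η x, e⟫ := by fun_prop
  have l1 := h.lim_w (q := p) (F := fun x => 1 + t * ⟪gradient η x, e⟫) (A := 2) (by linarith)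
    hJc.continuousOn (fun x _ => (hJ x).1)
  have hXc : ContinuousOn (fun x => XX t (gradient u x) (gradient η x) e) (Om N R₀ R₁ s) := by
    unfold XX
    have h0 : ContinuousOn (fun x => t * ⟪gradient u x, e⟫ / (1 + t * ⟪gradient η x, e⟫))
        (Om N R₀ R₁ s) :=
      ContinuousOn.div (continuousOn_const.mul (hgc.inner continuousOn_const))
        hJc.continuousOn fun x _ => (hJ x).2.ne'
    exact hgc.sub (h0.smul hηc.continuousOn)
  have l2 := h.lim_c (q := p) (F := fun x => ‖XX t (gradient u x) (gradient η x) e‖ ^ p *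
        (1 + t * ⟪gradient η x, e⟫)) (A := (2 * M) ^ p * 2) (by linarith)
      ((hXc.norm.rpow_const fun x _ => Or.inr (by linarith)).mul hJc.continuousOn) (by
        intro x hx
        have hx' := (mem_Om h.hR₀).1 hx
        rw [abs_mul, abs_of_nonneg (by positivity : 0 ≤ ‖XX t (gradient u x) (gradient η x) e‖ ^ p)]
        refine mul_le_mul ?_ (hJ x).1 (abs_nonneg _) (by positivity)
        exact Real.rpow_le_rpow (norm_nonneg _)
          (XX_bound he (hL x) ht (hb x hx'.1.le hx'.2.le).2) (by linarith))
  refine le_of_tendsto_of_tendsto (l1.const_mul _) l2 ?_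
  filter_upwards [self_mem_nhdsWithin] with ε hε
  have hε : 0 < ε := hε
  refine (shape1 hp he hL ht hΩ' hΦs hΦd hm (h.weps_T1 hε)).trans (le_of_eq ?_)
  refine setIntegral_congr_fun isOpen_Om.measurableSet fun x hx => ?_
  have hc : 0 ≤ (1 + ε) * (max (u x - ε) 0) ^ ε := by positivity
  have e2 := XX_smul t ((1 + ε) * (max (u x - ε) 0) ^ ε) (gradient u x) (gradient η x) e
  rw [← h.weps_grad hε hx] at e2
  have e3 : ‖XX t (gradient (weps (Om N R₀ R₁ s) u ε) x) (gradient η x) e‖ ^ p =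
      ((1 + ε) * (max (u x - ε) 0) ^ ε) ^ p * ‖XX t (gradient u x) (gradient η x) e‖ ^ p := by
    rw [e2, norm_smul, Real.norm_eq_abs, abs_of_nonneg hc, Real.mul_rpow hc (norm_nonneg _)]
  unfold XX at e3 ⊢
  rw [e3]; ring

theorem XX_deriv {p : ℝ} (hp : 1 < p) {t : ℝ} {U G e : EuclideanSpace ℝ (Fin N)}
    (hJ : 0 < 1 + t * ⟪G, e⟫) :
    HasDerivAt (fun t => ‖XX t U G e‖ ^ p * (1 + t * ⟪G, e⟫))
      (p * ⟪pa p (XX t U G e), (-(⟪U, e⟫ / (1 + t * ⟪G, e⟫) ^ 2)) • G⟫ * (1 + t * ⟪G, e⟫)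
        + ‖XX t U G e‖ ^ p * ⟪G, e⟫) t := by
  have hJd : HasDerivAt (fun t => 1 + t * ⟪G, e⟫) (⟪G, e⟫) t := by
    simpa using ((hasDerivAt_id t).mul_const (⟪G, e⟫)).const_add 1
  have h1 : HasDerivAt (fun t => t * ⟪U, e⟫ / (1 + t * ⟪G, e⟫))
      (⟪U, e⟫ / (1 + t * ⟪G, e⟫) ^ 2) t := by
    have h2 : HasDerivAt (fun t => t * ⟪U, e⟫) (⟪U, e⟫) t := by
      simpa using (hasDerivAt_id t).mul_const (⟪U, e⟫)
    have h3 := h2.div hJd hJ.ne'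
    refine h3.congr_deriv ?_
    congr 1; ring
  have h2 : HasDerivAt (fun t => XX t U G e) ((-(⟪U, e⟫ / (1 + t * ⟪G, e⟫) ^ 2)) • G) t := by
    unfold XX
    have := (h1.smul_const G).const_sub U
    simpa [neg_smul] using this
  have h3 := (hasFDerivAt_norm_rpow (XX t U G e) hp).comp_hasDerivAt t h2
  have h4 := h3.mul hJd
  refine h4.congr_deriv ?_
  simp only [pa, inner_smul_left, Function.comp]
  simp
  left; ring

theorem EF.B_deriv {R₀ R₁ s p lam : ℝ} {u : EuclideanSpace ℝ (Fin N) → ℝ} (h : EF N R₀ R₁ s p lam u)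
    {η : EuclideanSpace ℝ (Fin N) → ℝ} (hη : ContDiff ℝ 1 η) {L δ : ℝ}
    {e : EuclideanSpace ℝ (Fin N)} (he : ‖e‖ = 1)
    (hL : ∀ x, ‖gradient η x‖ ≤ L) (hδ : 0 < δ) (hδL : δ * L ≤ 1 / 2) :
    HasDerivAt (fun t => ∫ x in Om N R₀ R₁ s, ‖XX t (gradient u x) (gradient η x) e‖ ^ p *
        (1 + t * ⟪gradient η x, e⟫))
      (∫ x in Om N R₀ R₁ s, (‖gradient u x‖ ^ p * ⟪gradient η x, e⟫ -
        p * ⟪gradient u x, e⟫ * ⟪pa p (gradient u x), gradient η x⟫)) 0 := by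
  have hp := h.hp
  have hp0 : 0 < p := by linarith
  obtain ⟨M, hM, hb⟩ := h.bdd
  have hgc := h.cdOm.cont_grad isOpen_Om
  have hηc := hη.cont_grad
  have hL0 : 0 ≤ L := (norm_nonneg _).trans (hL 0)
  have htL : ∀ t ∈ ball (0:ℝ) δ, |t| * L ≤ 1 / 2 := by
    intro t ht
    rw [mem_ball_zero_iff, Real.norm_eq_abs] at ht
    exact (mul_le_mul_of_nonneg_right ht.le hL0).trans hδL
  have hJ : ∀ t ∈ ball (0:ℝ) δ, ∀ x, 1 / 2 ≤ 1 + t * ⟪gradient η x, e⟫ ∧ 1 + t * ⟪gradient η x, e⟫ ≤ 2 := by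
    intro t ht x
    have := abs_le.1 (abs_inner_le_half he (hL x) (htL t ht))
    constructor <;> linarith
  have hJc : ∀ t, Continuous fun x => 1 + t * ⟪gradient η x, e⟫ := by intro t; fun_prop
  have hfin : IsFiniteMeasure (volume.restrict (Om N R₀ R₁ s)) := ⟨by simpa using Om_finite.lt_top⟩
  have hXc : ∀ t ∈ ball (0:ℝ) δ,
      ContinuousOn (fun x => XX t (gradient u x) (gradient η x) e) (Om N R₀ R₁ s) := by
    intro t ht
    unfold XX
    have h0 : ContinuousOn (fun x => t * ⟪gradient u x, e⟫ / (1 + t * ⟪gradient η x, e⟫))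
        (Om N R₀ R₁ s) :=
      ContinuousOn.div (continuousOn_const.mul (hgc.inner continuousOn_const))
        (hJc t).continuousOn fun x _ => by linarith [(hJ t ht x).1]
    exact hgc.sub (h0.smul hηc.continuousOn)
  have hFc : ∀ t ∈ ball (0:ℝ) δ, ContinuousOn (fun x => ‖XX t (gradient u x) (gradient η x) e‖ ^ p *
        (1 + t * ⟪gradient η x, e⟫)) (Om N R₀ R₁ s) := fun t ht =>
    ((hXc t ht).norm.rpow_const fun x _ => Or.inr hp0.le).mul (hJc t).continuousOn
  have h0m : (0:ℝ) ∈ ball (0:ℝ) δ := mem_ball_self hδ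
  have hXb : ∀ t ∈ ball (0:ℝ) δ, ∀ x ∈ Om N R₀ R₁ s,
      ‖XX t (gradient u x) (gradient η x) e‖ ≤ 2 * M := by
    intro t ht x hx
    have hx' := (mem_Om h.hR₀).1 hx
    exact XX_bound he (hL x) (htL t ht) (hb x hx'.1.le hx'.2.le).2
  have hX0 : ∀ U G : EuclideanSpace ℝ (Fin N), XX 0 U G e = U := by intro U G; simp [XX]
  have hmain := hasDerivAt_integral_of_dominated_loc_of_deriv_le
    (μ := volume.restrict (Om N R₀ R₁ s)) (x₀ := (0:ℝ)) (s := ball (0:ℝ) δ)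
    (F := fun t x => ‖XX t (gradient u x) (gradient η x) e‖ ^ p * (1 + t * ⟪gradient η x, e⟫))
    (F' := fun t x => p * ⟪pa p (XX t (gradient u x) (gradient η x) e),
      (-(⟪gradient u x, e⟫ / (1 + t * ⟪gradient η x, e⟫) ^ 2)) • gradient η x⟫ *
        (1 + t * ⟪gradient η x, e⟫)
        + ‖XX t (gradient u x) (gradient η x) e‖ ^ p * ⟪gradient η x, e⟫)
    (bound := fun _ => p * ((2 * M) ^ (p - 1) * (4 * M * L)) * 2 + (2 * M) ^ p * L)
    (ball_mem_nhds 0 hδ) ?_ ?_ ?_ ?_ (integrable_const _) ?_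
  · refine hmain.2.congr_deriv ?_
    congr 1; ext x
    simp only [hX0, inner_smul_right]
    simp
    ring
  · filter_upwards [ball_mem_nhds (0:ℝ) hδ] with t ht
    exact (hFc t ht).aestronglyMeasurable isOpen_Om.measurableSet
  · refine Integrable.of_bound
      ((hFc 0 h0m).aestronglyMeasurable isOpen_Om.measurableSet) ((2 * M) ^ p * 2) ?_
    refine (ae_restrict_mem isOpen_Om.measurableSet).mono fun x hx => ?_
    rw [norm_mul, Real.norm_eq_abs, Real.norm_eq_abs,
      abs_of_nonneg (by linarith [(hJ 0 h0m x).1] : 0 ≤ 1 + 0 * ⟪gradient η x, e⟫),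
      abs_of_nonneg (by positivity)]
    refine mul_le_mul ?_ (hJ 0 h0m x).2 (by linarith [(hJ 0 h0m x).1]) (by positivity)
    exact Real.rpow_le_rpow (norm_nonneg _) (hXb 0 h0m x hx) hp0.le
  · refine ContinuousOn.aestronglyMeasurable ?_ isOpen_Om.measurableSet
    simp only [hX0]
    have hi : ContinuousOn (fun x => -(⟪gradient u x, e⟫ / (1 + 0 * ⟪gradient η x, e⟫) ^ 2))
        (Om N R₀ R₁ s) := by
      simp only [zero_mul, add_zero, one_pow, div_one]
      exact (hgc.inner continuousOn_const).neg
    have h1 : ContinuousOn (fun x => (-(⟪gradient u x, e⟫ / (1 + 0 * ⟪gradient η x, e⟫) ^ 2)) •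
        gradient η x) (Om N R₀ R₁ s) := hi.smul hηc.continuousOn
    have h2 : ContinuousOn (fun x => pa p (gradient u x)) (Om N R₀ R₁ s) :=
      (continuous_pa hp).comp_continuousOn hgc
    have h3 : ContinuousOn (fun x => ⟪gradient η x, e⟫) (Om N R₀ R₁ s) :=
      hηc.continuousOn.inner continuousOn_const
    exact ((continuousOn_const.mul (h2.inner h1)).mul (hJc 0).continuousOn).add
      ((hgc.norm.rpow_const fun x _ => Or.inr hp0.le).mul h3)
  · refine (ae_restrict_mem isOpen_Om.measurableSet).mono fun x hx => ?_
    intro t ht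
    have hx' := (mem_Om h.hR₀).1 hx
    obtain ⟨hJ1, hJ2⟩ := hJ t ht x
    have hX := hXb t ht x hx
    have hU := (hb x hx'.1.le hx'.2.le).2
    have hUe := abs_real_inner_le_norm (gradient u x) e
    have hGe := abs_real_inner_le_norm (gradient η x) e
    rw [he, mul_one] at hUe hGe
    have hn : ‖(-(⟪gradient u x, e⟫ / (1 + t * ⟪gradient η x, e⟫) ^ 2)) • gradient η x‖ ≤ 4 * M * L := by
      rw [norm_smul, norm_neg, Real.norm_eq_abs, abs_div, abs_of_nonneg (by positivity :
        0 ≤ (1 + t * ⟪gradient η x, e⟫) ^ 2)]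
      refine mul_le_mul ?_ (hL x) (norm_nonneg _) (by positivity)
      rw [div_le_iff₀ (by positivity)]
      have : 1 / 4 ≤ (1 + t * ⟪gradient η x, e⟫) ^ 2 := by nlinarith
      nlinarith
    have hin := abs_real_inner_le_norm (pa p (XX t (gradient u x) (gradient η x) e))
      ((-(⟪gradient u x, e⟫ / (1 + t * ⟪gradient η x, e⟫) ^ 2)) • gradient η x)
    rw [norm_pa hp] at hin
    have h1 : ‖XX t (gradient u x) (gradient η x) e‖ ^ (p - 1) ≤ (2 * M) ^ (p - 1) :=
      Real.rpow_le_rpow (norm_nonneg _) hX (by linarith)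
    have h2 : ‖XX t (gradient u x) (gradient η x) e‖ ^ p ≤ (2 * M) ^ p :=
      Real.rpow_le_rpow (norm_nonneg _) hX (by linarith)
    have h3 := hin.trans (mul_le_mul h1 hn (norm_nonneg _) (by positivity))
    refine (norm_add_le _ _).trans (add_le_add ?_ ?_)
    · rw [norm_mul, norm_mul, Real.norm_eq_abs, Real.norm_eq_abs, Real.norm_eq_abs, abs_of_pos hp0,
        abs_of_nonneg (by linarith : 0 ≤ 1 + t * ⟪gradient η x, e⟫)]
      refine mul_le_mul ?_ hJ2 (by linarith) (by positivity)
      exact mul_le_mul_of_nonneg_left h3 hp0.le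
    · rw [norm_mul, Real.norm_eq_abs, Real.norm_eq_abs, abs_of_nonneg (by positivity)]
      exact mul_le_mul h2 (hGe.trans (hL x)) (abs_nonneg _) (by positivity)
  · refine (ae_restrict_mem isOpen_Om.measurableSet).mono fun x hx => ?_
    intro t ht
    exact XX_deriv hp (by linarith [(hJ t ht x).1])

end PJ

section PK
variable {N : ℕ}

/-- radial cut-off near the outer sphere -/
noncomputable def eta (k R₁ : ℝ) (x : EuclideanSpace ℝ (Fin N)) : ℝ :=
  Real.smoothTransition (k * (R₁ ^ 2 - ‖x‖ ^ 2) - 1)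

theorem eta_cd (k R₁ : ℝ) : ContDiff ℝ 1 (eta k R₁ : EuclideanSpace ℝ (Fin N) → ℝ) := by
  have h1 : ContDiff ℝ 1 (fun x : EuclideanSpace ℝ (Fin N) => k * (R₁ ^ 2 - ‖x‖ ^ 2) - 1) :=
    (contDiff_const.mul (contDiff_const.sub (contDiff_norm_sq ℝ))).sub contDiff_const
  exact Real.smoothTransition.contDiff.comp h1

theorem eta_grad (k R₁ : ℝ) (x : EuclideanSpace ℝ (Fin N)) :
    gradient (eta k R₁) x =
      (-(2 * k * deriv Real.smoothTransition (k * (R₁ ^ 2 - ‖x‖ ^ 2) - 1))) • x := by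
  have h1 : HasGradientAt (fun x : EuclideanSpace ℝ (Fin N) => k * (R₁ ^ 2 - ‖x‖ ^ 2) - 1)
      ((-(2 * k)) • x) x := by
    have h2 : HasFDerivAt (fun x : EuclideanSpace ℝ (Fin N) => ‖x‖ ^ 2) (2 • innerSL ℝ x) x :=
      (hasStrictFDerivAt_norm_sq x).hasFDerivAt
    have h3 := ((h2.const_sub (R₁ ^ 2)).const_mul k).sub_const 1
    refine hga_of_fderiv h3 fun v => ?_
    simp [inner_smul_left]; ring
  have h4 := hga_comp (F := Real.smoothTransition)
    (f := fun x : EuclideanSpace ℝ (Fin N) => k * (R₁ ^ 2 - ‖x‖ ^ 2) - 1) (smooth_deriv _) h1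
  have h5 : HasGradientAt (eta k R₁) _ x := h4
  rw [h5.gradient, smul_smul]
  congr 1; ring

theorem eta_grad_bdd {k R₁ : ℝ} (hk : 0 < k) (hR : 0 < R₁) : ∃ L : ℝ, 0 < L ∧
    ∀ x : EuclideanSpace ℝ (Fin N), ‖gradient (eta k R₁) x‖ ≤ L := by
  obtain ⟨C, hC, hb⟩ := smooth_deriv_bdd
  refine ⟨2 * k * C * R₁ + 1, by positivity, fun x => ?_⟩
  rw [eta_grad, norm_smul, norm_neg, Real.norm_eq_abs, abs_mul, abs_of_pos (by positivity : 0 < 2 * k)]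
  by_cases h : k * (R₁ ^ 2 - ‖x‖ ^ 2) - 1 < 0
  · rw [smooth_deriv_zero (Or.inl h)]; simp; positivity
  · have h1 : ‖x‖ ≤ R₁ := by
      refine abs_le_of_sq_le_sq' ?_ hR.le |>.2
      by_contra hc
      have : k * (R₁ ^ 2 - ‖x‖ ^ 2) < 0 := mul_neg_of_pos_of_neg hk (by linarith)
      linarith
    have h2 := hb (k * (R₁ ^ 2 - ‖x‖ ^ 2) - 1)
    have : 2 * k * |deriv Real.smoothTransition (k * (R₁ ^ 2 - ‖x‖ ^ 2) - 1)| * ‖x‖ ≤ 2 * k * C * R₁ := by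
      gcongr
    linarith

theorem Om_map {k R₀ R₁ s : ℝ} (hN : 2 ≤ N) (hR₀ : 0 < R₀) (hs : 0 < s) (hR₁ : 0 < R₁) (hk : 0 < k)
    (hk2 : (R₀ + s) ^ 2 ≤ R₁ ^ 2 - 2 / k) {t : ℝ} (ht1 : |t| ≤ 1) (ht2 : |t| * (2 * R₁ + 1) ≤ 1 / k)
    {Φ : EuclideanSpace ℝ (Fin N) ≃ₜ EuclideanSpace ℝ (Fin N)}
    (hΦ : ∀ y, Φ y = y + (t * eta k R₁ y) • e1 N) {x : EuclideanSpace ℝ (Fin N)}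
    (hx : x ∈ Om N R₀ R₁ s) : Φ x ∈ Om N R₀ R₁ (s + t) := by
  rw [mem_Om hR₀] at hx ⊢
  constructor
  · rw [hΦ]
    by_cases h0 : eta k R₁ x = 0
    · rw [h0]; simpa using hx.1
    · have h1 : 0 < k * (R₁ ^ 2 - ‖x‖ ^ 2) - 1 := by
        by_contra hc
        exact h0 (Real.smoothTransition.zero_of_nonpos (not_lt.1 hc))
      have h2 : 1 / k < R₁ ^ 2 - ‖x‖ ^ 2 := by rw [div_lt_iff₀ hk]; linarith
      have h3 : ‖(t * eta k R₁ x) • e1 N‖ ≤ |t| := by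
        rw [norm_smul, norm_e1 hN, mul_one, Real.norm_eq_abs, abs_mul]
        have : |eta k R₁ x| ≤ 1 := by
          have h0 : 0 ≤ eta k R₁ x := Real.smoothTransition.nonneg _
          rw [abs_of_nonneg h0]
          exact Real.smoothTransition.le_one _
        exact mul_le_of_le_one_right (abs_nonneg t) this
      refine lt_of_le_of_lt ((norm_add_le _ _).trans (add_le_add_right h3 _)) ?_
      have h4 : (‖x‖ + |t|) ^ 2 < R₁ ^ 2 := by
        have : ‖x‖ * |t| ≤ R₁ * |t| := mul_le_mul_of_nonneg_right hx.1.le (abs_nonneg t)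
        nlinarith [abs_nonneg t]
      exact lt_of_pow_lt_pow_left₀ 2 hR₁.le h4
  · by_contra hc
    rw [not_lt] at hc
    have h1 : Φ x - (s + t) • e1 N = (Φ x - t • e1 N) - s • e1 N := by
      rw [add_smul]; abel
    rw [h1] at hc
    have h2 := near_of_norm hN hs hc
    have h3 : eta k R₁ (Φ x - t • e1 N) = 1 := by
      refine Real.smoothTransition.one_of_one_le ?_
      have h4 : ‖Φ x - t • e1 N‖ ^ 2 ≤ (R₀ + s) ^ 2 := by
        have := norm_nonneg (Φ x - t • e1 N); nlinarith
      have h5 : k * (2 / k) ≤ k * (R₁ ^ 2 - ‖Φ x - t • e1 N‖ ^ 2) :=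
        mul_le_mul_of_nonneg_left (by linarith) hk.le
      rw [mul_div_cancel₀ _ hk.ne'] at h5
      linarith
    have h4 : Φ (Φ x - t • e1 N) = Φ x := by
      rw [hΦ (Φ x - t • e1 N), h3]; simp
    have h5 := Φ.injective h4
    rw [h5] at hc
    exact absurd hx.2 (not_lt.2 hc)

theorem EF.shape_id {R₀ R₁ s p : ℝ} {u : EuclideanSpace ℝ (Fin N) → ℝ}
    (h : EF N R₀ R₁ s p (lam1 p (Om N R₀ R₁ s)) u)
    (hd : HasDerivAt (fun t : ℝ => lam1 p (Om N R₀ R₁ t)) 0 s)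
    {k : ℝ} (hk : 0 < k) (hk2 : (R₀ + s) ^ 2 ≤ R₁ ^ 2 - 2 / k) :
    ∫ x in Om N R₀ R₁ s, (‖gradient u x‖ ^ p * ⟪gradient (eta k R₁) x, e1 N⟫ -
        p * ⟪gradient u x, e1 N⟫ * ⟪pa p (gradient u x), gradient (eta k R₁) x⟫) =
      lam1 p (Om N R₀ R₁ s) * ∫ x in Om N R₀ R₁ s, |u x| ^ p * ⟪gradient (eta k R₁) x, e1 N⟫ := by
  have hR₁ : 0 < R₁ := h.hR₀.trans h.hR
  have he := norm_e1 h.hN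
  have hp := h.hp
  obtain ⟨L, hL0, hL⟩ := eta_grad_bdd (N := N) hk hR₁
  have hη := eta_cd (N := N) k R₁
  have hηc := hη.cont_grad
  obtain ⟨M, hM, hb⟩ := h.bdd
  set δ : ℝ := min (1 / (2 * L)) (min 1 (1 / k / (2 * R₁ + 1))) with hδ
  have hδ0 : 0 < δ := by positivity
  have hδL : δ * L ≤ 1 / 2 := by
    have : δ ≤ 1 / (2 * L) := min_le_left _ _
    calc δ * L ≤ 1 / (2 * L) * L := mul_le_mul_of_nonneg_right this hL0.le
      _ = 1 / 2 := by field_simp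
  have hB := h.B_deriv hη he hL hδ0 hδL
  set A0 := ∫ x in Om N R₀ R₁ s, |u x| ^ p with hA0
  set A1 := ∫ x in Om N R₀ R₁ s, |u x| ^ p * ⟪gradient (eta k R₁) x, e1 N⟫ with hA1
  have huc : ContinuousOn (fun x => |u x| ^ p) (Om N R₀ R₁ s) :=
    h.cdOm.continuousOn.abs.rpow_const fun x _ => Or.inr (by linarith)
  have hfin : IsFiniteMeasure (volume.restrict (Om N R₀ R₁ s)) := ⟨by simpa using Om_finite.lt_top⟩
  have hub : ∀ x ∈ Om N R₀ R₁ s, |u x| ^ p ≤ M ^ p := by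
    intro x hx
    have hx' := (mem_Om h.hR₀).1 hx
    exact Real.rpow_le_rpow (abs_nonneg _) (hb x hx'.1.le hx'.2.le).1 (by linarith)
  have hi0 : IntegrableOn (fun x => |u x| ^ p) (Om N R₀ R₁ s) := by
    refine Integrable.of_bound (huc.aestronglyMeasurable isOpen_Om.measurableSet) (M ^ p) ?_
    refine (ae_restrict_mem isOpen_Om.measurableSet).mono fun x hx => ?_
    rw [Real.norm_eq_abs, abs_of_nonneg (by positivity)]
    exact hub x hx
  have hi1 : IntegrableOn (fun x => |u x| ^ p * ⟪gradient (eta k R₁) x, e1 N⟫) (Om N R₀ R₁ s) := by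
    refine Integrable.of_bound ((huc.mul
      (hηc.continuousOn.inner continuousOn_const)).aestronglyMeasurable isOpen_Om.measurableSet)
      (M ^ p * L) ?_
    refine (ae_restrict_mem isOpen_Om.measurableSet).mono fun x hx => ?_
    rw [norm_mul, Real.norm_eq_abs, Real.norm_eq_abs, abs_of_nonneg (by positivity)]
    have hGe := abs_real_inner_le_norm (gradient (eta k R₁) x) (e1 N)
    rw [he, mul_one] at hGe
    exact mul_le_mul (hub x hx) (hGe.trans (hL x)) (abs_nonneg _) (by positivity)
  have hA : ∀ t : ℝ, ∫ x in Om N R₀ R₁ s, |u x| ^ p * (1 + t * ⟪gradient (eta k R₁) x, e1 N⟫) =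
      A0 + t * A1 := by
    intro t
    rw [hA0, hA1, ← integral_const_mul, ← integral_add hi0 (hi1.const_mul t)]
    congr 1; ext x; ring
  have hl : HasDerivAt (fun t : ℝ => lam1 p (Om N R₀ R₁ (s + t))) 0 0 := by
    have h1 : HasDerivAt (fun t : ℝ => s + t) 1 0 := by simpa using (hasDerivAt_id (0:ℝ)).const_add s
    have h2 : HasDerivAt (fun t : ℝ => lam1 p (Om N R₀ R₁ t)) 0 (s + 0) := by simpa using hd
    have h3 := HasDerivAt.comp (0:ℝ) h2 h1
    rw [zero_mul] at h3
    exact h3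
  have hAd : HasDerivAt (fun t : ℝ => A0 + t * A1) A1 0 := by
    simpa using ((hasDerivAt_id (0:ℝ)).mul_const A1).const_add A0
  have hφ := hB.sub (hl.mul hAd)
  have hmin : IsLocalMin ((fun t => ∫ x in Om N R₀ R₁ s,
      ‖XX t (gradient u x) (gradient (eta k R₁) x) (e1 N)‖ ^ p *
        (1 + t * ⟪gradient (eta k R₁) x, e1 N⟫)) -
      ((fun t : ℝ => lam1 p (Om N R₀ R₁ (s + t))) * (fun t : ℝ => A0 + t * A1))) 0 := by
    filter_upwards [ball_mem_nhds (0:ℝ) hδ0] with t ht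
    rw [mem_ball_zero_iff, Real.norm_eq_abs] at ht
    have h0 : ∫ x in Om N R₀ R₁ s,
      ‖XX 0 (gradient u x) (gradient (eta k R₁) x) (e1 N)‖ ^ p *
        (1 + 0 * ⟪gradient (eta k R₁) x, e1 N⟫) = lam1 p (Om N R₀ R₁ s) * A0 := by
      rw [hA0, ← h.energy]; simp [XX]
    simp only [Pi.sub_apply, Pi.mul_apply]
    rw [h0, add_zero, zero_mul, add_zero, sub_self]
    have htL : |t| * L ≤ 1 / 2 := (mul_le_mul_of_nonneg_right ht.le hL0.le).trans hδL
    obtain ⟨Φ, hΦ, hΦs, hΦd⟩ := shape_homeo hη he hL htL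
    have h1 := h.shape_u hη he hL htL (Ω' := Om N R₀ R₁ (s + t)) isOpen_Om hΦs hΦd (fun x hx =>
      Om_map h.hN h.hR₀ h.hs hR₁ hk hk2
        (ht.le.trans ((min_le_right _ _).trans (min_le_left _ _))) (by
          have : |t| ≤ 1 / k / (2 * R₁ + 1) := ht.le.trans ((min_le_right _ _).trans (min_le_right _ _))
          rwa [le_div_iff₀ (by positivity)] at this) hΦ hx)
    rw [hA] at h1
    linarith
  have := hmin.hasDerivAt_eq_zero hφ
  simp only [zero_mul, add_zero, zero_add] at this
  linarith

/-- The boundary integrand. -/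
noncomputable def QQ (p lam : ℝ) (u : EuclideanSpace ℝ (Fin N) → ℝ) (x : EuclideanSpace ℝ (Fin N)) : ℝ :=
  (‖gradient u x‖ ^ p - lam * |u x| ^ p) * ⟪e1 N, x⟫ -
    p * ⟪e1 N, gradient u x⟫ * ⟪pa p (gradient u x), x⟫

end PK

section PL
variable {N : ℕ}

theorem tangential {u : EuclideanSpace ℝ (Fin N) → ℝ} {x g : EuclideanSpace ℝ (Fin N)}
    (hx : x ≠ 0) (hg : HasGradientAt u g x) (hc : ∀ y, ‖y‖ = ‖x‖ → u y = u x) :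
    g = (⟪g, x⟫ / ‖x‖ ^ 2) • x := by
  have hx0 : 0 < ‖x‖ := norm_pos_iff.2 hx
  have key : ∀ v : EuclideanSpace ℝ (Fin N), ‖v‖ = ‖x‖ → ⟪x, v⟫ = 0 → ⟪g, v⟫ = 0 := by
    intro v hv hxv
    have h1 : HasDerivAt (fun t : ℝ => Real.cos t • x + Real.sin t • v) v 0 := by
      have := ((Real.hasDerivAt_cos 0).smul_const x).add ((Real.hasDerivAt_sin 0).smul_const v)
      exact this.congr_deriv (by simp)
    have h2 : HasFDerivAt u (innerSL ℝ g) (Real.cos 0 • x + Real.sin 0 • v) := by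
      have := hg.hasFDerivAt
      simp only [Real.cos_zero, Real.sin_zero, one_smul, zero_smul, add_zero]
      exact this
    have h3 := h2.comp_hasDerivAt 0 h1
    have h4 : (u ∘ fun t : ℝ => Real.cos t • x + Real.sin t • v) = fun _ => u x := by
      ext t
      refine hc _ ?_
      have h5 : ‖Real.cos t • x + Real.sin t • v‖ ^ 2 = ‖x‖ ^ 2 := by
        rw [norm_add_sq_real, inner_smul_left, inner_smul_right, hxv, norm_smul, norm_smul, hv,
          Real.norm_eq_abs, Real.norm_eq_abs, mul_pow, mul_pow, sq_abs, sq_abs]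
        have := Real.sin_sq_add_cos_sq t
        simp only [mul_zero, add_zero]
        linear_combination (‖x‖ ^ 2) * this
      exact (sq_eq_sq₀ (norm_nonneg _) (norm_nonneg _)).1 h5
    rw [h4] at h3
    have := h3.unique (hasDerivAt_const 0 (u x))
    simpa using this
  set w := g - (⟪g, x⟫ / ‖x‖ ^ 2) • x with hw
  have hwx : ⟪x, w⟫ = 0 := by
    rw [hw, inner_sub_right, inner_smul_right, real_inner_self_eq_norm_sq, real_inner_comm]
    field_simp; ring
  by_cases h0 : w = 0
  · exact sub_eq_zero.1 h0
  · exfalso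
    have hw0 : 0 < ‖w‖ := norm_pos_iff.2 h0
    have h1 := key ((‖x‖ / ‖w‖) • w) (by
      rw [norm_smul, Real.norm_eq_abs, abs_of_pos (by positivity)]; field_simp) (by
      rw [inner_smul_right, hwx, mul_zero])
    rw [inner_smul_right] at h1
    have h2 : ⟪g, w⟫ = 0 := by
      rcases mul_eq_zero.1 h1 with h | h
      · have : 0 < ‖x‖ / ‖w‖ := by positivity
        linarith
      · exact h
    have h3 : ⟪w, w⟫ = 0 := by
      nth_rw 1 [hw]
      rw [inner_sub_left, h2, inner_smul_left, hwx]; simp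
    rw [real_inner_self_eq_norm_sq] at h3
    exact (pow_pos hw0 2).ne' h3

theorem onesided {f : ℝ → ℝ} {f' b δ : ℝ} (hδ : 0 < δ) (hf : HasDerivAt f f' b)
    (h : ∀ r, b - δ < r → r < b → f r ≤ f b) : 0 ≤ f' := by
  have h1 := (hasDerivWithinAt_iff_tendsto_slope' (s := Iio b) (by simp)).1 hf.hasDerivWithinAt
  refine ge_of_tendsto h1 ?_
  filter_upwards [Ioo_mem_nhdsLT (by linarith : b - δ < b)] with r hr
  rw [slope_def_field]
  exact div_nonneg_of_nonpos (by linarith [h r hr.1 hr.2]) (by linarith [hr.2])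

theorem ray_deriv {u : EuclideanSpace ℝ (Fin N) → ℝ} {x g : EuclideanSpace ℝ (Fin N)}
    (hg : HasGradientAt u g x) : HasDerivAt (fun r : ℝ => u (r • x)) ⟪g, x⟫ 1 := by
  have h1 : HasDerivAt (fun r : ℝ => r • x) x 1 := by
    simpa using (hasDerivAt_id (1:ℝ)).smul_const x
  have h2 : HasFDerivAt u (innerSL ℝ g) ((1:ℝ) • x) := by
    rw [one_smul]; exact hg.hasFDerivAt
  exact h2.comp_hasDerivAt 1 h1

/-- gradient at points away from the hole -/
theorem EF.hga {R₀ R₁ s p lam : ℝ} {u : EuclideanSpace ℝ (Fin N) → ℝ} (h : EF N R₀ R₁ s p lam u)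
    {x : EuclideanSpace ℝ (Fin N)} (h1 : R₀ + s < ‖x‖) (h2 : ‖x‖ ≤ R₁) :
    HasGradientAt u (gradient u x) x := by
  obtain ⟨V, hVo, hV, hVc⟩ := h.hV
  exact hVc.hga hVo (hV x h2 (far_of_norm h.hN h.hs h1).le)

theorem EF.contAt {R₀ R₁ s p lam : ℝ} {u : EuclideanSpace ℝ (Fin N) → ℝ} (h : EF N R₀ R₁ s p lam u)
    {x : EuclideanSpace ℝ (Fin N)} (h1 : R₀ + s < ‖x‖) (h2 : ‖x‖ ≤ R₁) :
    ContinuousAt u x ∧ ContinuousAt (gradient u) x := by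
  obtain ⟨V, hVo, hV, hVc⟩ := h.hV
  have hx := hVo.mem_nhds (hV x h2 (far_of_norm h.hN h.hs h1).le)
  exact ⟨hVc.continuousOn.continuousAt hx, (hVc.cont_grad hVo).continuousAt hx⟩

theorem EF.outer {R₀ R₁ s p lam : ℝ} {u : EuclideanSpace ℝ (Fin N) → ℝ} (h : EF N R₀ R₁ s p lam u)
    {x : EuclideanSpace ℝ (Fin N)} (hx : ‖x‖ = R₁) :
    gradient u x = (-(‖gradient u x‖ / R₁)) • x ∧ ⟪gradient u x, x⟫ = - ‖gradient u x‖ * R₁ := by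
  have hR₁ : 0 < R₁ := h.hR₀.trans h.hR
  have hs' := h.hs'
  have hg := h.hga (x := x) (by rw [hx]; linarith) hx.le
  have hx0 : x ≠ 0 := by rw [← norm_pos_iff, hx]; exact hR₁
  have h1 := tangential hx0 hg (fun y hy => by rw [h.zo y (by rw [hy, hx]), h.zo x hx])
  have h2 : ⟪gradient u x, x⟫ ≤ 0 := by
    have h3 := (ray_deriv hg).neg
    have := onesided (δ := 1 - (R₀ + s) / R₁) (by rw [sub_pos, div_lt_one hR₁]; linarith) h3 (by
      intro r hr1 hr2
      have hr1 : (R₀ + s) / R₁ < r := by linarith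
      rw [div_lt_iff₀ hR₁] at hr1
      have hr0 : 0 < r := by
        by_contra hc
        have := h.hR₀; have := h.hs
        nlinarith
      have hn : ‖r • x‖ = r * R₁ := by rw [norm_smul, hx, Real.norm_eq_abs, abs_of_pos hr0]
      have h4 := h.nonneg (x := r • x) (by rw [hn]; nlinarith)
        (far_of_norm h.hN h.hs (by rw [hn]; exact hr1)).le
      simp only [Pi.neg_apply, one_smul, h.zo x hx]
      linarith)
    linarith
  have h3 : ⟪gradient u x, x⟫ = - ‖gradient u x‖ * R₁ := by
    have h4 : ‖gradient u x‖ = |⟪gradient u x, x⟫ / ‖x‖ ^ 2| * ‖x‖ := by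
      conv_lhs => rw [h1]
      rw [norm_smul, Real.norm_eq_abs]
    rw [hx, abs_div, abs_of_nonpos h2, abs_of_pos (by positivity)] at h4
    rw [h4]; field_simp
  refine ⟨?_, h3⟩
  conv_lhs => rw [h1]
  rw [h3, hx]; congr 1; field_simp

theorem EF.outer_mono {R₀ R₁ s p lam : ℝ} {u : EuclideanSpace ℝ (Fin N) → ℝ} (h : EF N R₀ R₁ s p lam u)
    {x y : EuclideanSpace ℝ (Fin N)} (hx : ‖x‖ = R₁) (hy : ‖y‖ = R₁) (hxy : ⟪e1 N, y⟫ ≤ ⟪e1 N, x⟫)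
    (hne : ⟪e1 N, y⟫ ≠ ⟪e1 N, x⟫) :
    ‖gradient u x‖ ≤ ‖gradient u y‖ := by
  have hR₁ : 0 < R₁ := h.hR₀.trans h.hR
  have hs' := h.hs'
  have hlt := lt_of_le_of_ne hxy hne
  have hgx := h.hga (x := x) (by rw [hx]; linarith) hx.le
  have hgy := h.hga (x := y) (by rw [hy]; linarith) hy.le
  have h3 := (ray_deriv hgx).sub (ray_deriv hgy)
  have := onesided (δ := 1 - (R₀ + s) / R₁) (by rw [sub_pos, div_lt_one hR₁]; linarith) h3 (by
      intro r hr1 hr2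
      have hr1 : (R₀ + s) / R₁ < r := by linarith
      rw [div_lt_iff₀ hR₁] at hr1
      have hr0 : 0 < r := by
        by_contra hc
        have := h.hR₀; have := h.hs
        nlinarith
      have hn : ‖r • x‖ = r * R₁ := by rw [norm_smul, hx, Real.norm_eq_abs, abs_of_pos hr0]
      have hn2 : ‖r • y‖ = r * R₁ := by rw [norm_smul, hy, Real.norm_eq_abs, abs_of_pos hr0]
      have h4 := h.mono (x := r • x) (y := r • y) ((mem_Om h.hR₀).2 ⟨by rw [hn]; nlinarith,
        (far_of_norm h.hN h.hs (by rw [hn]; exact hr1))⟩) (by rw [hn, hn2]) (by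
          rw [inner_smul_right, inner_smul_right]; exact mul_lt_mul_of_pos_left hlt hr0)
      simp only [Pi.sub_apply, one_smul, h.zo x hx, h.zo y hy]
      linarith)
  rw [(h.outer hx).2, (h.outer hy).2] at this
  nlinarith

theorem EF.QQ_outer {R₀ R₁ s p lam : ℝ} {u : EuclideanSpace ℝ (Fin N) → ℝ} (h : EF N R₀ R₁ s p lam u)
    {x : EuclideanSpace ℝ (Fin N)} (hx : ‖x‖ = R₁) :
    QQ p lam u x = (1 - p) * ‖gradient u x‖ ^ p * ⟪e1 N, x⟫ := by
  have hp := h.hp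
  obtain ⟨h1, h2⟩ := h.outer hx
  have h3 : ⟪e1 N, gradient u x⟫ * ⟪pa p (gradient u x), x⟫ = ⟪e1 N, x⟫ * ‖gradient u x‖ ^ p := by
    rw [← inner_pa_self hp]
    set g := gradient u x with hg
    set c := -(‖g‖ / R₁) with hc
    have e1' : ⟪e1 N, g⟫ = c * ⟪e1 N, x⟫ := by rw [h1, inner_smul_right]
    have e2' : ⟪pa p g, g⟫ = c * ⟪pa p g, x⟫ := by
      nth_rw 2 [h1]; rw [inner_smul_right]
    rw [e1', e2']; ring
  unfold QQ
  rw [h.zo x hx, abs_zero, Real.zero_rpow (by linarith), mul_assoc p, h3]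
  ring

theorem EF.qq_outer_nonneg {R₀ R₁ s p lam : ℝ} {u : EuclideanSpace ℝ (Fin N) → ℝ} (h : EF N R₀ R₁ s p lam u)
    {x : EuclideanSpace ℝ (Fin N)} (hx : ‖x‖ = R₁) :
    0 ≤ QQ p lam u x + QQ p lam u (-x) := by
  have hp := h.hp
  have hx' : ‖-x‖ = R₁ := by rw [norm_neg, hx]
  rw [h.QQ_outer hx, h.QQ_outer hx', inner_neg_right]
  rcases lt_trichotomy (⟪e1 N, x⟫) 0 with h0 | h0 | h0
  · have := h.outer_mono (x := -x) (y := x) hx' hx (by rw [inner_neg_right]; linarith)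
      (by rw [inner_neg_right]; linarith)
    have := Real.rpow_le_rpow (norm_nonneg _) this (by linarith : 0 ≤ p)
    have h2 : 0 ≤ (p - 1) * (-⟪e1 N, x⟫) * (‖gradient u x‖ ^ p - ‖gradient u (-x)‖ ^ p) :=
      mul_nonneg (mul_nonneg (by linarith) (by linarith)) (by linarith)
    linarith
  · rw [h0]; simp
  · have := h.outer_mono (x := x) (y := -x) hx hx' (by rw [inner_neg_right]; linarith)
      (by rw [inner_neg_right]; linarith)
    have := Real.rpow_le_rpow (norm_nonneg _) this (by linarith : 0 ≤ p)
    have h2 : 0 ≤ (p - 1) * (⟪e1 N, x⟫) * (‖gradient u (-x)‖ ^ p - ‖gradient u x‖ ^ p) :=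
      mul_nonneg (mul_nonneg (by linarith) (by linarith)) (by linarith)
    linarith

/-- if the symmetrised boundary integrand vanishes at the pole, the normal derivative is constant -/
theorem EF.const_of_qq {R₀ R₁ s p lam : ℝ} {u : EuclideanSpace ℝ (Fin N) → ℝ} (h : EF N R₀ R₁ s p lam u)
    (h0 : QQ p lam u (R₁ • e1 N) + QQ p lam u (-(R₁ • e1 N)) = 0) :
    ∃ c : ℝ, 0 ≤ c ∧ ∀ x, ‖x‖ = R₁ → ‖gradient u x‖ = c := by
  have hR₁ : 0 < R₁ := h.hR₀.trans h.hR
  have hp := h.hp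
  have he := norm_e1 h.hN
  have hn : ‖R₁ • e1 N‖ = R₁ := by rw [norm_smul, he, mul_one, Real.norm_eq_abs, abs_of_pos hR₁]
  have hn' : ‖-(R₁ • e1 N)‖ = R₁ := by rw [norm_neg, hn]
  have hi : ⟪e1 N, R₁ • e1 N⟫ = R₁ := by
    rw [inner_smul_right, real_inner_self_eq_norm_sq, he]; ring
  rw [h.QQ_outer hn, h.QQ_outer hn', inner_neg_right, hi] at h0
  have h1 : ‖gradient u (R₁ • e1 N)‖ ^ p = ‖gradient u (-(R₁ • e1 N))‖ ^ p := by
    have : (1 - p) * R₁ * (‖gradient u (R₁ • e1 N)‖ ^ p - ‖gradient u (-(R₁ • e1 N))‖ ^ p) = 0 := by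
      linarith
    rcases mul_eq_zero.1 this with h2 | h2
    · rcases mul_eq_zero.1 h2 with h3 | h3 <;> linarith
    · linarith
  have h2 : ‖gradient u (R₁ • e1 N)‖ = ‖gradient u (-(R₁ • e1 N))‖ :=
    (Real.rpow_left_inj (norm_nonneg _) (norm_nonneg _) (by linarith)).1 h1
  refine ⟨‖gradient u (R₁ • e1 N)‖, norm_nonneg _, fun x hx => ?_⟩
  have hcs := abs_le.1 (abs_real_inner_le_norm (e1 N) x)
  rw [he, hx, one_mul] at hcs
  have a1 : ‖gradient u (R₁ • e1 N)‖ ≤ ‖gradient u x‖ := by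
    by_cases hq : ⟪e1 N, x⟫ = R₁
    · have : x = R₁ • e1 N := by
        rw [← sub_eq_zero, ← norm_eq_zero, ← sq_eq_zero_iff, norm_sub_sq_real, hx, hn,
          inner_smul_right, real_inner_comm, hq]; ring
      rw [this]
    · exact h.outer_mono hn hx (by rw [hi]; exact hcs.2) (by rw [hi]; exact hq)
  have a2 : ‖gradient u x‖ ≤ ‖gradient u (-(R₁ • e1 N))‖ := by
    by_cases hq : ⟪e1 N, x⟫ = -R₁
    · have : x = -(R₁ • e1 N) := by
        rw [← sub_eq_zero, ← norm_eq_zero, ← sq_eq_zero_iff, norm_sub_sq_real, hx, hn',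
          inner_neg_right, inner_smul_right, real_inner_comm, hq]; ring
      rw [this]
    · refine h.outer_mono hx hn' ?_ ?_ <;> rw [inner_neg_right, hi]
      · exact hcs.1
      · exact fun h' => hq h'.symm
  exact le_antisymm (a2.trans h2.ge) a1

end PL

section PM
variable {N : ℕ}

/-- radial weight concentrating at the outer sphere -/
noncomputable def rho (k R₁ : ℝ) (x : EuclideanSpace ℝ (Fin N)) : ℝ :=
  2 * k * deriv Real.smoothTransition (k * (R₁ ^ 2 - ‖x‖ ^ 2) - 1)

theorem rho_cont (k R₁ : ℝ) : Continuous (rho k R₁ : EuclideanSpace ℝ (Fin N) → ℝ) := by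
  unfold rho
  exact continuous_const.mul (smooth_deriv_cont.comp (by fun_prop))

theorem rho_nonneg {k : ℝ} (hk : 0 < k) (R₁ : ℝ) (x : EuclideanSpace ℝ (Fin N)) : 0 ≤ rho k R₁ x :=
  mul_nonneg (by linarith) (smooth_deriv_nonneg _)

theorem rho_supp {k R₁ : ℝ} (hk : 0 < k) {x : EuclideanSpace ℝ (Fin N)} (h : rho k R₁ x ≠ 0) :
    R₁ ^ 2 - 2 / k ≤ ‖x‖ ^ 2 ∧ ‖x‖ ^ 2 ≤ R₁ ^ 2 - 1 / k := by
  have h1 : deriv Real.smoothTransition (k * (R₁ ^ 2 - ‖x‖ ^ 2) - 1) ≠ 0 := by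
    intro h0; apply h; unfold rho; rw [h0, mul_zero]
  have h2 : 0 ≤ k * (R₁ ^ 2 - ‖x‖ ^ 2) - 1 := by
    by_contra hc; exact h1 (smooth_deriv_zero (Or.inl (not_le.1 hc)))
  have h3 : k * (R₁ ^ 2 - ‖x‖ ^ 2) - 1 ≤ 1 := by
    by_contra hc; exact h1 (smooth_deriv_zero (Or.inr (not_le.1 hc)))
  constructor
  · have : R₁ ^ 2 - ‖x‖ ^ 2 ≤ 2 / k := by rw [le_div_iff₀ hk]; linarith
    linarith
  · have : 1 / k ≤ R₁ ^ 2 - ‖x‖ ^ 2 := by rw [div_le_iff₀ hk]; linarith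
    linarith

theorem rho_iso (k R₁ : ℝ) (σ : EuclideanSpace ℝ (Fin N) ≃ₗᵢ[ℝ] EuclideanSpace ℝ (Fin N))
    (x : EuclideanSpace ℝ (Fin N)) : rho k R₁ (σ x) = rho k R₁ x := by
  unfold rho; rw [σ.norm_map]

theorem rho_cs {k R₁ : ℝ} (hk : 0 < k) :
    HasCompactSupport (rho k R₁ : EuclideanSpace ℝ (Fin N) → ℝ) := by
  refine HasCompactSupport.intro (isCompact_closedBall (0 : EuclideanSpace ℝ (Fin N)) |R₁|) ?_
  intro x hx
  by_contra h0
  apply hx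
  rw [mem_closedBall_zero_iff]
  have h1 := (rho_supp hk h0).2
  have : 0 < 1 / k := by positivity
  refine abs_le_of_sq_le_sq' ?_ (abs_nonneg _) |>.2
  rw [sq_abs]; linarith

theorem rho_int_pos {k R₁ : ℝ} (hN : 2 ≤ N) (hk : 0 < k) (hk2 : 0 ≤ R₁ ^ 2 - 2 / k) :
    0 < ∫ x : EuclideanSpace ℝ (Fin N), rho k R₁ x := by
  obtain ⟨τ, hτ, hτ2⟩ := exists_deriv_eq_slope Real.smoothTransition (zero_lt_one)
    Real.smoothTransition.continuous.continuousOn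
    (fun t _ => (smooth_deriv t).differentiableAt.differentiableWithinAt)
  rw [Real.smoothTransition.one, Real.smoothTransition.zero] at hτ2
  have hr : 0 ≤ R₁ ^ 2 - (τ + 1) / k := by
    have : (τ + 1) / k ≤ 2 / k := by gcongr; linarith [hτ.2]
    linarith
  have hx : rho k R₁ (Real.sqrt (R₁ ^ 2 - (τ + 1) / k) • e1 N) ≠ 0 := by
    unfold rho
    rw [norm_smul, norm_e1 hN, mul_one, Real.norm_eq_abs, sq_abs, Real.sq_sqrt hr]
    have : k * (R₁ ^ 2 - (R₁ ^ 2 - (τ + 1) / k)) - 1 = τ := by field_simp; ring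
    rw [this, hτ2]
    have : 0 < 2 * k := by positivity
    norm_num; exact hk.ne'
  refine (rho_cont k R₁).integral_pos_of_hasCompactSupport_nonneg_nonzero (rho_cs hk)
    (fun x => rho_nonneg hk R₁ x) hx

/-- cone around a direction -/
def cone (ω : EuclideanSpace ℝ (Fin N)) (δ : ℝ) : Set (EuclideanSpace ℝ (Fin N)) :=
  {x | ‖x - ‖x‖ • ω‖ < δ * ‖x‖}

theorem cone_meas (ω : EuclideanSpace ℝ (Fin N)) (δ : ℝ) : MeasurableSet (cone ω δ) := by
  have : IsOpen {x : EuclideanSpace ℝ (Fin N) | ‖x - ‖x‖ • ω‖ < δ * ‖x‖} :=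
    isOpen_lt (by fun_prop) (by fun_prop)
  exact this.measurableSet

theorem cone_int (k R₁ δ : ℝ) {ω ω' : EuclideanSpace ℝ (Fin N)} (h : ‖ω'‖ = ‖ω‖) :
    ∫ x, (cone ω' δ).indicator (rho k R₁) x = ∫ x, (cone ω δ).indicator (rho k R₁) x := by
  set σ := (Submodule.span ℝ {ω' - ω})ᗮ.reflection with hσ
  have h1 : σ ω' = ω := Submodule.reflection_sub h
  have h2 : ∫ x, (cone ω δ).indicator (rho k R₁) (σ x) = ∫ x, (cone ω δ).indicator (rho k R₁) x :=
    σ.measurePreserving.integral_comp σ.toHomeomorph.measurableEmbedding _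
  rw [← h2]
  congr 1; ext x
  have h3 : σ x ∈ cone ω δ ↔ x ∈ cone ω' δ := by
    unfold cone
    rw [Set.mem_ofPred_eq, Set.mem_ofPred_eq, σ.norm_map]
    have : σ x - ‖x‖ • ω = σ (x - ‖x‖ • ω') := by rw [map_sub, map_smul, h1]
    rw [this, σ.norm_map]
  by_cases hx : x ∈ cone ω' δ
  · rw [indicator_of_mem hx, indicator_of_mem (h3.2 hx), rho_iso]
  · rw [indicator_of_notMem hx, indicator_of_notMem (fun h => hx (h3.1 h))]

set_option maxHeartbeats 1000000 in
theorem conc {R₁ r0 : ℝ} (hN : 2 ≤ N) (hr0 : 0 ≤ r0) (hr : r0 < R₁) {q : EuclideanSpace ℝ (Fin N) → ℝ}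
    (hq : ∀ x, r0 < ‖x‖ → ‖x‖ ≤ R₁ → ContinuousAt q x) (hnn : ∀ x, ‖x‖ = R₁ → 0 ≤ q x)
    (hInt0 : ∀ k : ℝ, 0 < k → r0 ^ 2 < R₁ ^ 2 - 2 / k → ∫ x, rho k R₁ x * q x = 0)
    {ω : EuclideanSpace ℝ (Fin N)} (hω : ‖ω‖ = 1) : q (R₁ • ω) = 0 := by
  have hR₁ : 0 < R₁ := hr0.trans_lt hr
  have hnω : ‖R₁ • ω‖ = R₁ := by rw [norm_smul, hω, mul_one, Real.norm_eq_abs, abs_of_pos hR₁]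
  by_contra hne
  obtain ⟨c, hc⟩ : ∃ c, c = q (R₁ • ω) / 2 := ⟨_, rfl⟩
  have hc0 : 0 < c := by
    have := lt_of_le_of_ne (hnn _ hnω) (Ne.symm hne); linarith
  -- neighbourhood of the pole
  obtain ⟨d, hd, hd1⟩ : ∃ d > 0, ∀ x, ‖x - R₁ • ω‖ < d → c < q x := by
    have h1 := (hq (R₁ • ω) (by rw [hnω]; exact hr) hnω.le).eventually_const_lt
      (by linarith : c < q (R₁ • ω))
    obtain ⟨d, hd, h2⟩ := Metric.eventually_nhds_iff.1 h1
    exact ⟨d, hd, fun x hx => h2 (by rwa [dist_eq_norm])⟩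
  set δ := d / (2 * R₁) with hδ
  have hδ0 : 0 < δ := by positivity
  have hcone : ∀ x, x ∈ cone ω δ → R₁ - d / 2 < ‖x‖ → ‖x‖ ≤ R₁ → c < q x := by
    intro x hx h1 h2
    have hx : ‖x - ‖x‖ • ω‖ < δ * ‖x‖ := hx
    apply hd1
    have e1 : x - R₁ • ω = (x - ‖x‖ • ω) + (‖x‖ - R₁) • ω := by rw [sub_smul]; abel
    rw [e1]
    have e2 : ‖(‖x‖ - R₁) • ω‖ ≤ d / 2 := by
      rw [norm_smul, hω, mul_one, Real.norm_eq_abs, abs_of_nonpos (by linarith)]; linarith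
    have e3 : δ * ‖x‖ ≤ d / 2 := by
      calc δ * ‖x‖ ≤ δ * R₁ := mul_le_mul_of_nonneg_left h2 hδ0.le
        _ = d / 2 := by rw [hδ]; field_simp
    linarith [norm_add_le (x - ‖x‖ • ω) ((‖x‖ - R₁) • ω)]
  -- finite cover
  obtain ⟨T, hT1, hT2⟩ := (isCompact_sphere (0 : EuclideanSpace ℝ (Fin N)) 1).elim_nhds_subcover
    (fun ω' => ball ω' δ) (fun ω' _ => ball_mem_nhds _ hδ0)
  have hcov : ∀ x : EuclideanSpace ℝ (Fin N), x ≠ 0 → ∃ ω' ∈ T, x ∈ cone ω' δ := by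
    intro x hx
    have hx0 : 0 < ‖x‖ := norm_pos_iff.2 hx
    have h1 : ‖x‖⁻¹ • x ∈ sphere (0 : EuclideanSpace ℝ (Fin N)) 1 := by
      rw [mem_sphere_zero_iff_norm, norm_smul, norm_inv, norm_norm, inv_mul_cancel₀ hx0.ne']
    have h2 := hT2 h1
    simp only [mem_iUnion] at h2
    obtain ⟨ω', hω', h3⟩ := h2
    refine ⟨ω', hω', ?_⟩
    rw [mem_ball, dist_eq_norm] at h3
    show ‖x - ‖x‖ • ω'‖ < δ * ‖x‖
    have h4 : x - ‖x‖ • ω' = ‖x‖ • (‖x‖⁻¹ • x - ω') := by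
      rw [smul_sub, smul_smul, mul_inv_cancel₀ hx0.ne', one_smul]
    rw [h4, norm_smul, norm_norm, mul_comm]
    exact mul_lt_mul_of_pos_right h3 hx0
  set n : ℝ := (T.card : ℝ) with hn
  have hn0 : 0 ≤ n := by positivity
  set ε := c / (2 * (n + 1)) with hε
  have hε0 : 0 < ε := by positivity
  -- lower bound near the sphere
  obtain ⟨κ, hκ, hκ1⟩ : ∃ κ > 0, ∀ x, R₁ - κ < ‖x‖ → ‖x‖ ≤ R₁ → -ε < q x := by
    have hsub : sphere (0 : EuclideanSpace ℝ (Fin N)) R₁ ⊆ interior {x | -ε < q x} := by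
      intro x hx
      rw [mem_sphere_zero_iff_norm] at hx
      rw [mem_interior_iff_mem_nhds]
      exact (hq x (by rw [hx]; exact hr) hx.le).eventually_const_lt (by linarith [hnn x hx])
    obtain ⟨κ, hκ, h1⟩ := (isCompact_sphere (0 : EuclideanSpace ℝ (Fin N)) R₁).exists_thickening_subset_open
      isOpen_interior hsub
    refine ⟨min κ R₁, lt_min hκ hR₁, fun x hx1 hx2 => ?_⟩
    have hx0 : 0 < ‖x‖ := by
      have := min_le_right κ R₁; linarith
    have h2 : x ∈ thickening κ (sphere (0 : EuclideanSpace ℝ (Fin N)) R₁) := by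
      rw [mem_thickening_iff]
      refine ⟨(R₁ / ‖x‖) • x, ?_, ?_⟩
      · rw [mem_sphere_zero_iff_norm, norm_smul, Real.norm_eq_abs, abs_of_pos (by positivity)]
        field_simp
      · rw [dist_eq_norm]
        have : x - (R₁ / ‖x‖) • x = (1 - R₁ / ‖x‖) • x := by rw [sub_smul, one_smul]
        rw [this, norm_smul, Real.norm_eq_abs, abs_of_nonpos (by
          rw [sub_nonpos, le_div_iff₀ hx0]; linarith)]
        have : -(1 - R₁ / ‖x‖) * ‖x‖ = R₁ - ‖x‖ := by field_simp; ring
        rw [this]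
        have := min_le_left κ R₁; linarith
    have h3 : x ∈ {x | -ε < q x} := interior_subset (h1 h2)
    exact h3
  -- choice of k
  obtain ⟨ρ, hρ⟩ : ∃ ρ, ρ = max r0 (max (R₁ - d / 2) (R₁ - κ)) := ⟨_, rfl⟩
  have hρ0 : 0 ≤ ρ := by rw [hρ]; exact hr0.trans (le_max_left _ _)
  have hρ1 : ρ < R₁ := by rw [hρ]; exact max_lt hr (max_lt (by linarith) (by linarith))
  have hρ2 : r0 ≤ ρ ∧ R₁ - d / 2 ≤ ρ ∧ R₁ - κ ≤ ρ := by
    rw [hρ]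
    exact ⟨le_max_left _ _, (le_max_left _ _).trans (le_max_right _ _),
      (le_max_right _ _).trans (le_max_right _ _)⟩
  have hgap : 0 < R₁ ^ 2 - ρ ^ 2 := by nlinarith
  obtain ⟨k, hk⟩ : ∃ k, k = 4 / (R₁ ^ 2 - ρ ^ 2) := ⟨_, rfl⟩
  have hk0 : 0 < k := by rw [hk]; positivity
  have hk2 : ρ ^ 2 < R₁ ^ 2 - 2 / k := by
    rw [hk]
    have : 2 / (4 / (R₁ ^ 2 - ρ ^ 2)) = (R₁ ^ 2 - ρ ^ 2) / 2 := by field_simp; norm_num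
    rw [this]; linarith
  have hsupp : ∀ x : EuclideanSpace ℝ (Fin N), rho k R₁ x ≠ 0 → ρ < ‖x‖ ∧ ‖x‖ ≤ R₁ := by
    intro x hx
    obtain ⟨h1, h2⟩ := rho_supp hk0 hx
    refine ⟨lt_of_pow_lt_pow_left₀ 2 (norm_nonneg _) (by linarith), ?_⟩
    have : 0 < 1 / k := by positivity
    exact le_of_lt (lt_of_pow_lt_pow_left₀ 2 hR₁.le (by linarith))
  have hI := rho_int_pos (R₁ := R₁) hN hk0 (by nlinarith)
  have hri : Integrable (rho k R₁ : EuclideanSpace ℝ (Fin N) → ℝ) :=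
    (rho_cont k R₁).integrable_of_hasCompactSupport (rho_cs hk0)
  have hci : ∀ ω' : EuclideanSpace ℝ (Fin N), Integrable ((cone ω' δ).indicator (rho k R₁)) :=
    fun ω' => hri.indicator (cone_meas ω' δ)
  set J := ∫ x, (cone ω δ).indicator (rho k R₁) x with hJ
  have hIJ : ∫ x : EuclideanSpace ℝ (Fin N), rho k R₁ x ≤ n * J := by
    have h1 : ∫ x : EuclideanSpace ℝ (Fin N), rho k R₁ x ≤ ∫ x, ∑ ω' ∈ T, (cone ω' δ).indicator (rho k R₁) x := by
      refine integral_mono hri (integrable_finsetSum _ fun ω' _ => hci ω') fun x => ?_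
      simp only
      by_cases hx : rho k R₁ x = 0
      · rw [hx]
        exact Finset.sum_nonneg fun ω' _ => indicator_nonneg (fun y _ => rho_nonneg hk0 R₁ y) x
      · have hx0 : x ≠ 0 := by
          rw [← norm_pos_iff]; exact hρ0.trans_lt (hsupp x hx).1
        obtain ⟨ω', hω', h2⟩ := hcov x hx0
        refine le_trans (le_of_eq (indicator_of_mem h2 _).symm)
          (Finset.single_le_sum (f := fun ω' => (cone ω' δ).indicator (rho k R₁) x)
            (fun ω' _ => indicator_nonneg (fun y _ => rho_nonneg hk0 R₁ y) x) hω')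
    rw [integral_finsetSum _ fun ω' _ => hci ω'] at h1
    refine h1.trans (le_of_eq ?_)
    rw [Finset.sum_congr rfl fun ω' hω' => cone_int k R₁ δ (ω := ω) (ω' := ω') (by
      rw [hω]; exact mem_sphere_zero_iff_norm.1 (hT1 ω' hω'))]
    rw [Finset.sum_const, nsmul_eq_mul]
  have hqi : Integrable (fun x => rho k R₁ x * q x) := by
    have hKc : IsCompact (closedBall (0 : EuclideanSpace ℝ (Fin N)) R₁ ∩ {x | R₁ ^ 2 - 2 / k ≤ ‖x‖ ^ 2}) := by
      refine (isCompact_closedBall _ _).inter_right ?_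
      have : IsClosed {x : EuclideanSpace ℝ (Fin N) | R₁ ^ 2 - 2 / k ≤ ‖x‖ ^ 2} :=
        isClosed_le continuous_const (by fun_prop)
      exact this
    have h1 : IntegrableOn (fun x => rho k R₁ x * q x)
        (closedBall (0 : EuclideanSpace ℝ (Fin N)) R₁ ∩ {x | R₁ ^ 2 - 2 / k ≤ ‖x‖ ^ 2}) := by
      refine ContinuousOn.integrableOn_compact hKc ?_
      refine (rho_cont k R₁).continuousOn.mul fun x hx => ?_
      have hx2 : R₁ ^ 2 - 2 / k ≤ ‖x‖ ^ 2 := hx.2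
      refine (hq x ?_ (mem_closedBall_zero_iff.1 hx.1)).continuousWithinAt
      exact hρ2.1.trans_lt (lt_of_pow_lt_pow_left₀ 2 (norm_nonneg _) (by linarith))
    refine h1.integrable_of_forall_notMem_eq_zero fun x hx => ?_
    by_contra h0
    have h2 : rho k R₁ x ≠ 0 := fun h => h0 (by rw [h, zero_mul])
    exact hx ⟨mem_closedBall_zero_iff.2 (hsupp x h2).2, (rho_supp hk0 h2).1⟩
  have hlow : c * J - ε * ∫ x : EuclideanSpace ℝ (Fin N), rho k R₁ x ≤ ∫ x : EuclideanSpace ℝ (Fin N), rho k R₁ x * q x := by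
    rw [hJ, ← integral_const_mul, ← integral_const_mul, ← integral_sub ((hci ω).const_mul c)
      (hri.const_mul ε)]
    refine integral_mono (((hci ω).const_mul c).sub (hri.const_mul ε)) hqi fun x => ?_
    simp only
    by_cases hx : rho k R₁ x = 0
    · have : (cone ω δ).indicator (rho k R₁) x = 0 := by
        by_cases h : x ∈ cone ω δ
        · rw [indicator_of_mem h, hx]
        · rw [indicator_of_notMem h]
      rw [this, hx]; simp
    · have h1 := hsupp x hx
      have h2 := rho_nonneg hk0 R₁ x
      by_cases h : x ∈ cone ω δ
      · rw [indicator_of_mem h]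
        have := hcone x h (by linarith [hρ2.2.1]) h1.2
        nlinarith
      · rw [indicator_of_notMem h]
        have := hκ1 x (by linarith [hρ2.2.2]) h1.2
        nlinarith
  rw [hInt0 k hk0 (by nlinarith [hρ2.1])] at hlow
  have hJ0 : 0 < J := by
    by_contra hc'
    nlinarith
  have h5 : ε * (n * J) ≤ c / 2 * J := by
    have : ε * n ≤ c / 2 := by
      rw [hε, div_mul_eq_mul_div, div_le_iff₀ (by positivity)]
      nlinarith
    nlinarith
  have h6 : ε * ∫ x : EuclideanSpace ℝ (Fin N), rho k R₁ x ≤ ε * (n * J) := mul_le_mul_of_nonneg_left hIJ hε0.le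
  nlinarith

end PM

section PN
variable {N : ℕ}

theorem rho_layer {k R₁ r0 : ℝ} (hk : 0 < k) (hR₁ : 0 < R₁) (hk2 : r0 ^ 2 < R₁ ^ 2 - 2 / k)
    {x : EuclideanSpace ℝ (Fin N)} (hx : rho k R₁ x ≠ 0) : r0 < ‖x‖ ∧ ‖x‖ < R₁ := by
  obtain ⟨h1, h2⟩ := rho_supp hk hx
  refine ⟨lt_of_pow_lt_pow_left₀ 2 (norm_nonneg _) (by linarith), ?_⟩
  have : 0 < 1 / k := by positivity
  exact lt_of_pow_lt_pow_left₀ 2 hR₁.le (by linarith)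

theorem rho_mul_integrable {k R₁ r0 : ℝ} (hk : 0 < k) (hR₁ : 0 < R₁) (hk2 : r0 ^ 2 < R₁ ^ 2 - 2 / k)
    {q : EuclideanSpace ℝ (Fin N) → ℝ}
    (hq : ∀ x, r0 < ‖x‖ → ‖x‖ ≤ R₁ → ContinuousAt q x) :
    Integrable (fun x => rho k R₁ x * q x) := by
  have hKc : IsCompact (closedBall (0 : EuclideanSpace ℝ (Fin N)) R₁ ∩ {x | R₁ ^ 2 - 2 / k ≤ ‖x‖ ^ 2}) := by
    refine (isCompact_closedBall _ _).inter_right ?_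
    have : IsClosed {x : EuclideanSpace ℝ (Fin N) | R₁ ^ 2 - 2 / k ≤ ‖x‖ ^ 2} :=
      isClosed_le continuous_const (by fun_prop)
    exact this
  have h1 : IntegrableOn (fun x => rho k R₁ x * q x)
      (closedBall (0 : EuclideanSpace ℝ (Fin N)) R₁ ∩ {x | R₁ ^ 2 - 2 / k ≤ ‖x‖ ^ 2}) := by
    refine ContinuousOn.integrableOn_compact hKc ?_
    refine (rho_cont k R₁).continuousOn.mul fun x hx => ?_
    have hx2 : R₁ ^ 2 - 2 / k ≤ ‖x‖ ^ 2 := hx.2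
    refine (hq x ?_ (mem_closedBall_zero_iff.1 hx.1)).continuousWithinAt
    exact (lt_of_pow_lt_pow_left₀ 2 (norm_nonneg _) (by linarith))
  refine h1.integrable_of_forall_notMem_eq_zero fun x hx => ?_
  by_contra h0
  have h2 : rho k R₁ x ≠ 0 := fun h => h0 (by rw [h, zero_mul])
  exact hx ⟨mem_closedBall_zero_iff.2 (rho_layer hk hR₁ hk2 h2).2.le, (rho_supp hk h2).1⟩

theorem EF.contF {R₀ R₁ s p lam : ℝ} {u : EuclideanSpace ℝ (Fin N) → ℝ} (h : EF N R₀ R₁ s p lam u)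
    {x : EuclideanSpace ℝ (Fin N)} (h1 : R₀ + s < ‖x‖) (h2 : ‖x‖ ≤ R₁) :
    ContinuousAt (fun x => ‖gradient u x‖ ^ p * ⟪e1 N, x⟫ -
      p * ⟪e1 N, gradient u x⟫ * ⟪pa p (gradient u x), x⟫) x ∧
    ContinuousAt (fun x => |u x| ^ p * ⟪e1 N, x⟫) x := by
  obtain ⟨c1, c2⟩ := h.contAt h1 h2
  have hp := h.hp
  have c3 : ContinuousAt (fun x => pa p (gradient u x)) x :=
    (continuous_pa hp).continuousAt.comp c2
  have c4 : ContinuousAt (fun x : EuclideanSpace ℝ (Fin N) => ⟪e1 N, x⟫) x := by fun_prop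
  have c5 : ContinuousAt (fun x => ⟪e1 N, gradient u x⟫) x := continuousAt_const.inner c2
  have c6 : ContinuousAt (fun x => ⟪pa p (gradient u x), x⟫) x := c3.inner continuousAt_id
  refine ⟨?_, ?_⟩
  · exact ((c2.norm.rpow_const (Or.inr (by linarith))).mul c4).sub ((continuousAt_const.mul c5).mul c6)
  · exact (c1.abs.rpow_const (Or.inr (by linarith))).mul c4

theorem EF.contQQ {R₀ R₁ s p lam : ℝ} {u : EuclideanSpace ℝ (Fin N) → ℝ} (h : EF N R₀ R₁ s p lam u)
    {x : EuclideanSpace ℝ (Fin N)} (h1 : R₀ + s < ‖x‖) (h2 : ‖x‖ ≤ R₁) :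
    ContinuousAt (QQ p lam u) x := by
  obtain ⟨c1, c2⟩ := h.contF h1 h2
  have h3 := c1.sub (c2.const_mul lam)
  refine h3.congr (Eventually.of_forall fun y => ?_)
  simp only [Pi.sub_apply]
  unfold QQ; ring

theorem EF.rhoQQ {R₀ R₁ s p : ℝ} {u : EuclideanSpace ℝ (Fin N) → ℝ}
    (h : EF N R₀ R₁ s p (lam1 p (Om N R₀ R₁ s)) u)
    (hd : HasDerivAt (fun t : ℝ => lam1 p (Om N R₀ R₁ t)) 0 s)
    {k : ℝ} (hk : 0 < k) (hk2 : (R₀ + s) ^ 2 < R₁ ^ 2 - 2 / k) :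
    ∫ x, rho k R₁ x * QQ p (lam1 p (Om N R₀ R₁ s)) u x = 0 := by
  have hR₁ : 0 < R₁ := h.hR₀.trans h.hR
  have h1 := h.shape_id hd hk hk2.le
  set lam := lam1 p (Om N R₀ R₁ s) with hlam
  have hF := rho_mul_integrable hk hR₁ hk2 fun x h1 h2 => (h.contF h1 h2).1
  have hG := rho_mul_integrable hk hR₁ hk2 fun x h1 h2 => (h.contF h1 h2).2
  have hin : ∀ x : EuclideanSpace ℝ (Fin N), x ∉ Om N R₀ R₁ s → rho k R₁ x = 0 := by
    intro x hx
    by_contra h0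
    obtain ⟨a1, a2⟩ := rho_layer hk hR₁ hk2 h0
    exact hx ((mem_Om h.hR₀).2 ⟨a2, far_of_norm h.hN h.hs a1⟩)
  have e1' : ∫ x in Om N R₀ R₁ s, (‖gradient u x‖ ^ p * ⟪gradient (eta k R₁) x, e1 N⟫ -
        p * ⟪gradient u x, e1 N⟫ * ⟪pa p (gradient u x), gradient (eta k R₁) x⟫) =
      -∫ x, rho k R₁ x * (‖gradient u x‖ ^ p * ⟪e1 N, x⟫ -
        p * ⟪e1 N, gradient u x⟫ * ⟪pa p (gradient u x), x⟫) := by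
    rw [← setIntegral_eq_integral_of_forall_compl_eq_zero (s := Om N R₀ R₁ s)
      (f := fun x => rho k R₁ x * (‖gradient u x‖ ^ p * ⟪e1 N, x⟫ -
        p * ⟪e1 N, gradient u x⟫ * ⟪pa p (gradient u x), x⟫))
      (fun x hx => by simp only [hin x hx, zero_mul]), ← integral_neg]
    congr 1; ext x
    rw [eta_grad, real_inner_smul_left, real_inner_smul_right, real_inner_comm (e1 N) x,
      real_inner_comm (e1 N) (gradient u x)]
    unfold rho; ring
  have e2' : ∫ x in Om N R₀ R₁ s, |u x| ^ p * ⟪gradient (eta k R₁) x, e1 N⟫ =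
      -∫ x, rho k R₁ x * (|u x| ^ p * ⟪e1 N, x⟫) := by
    rw [← setIntegral_eq_integral_of_forall_compl_eq_zero (s := Om N R₀ R₁ s)
      (f := fun x => rho k R₁ x * (|u x| ^ p * ⟪e1 N, x⟫))
      (fun x hx => by simp only [hin x hx, zero_mul]), ← integral_neg]
    congr 1; ext x
    rw [eta_grad, real_inner_smul_left, real_inner_comm (e1 N) x]
    unfold rho; ring
  rw [e1', e2'] at h1
  have e3 : (fun x => rho k R₁ x * QQ p lam u x) = fun x =>
      rho k R₁ x * (‖gradient u x‖ ^ p * ⟪e1 N, x⟫ -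
        p * ⟪e1 N, gradient u x⟫ * ⟪pa p (gradient u x), x⟫) -
      lam * (rho k R₁ x * (|u x| ^ p * ⟪e1 N, x⟫)) := by
    ext x; unfold QQ; ring
  rw [e3, integral_sub hF (hG.const_mul lam), integral_const_mul]
  linarith

theorem EF.const_grad {R₀ R₁ s p : ℝ} {u : EuclideanSpace ℝ (Fin N) → ℝ}
    (h : EF N R₀ R₁ s p (lam1 p (Om N R₀ R₁ s)) u)
    (hd : HasDerivAt (fun t : ℝ => lam1 p (Om N R₀ R₁ t)) 0 s) :
    ∃ c : ℝ, 0 ≤ c ∧ ∀ x, ‖x‖ = R₁ → ‖gradient u x‖ = c := by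
  have hR₁ : 0 < R₁ := h.hR₀.trans h.hR
  have hr : R₀ + s < R₁ := by linarith [h.hs']
  have hr0 : 0 ≤ R₀ + s := by linarith [h.hs, h.hR₀]
  apply h.const_of_qq
  set lam := lam1 p (Om N R₀ R₁ s) with hlam
  refine conc (q := fun x => QQ p lam u x + QQ p lam u (-x)) h.hN hr0 hr ?_
    (fun x hx => h.qq_outer_nonneg hx) ?_ (norm_e1 h.hN)
  · intro x h1 h2
    refine (h.contQQ h1 h2).add ?_
    have h3 := h.contQQ (x := -x) (by rwa [norm_neg]) (by rwa [norm_neg])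
    exact ContinuousAt.comp (g := QQ p lam u) (f := fun y => -y) h3 continuousAt_neg
  · intro k hk hk2
    have i1 := rho_mul_integrable hk hR₁ hk2 fun x h1 h2 => h.contQQ h1 h2
    have z1 := h.rhoQQ hd hk hk2
    have e : ∀ x : EuclideanSpace ℝ (Fin N), rho k R₁ (-x) = rho k R₁ x := by
      intro x; unfold rho; rw [norm_neg]
    have i2 := i1.comp_neg
    have z2 := integral_neg_eq_self (fun x => rho k R₁ x * QQ p lam u x) volume
    simp only [e] at i2 z2
    simp only [mul_add]
    rw [integral_add i1 i2, z2, z1, add_zero]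

end PN

section PO
variable {N : ℕ}

theorem near_sphere {ρ0 : ℝ} (hρ0 : 0 < ρ0) {P : EuclideanSpace ℝ (Fin N) → Prop}
    (hP : ∀ x, ‖x‖ = ρ0 → ∀ᶠ y in 𝓝 x, P y) :
    ∃ τ > 0, ∀ x, ρ0 - τ < ‖x‖ → ‖x‖ ≤ ρ0 → P x := by
  have hsub : sphere (0 : EuclideanSpace ℝ (Fin N)) ρ0 ⊆ interior {x | P x} := by
    intro x hx
    rw [mem_sphere_zero_iff_norm] at hx
    rw [mem_interior_iff_mem_nhds]
    exact hP x hx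
  obtain ⟨κ, hκ, h1⟩ := (isCompact_sphere (0 : EuclideanSpace ℝ (Fin N)) ρ0).exists_thickening_subset_open
    isOpen_interior hsub
  refine ⟨min κ ρ0, lt_min hκ hρ0, fun x hx1 hx2 => ?_⟩
  have hx0 : 0 < ‖x‖ := by
    have := min_le_right κ ρ0; linarith
  have h2 : x ∈ thickening κ (sphere (0 : EuclideanSpace ℝ (Fin N)) ρ0) := by
    rw [mem_thickening_iff]
    refine ⟨(ρ0 / ‖x‖) • x, ?_, ?_⟩
    · rw [mem_sphere_zero_iff_norm, norm_smul, Real.norm_eq_abs, abs_of_pos (by positivity)]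
      field_simp
    · rw [dist_eq_norm]
      have : x - (ρ0 / ‖x‖) • x = (1 - ρ0 / ‖x‖) • x := by rw [sub_smul, one_smul]
      rw [this, norm_smul, Real.norm_eq_abs, abs_of_nonpos (by
        rw [sub_nonpos, le_div_iff₀ hx0]; linarith)]
      have : -(1 - ρ0 / ‖x‖) * ‖x‖ = ρ0 - ‖x‖ := by field_simp; ring
      rw [this]
      have := min_le_left κ ρ0; linarith
  have h3 : x ∈ {x | P x} := interior_subset (h1 h2)
  exact h3

theorem EF.HA_sub {R₀ R₁ s p lam : ℝ} {u : EuclideanSpace ℝ (Fin N) → ℝ} (h : EF N R₀ R₁ s p lam u)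
    {x : EuclideanSpace ℝ (Fin N)} (h1 : R₀ + s < ‖x‖) (h2 : ‖x‖ < R₁) : x ∈ Om N R₀ R₁ s :=
  (mem_Om h.hR₀).2 ⟨h2, far_of_norm h.hN h.hs h1⟩

/-- Hopf-type statement on the outer sphere -/
theorem EF.hopf {R₀ R₁ s p lam : ℝ} {u : EuclideanSpace ℝ (Fin N) → ℝ} (h : EF N R₀ R₁ s p lam u)
    (h0 : ∀ x, ‖x‖ = R₁ → gradient u x = 0) : False := by
  have hp := h.hp
  have hR₁ : 0 < R₁ := h.hR₀.trans h.hR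
  have hr : R₀ + s < R₁ := by linarith [h.hs']
  have hr0 : 0 < R₀ + s := by linarith [h.hs, h.hR₀]
  have he := norm_e1 h.hN
  have hsub : HA (e1 N) (R₀ + s) R₁ ⊆ Om N R₀ R₁ s := fun x hx => h.HA_sub hx.2.1 hx.2.2
  have hg : ContinuousOn (gradient u) (HA (e1 N) (R₀ + s) R₁) := fun x hx =>
    (h.contAt hx.2.1 hx.2.2.le).2.continuousWithinAt
  have hz := log_lemma (q := p) (m := 1) (M := 1) (ρ := R₀ + s) (ρ0 := R₁) hp one_pos zero_le_one hR₁
    he (z := u) (Z := fun x => pa p (gradient u x)) (h.cdOm.mono hsub)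
    (fun x hx => (h.pos x (hsub hx)).le) ((continuous_pa hp).comp_continuousOn hg)
    (fun x _ => by rw [one_mul, inner_pa_self hp]) (fun x _ => by rw [one_mul, norm_pa hp])
    (by
      intro η hη
      obtain ⟨τ, hτ, h1⟩ := near_sphere (P := fun x => ‖pa p (gradient u x)‖ < η) hR₁ (by
        intro x hx
        have hc : ContinuousAt (fun x => ‖pa p (gradient u x)‖) x :=
          ((continuous_pa hp).continuousAt.comp (h.contAt (by rw [hx]; exact hr) hx.le).2).norm
        refine hc.eventually_lt_const ?_
        show ‖pa p (gradient u x)‖ < η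
        rw [h0 x hx, norm_pa hp, norm_zero, Real.zero_rpow (by linarith)]
        exact hη)
      exact ⟨τ, hτ, fun x hx hx2 => (h1 x hx2 hx.2.2.le).le⟩)
    (by
      intro η hη
      obtain ⟨τ, hτ, h1⟩ := near_sphere (P := fun x => u x < η) hR₁ (by
        intro x hx
        refine (h.contAt (by rw [hx]; exact hr) hx.le).1.eventually_lt_const ?_
        rw [h.zo x hx]
        exact hη)
      exact ⟨τ, hτ, fun x hx hx2 => (h1 x hx2 hx.2.2.le).le⟩)
    (by
      intro φ hφ hφ0
      have := we_isometry isOpen_Om h.cdOm h.we (LinearIsometryEquiv.refl ℝ _)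
        (D := HA (e1 N) (R₀ + s) R₁) (fun x hx => hsub hx) hφ
      simp only [LinearIsometryEquiv.coe_refl, id] at this
      rw [this]
      refine setIntegral_nonneg (isOpen_HA _ _ _).measurableSet fun x hx => ?_
      exact mul_nonneg (mul_nonneg h.hl (Real.rpow_nonneg (h.pos x (hsub hx)).le _)) (hφ0 x))
  have hn : ‖((R₀ + s + R₁) / 2) • e1 N‖ = (R₀ + s + R₁) / 2 := by
    rw [norm_smul, he, mul_one, Real.norm_eq_abs, abs_of_pos (by linarith)]
  have hmem : ((R₀ + s + R₁) / 2) • e1 N ∈ HA (e1 N) (R₀ + s) R₁ := by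
    refine ⟨?_, ?_, ?_⟩
    · rw [real_inner_smul_right, real_inner_self_eq_norm_sq, he]; norm_num; linarith
    · rw [hn]; linarith
    · rw [hn]; linarith
  exact (h.pos _ (hsub hmem)).ne' (hz _ hmem)

set_option maxHeartbeats 1000000 in
/-- propagation of symmetry inwards -/
theorem EF.step {R₀ R₁ s p lam : ℝ} {u : EuclideanSpace ℝ (Fin N) → ℝ} (h : EF N R₀ R₁ s p lam u)
    {ρ0 B γ : ℝ} (hρ : R₀ + s < ρ0) (hρ' : ρ0 ≤ R₁) (hB : ∀ x, ‖x‖ = ρ0 → u x = B)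
    (hγ : γ ≠ 0) (hgr : ∀ x, ‖x‖ = ρ0 → gradient u x = γ • x) :
    ∃ δ > 0, R₀ + s ≤ ρ0 - δ ∧ ∀ x, ρ0 - δ < ‖x‖ → ‖x‖ < ρ0 → u x = u (‖x‖ • e1 N) := by
  have hp := h.hp
  have hr0 : 0 < R₀ + s := by linarith [h.hs, h.hR₀]
  have hρ0 : 0 < ρ0 := by linarith
  have he := norm_e1 h.hN
  obtain ⟨c, hc⟩ : ∃ c, c = |γ| * ρ0 := ⟨_, rfl⟩
  have hc0 : 0 < c := by rw [hc]; have := abs_pos.2 hγ; positivity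
  obtain ⟨τ, hτ, h1⟩ := near_sphere (P := fun x => c / 2 < ‖gradient u x‖ ∧ ‖gradient u x‖ < 2 * c) hρ0 (by
    intro x hx
    have hcn := (h.contAt (x := x) (by rw [hx]; exact hρ) (by rw [hx]; exact hρ')).2.norm
    have hv : ‖gradient u x‖ = c := by rw [hgr x hx, norm_smul, hx, Real.norm_eq_abs, hc]
    exact (hcn.eventually_const_lt (by simp only [hv]; linarith)).and
      (hcn.eventually_lt_const (by simp only [hv]; linarith)))
  obtain ⟨m, M, hm, hM, hmM⟩ := pa_strong (E := EuclideanSpace ℝ (Fin N)) hp (α := c / 2) (β := 2 * c)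
    (by positivity)
  refine ⟨min τ (ρ0 - (R₀ + s)), lt_min hτ (by linarith), by linarith [min_le_right τ (ρ0 - (R₀ + s))], ?_⟩
  obtain ⟨ρ, hρd⟩ : ∃ ρ, ρ = ρ0 - min τ (ρ0 - (R₀ + s)) := ⟨_, rfl⟩
  rw [← hρd]
  have hρ1 : ρ0 - τ ≤ ρ := by rw [hρd]; linarith [min_le_left τ (ρ0 - (R₀ + s))]
  have hρ2 : R₀ + s ≤ ρ := by rw [hρd]; linarith [min_le_right τ (ρ0 - (R₀ + s))]
  intro x hx1 hx2
  set y := ‖x‖ • e1 N with hy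
  have hx0 : 0 < ‖x‖ := by linarith
  have hny : ‖y‖ = ‖x‖ := by rw [hy, norm_smul, he, mul_one, norm_norm]
  by_cases hxy : y - x = 0
  · rw [sub_eq_zero.1 hxy]
  have hd : 0 < ‖y - x‖ := norm_pos_iff.2 hxy
  set a := ‖y - x‖⁻¹ • (y - x) with ha
  have hn : ‖a‖ = 1 := by rw [ha, norm_smul, norm_inv, norm_norm, inv_mul_cancel₀ hd.ne']
  have hsq : ‖y - x‖ ^ 2 = 2 * ⟪y - x, y⟫ := by
    rw [norm_sub_sq_real, inner_sub_left, real_inner_self_eq_norm_sq, hny, real_inner_comm y x]; ring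
  have hay : 0 < ⟪a, y⟫ := by
    rw [ha, real_inner_smul_left]
    have : 0 < ⟪y - x, y⟫ := by nlinarith [pow_pos hd 2]
    positivity
  have hae : 0 < ⟪a, e1 N⟫ := by
    rw [hy, real_inner_smul_right] at hay
    exact pos_of_mul_pos_right hay hx0.le
  have hσy : rfl_ a y = x := by
    rw [rfl_apply hn]
    have : (2 * ⟪a, y⟫) • a = y - x := by
      rw [ha, real_inner_smul_left, smul_smul]
      have e : 2 * (‖y - x‖⁻¹ * ⟪y - x, y⟫) * ‖y - x‖⁻¹ = 1 := by
        have : 2 * (‖y - x‖⁻¹ * ⟪y - x, y⟫) * ‖y - x‖⁻¹ = (2 * ⟪y - x, y⟫) / ‖y - x‖ ^ 2 := by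
          field_simp
        rw [this, ← hsq]; field_simp
      rw [e, one_smul]
    rw [this]; abel
  set σ := rfl_ a with hσ
  set D := HA a ρ ρ0 with hDdef
  have hD : IsOpen D := isOpen_HA a ρ ρ0
  have hsub : D ⊆ Om N R₀ R₁ s := fun w hw =>
    h.HA_sub (hρ2.trans_lt hw.2.1) (hw.2.2.trans_le hρ')
  have hsub' : ∀ w ∈ D, σ w ∈ Om N R₀ R₁ s := fun w hw =>
    h.HA_sub (by rw [σ.norm_map]; exact (hρ2.trans_lt hw.2.1))
      (by rw [σ.norm_map]; exact (hw.2.2.trans_le hρ'))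
  -- gradient of the reflected function
  have hgσ : ∀ w, R₀ + s < ‖w‖ → ‖w‖ ≤ R₁ →
      HasGradientAt (fun y => u (σ y)) (σ.symm (gradient u (σ w))) w := fun w hw1 hw2 =>
    hga_isometry σ (h.hga (by rwa [σ.norm_map]) (by rwa [σ.norm_map]))
  have hUc : ∀ w, R₀ + s < ‖w‖ → ‖w‖ ≤ R₁ →
      ContinuousAt (fun w => σ.symm (gradient u (σ w))) w := by
    intro w hw1 hw2
    have c1 := (h.contAt (x := σ w) (by rwa [σ.norm_map]) (by rwa [σ.norm_map])).2
    have c2 : ContinuousAt (fun w => gradient u (σ w)) w :=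
      ContinuousAt.comp (g := gradient u) (f := fun w => σ w) c1 σ.continuous.continuousAt
    exact σ.symm.continuous.continuousAt.comp c2
  have hpU : ∀ w, R₀ + s < ‖w‖ → ‖w‖ ≤ R₁ →
      ContinuousAt (fun w => pa p (σ.symm (gradient u (σ w)))) w := fun w h1 h2 =>
    ContinuousAt.comp (g := pa p) (continuous_pa hp).continuousAt (hUc w h1 h2)
  have hpV : ∀ w, R₀ + s < ‖w‖ → ‖w‖ ≤ R₁ →
      ContinuousAt (fun w => pa p (gradient u w)) w := fun w h1 h2 =>
    ContinuousAt.comp (g := pa p) (continuous_pa hp).continuousAt (h.contAt h1 h2).2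
  have huσ : ∀ w, R₀ + s < ‖w‖ → ‖w‖ ≤ R₁ → ContinuousAt (fun w => u (σ w)) w := by
    intro w hw1 hw2
    have c1 := (h.contAt (x := σ w) (by rwa [σ.norm_map]) (by rwa [σ.norm_map])).1
    exact ContinuousAt.comp (g := u) (f := fun w => σ w) c1 σ.continuous.continuousAt
  have hDr : ∀ w ∈ D, R₀ + s < ‖w‖ ∧ ‖w‖ ≤ R₁ := fun w hw =>
    ⟨hρ2.trans_lt hw.2.1, hw.2.2.le.trans hρ'⟩
  have hgz : ∀ w ∈ D, gradient (fun w => u (σ w) - u w) w = σ.symm (gradient u (σ w)) - gradient u w :=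
    fun w hw => (hga_sub (hgσ w (hDr w hw).1 (hDr w hw).2) (h.hga (hDr w hw).1 (hDr w hw).2)).gradient
  have hnm : ∀ w ∈ D, ‖gradient u w‖ ∈ Icc (c / 2) (2 * c) ∧
      ‖σ.symm (gradient u (σ w))‖ ∈ Icc (c / 2) (2 * c) := by
    intro w hw
    have e1 := h1 w (by linarith [hw.2.1]) hw.2.2.le
    have e2 := h1 (σ w) (by rw [σ.norm_map]; linarith [hw.2.1]) (by rw [σ.norm_map]; exact hw.2.2.le)
    rw [LinearIsometryEquiv.norm_map]
    exact ⟨⟨e1.1.le, e1.2.le⟩, ⟨e2.1.le, e2.2.le⟩⟩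
  have hz := log_lemma (q := 2) (m := m) (M := M) (ρ := ρ) (ρ0 := ρ0) one_lt_two hm hM hρ0
    hn (z := fun w => u (σ w) - u w)
    (Z := fun w => pa p (σ.symm (gradient u (σ w))) - pa p (gradient u w))
    (by
      refine ContDiffOn.sub ?_ (h.cdOm.mono hsub)
      exact h.cdOm.comp σ.contDiff.contDiffOn hsub')
    (by
      intro w hw
      have := h.refl_le hn hae (hsub hw) hw.1
      linarith)
    (fun w hw => ((hpU w (hDr w hw).1 (hDr w hw).2).sub
      (hpV w (hDr w hw).1 (hDr w hw).2)).continuousWithinAt)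
    (by
      intro w hw
      rw [hgz w hw, Real.rpow_two]
      exact (hmM _ _ (hnm w hw).2 (hnm w hw).1).1)
    (by
      intro w hw
      rw [hgz w hw, show (2 : ℝ) - 1 = 1 by norm_num, Real.rpow_one]
      exact (hmM _ _ (hnm w hw).2 (hnm w hw).1).2)
    (by
      intro η hη
      obtain ⟨τ, hτ, h1⟩ := near_sphere
        (P := fun w => ‖pa p (σ.symm (gradient u (σ w))) - pa p (gradient u w)‖ < η) hρ0 (by
        intro w hw
        have w1 : R₀ + s < ‖w‖ := by rw [hw]; exact hρ
        have w2 : ‖w‖ ≤ R₁ := by rw [hw]; exact hρ'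
        have hc := ((hpU w w1 w2).sub (hpV w w1 w2)).norm
        refine hc.eventually_lt_const ?_
        show ‖pa p (σ.symm (gradient u (σ w))) - pa p (gradient u w)‖ < η
        rw [hgr w hw, hgr (σ w) (by rw [σ.norm_map, hw]), map_smul, LinearIsometryEquiv.symm_apply_apply,
          sub_self, norm_zero]
        exact hη)
      exact ⟨τ, hτ, fun x hx hx2 => (h1 x hx2 hx.2.2.le).le⟩)
    (by
      intro η hη
      obtain ⟨τ, hτ, h1⟩ := near_sphere (P := fun w => u (σ w) - u w < η) hρ0 (by
        intro w hw
        have w1 : R₀ + s < ‖w‖ := by rw [hw]; exact hρ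
        have w2 : ‖w‖ ≤ R₁ := by rw [hw]; exact hρ'
        have hc := (huσ w w1 w2).sub (h.contAt w1 w2).1
        refine hc.eventually_lt_const ?_
        show u (σ w) - u w < η
        rw [hB w hw, hB (σ w) (by rw [σ.norm_map, hw]), sub_self]
        exact hη)
      exact ⟨τ, hτ, fun x hx hx2 => (h1 x hx2 hx.2.2.le).le⟩)
    (by
      intro φ hφ hφ0
      have t1 := we_isometry isOpen_Om h.cdOm h.we (LinearIsometryEquiv.refl ℝ _)
        (D := D) (fun x hx => hsub hx) hφ
      simp only [LinearIsometryEquiv.coe_refl, id] at t1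
      have t2 := we_isometry isOpen_Om h.cdOm h.we σ (D := D) hsub' hφ
      have t3 : ∫ x in D, ⟪pa p (gradient (fun y => u (σ y)) x), gradient φ x⟫ =
          ∫ x in D, ⟪pa p (σ.symm (gradient u (σ x))), gradient φ x⟫ :=
        setIntegral_congr_fun hD.measurableSet fun w hw => by
          simp only [(hgσ w (hDr w hw).1 (hDr w hw).2).gradient]
      rw [t3] at t2
      have i1 : IntegrableOn (fun x => ⟪pa p (σ.symm (gradient u (σ x))), gradient φ x⟫) D :=
        hφ.inner_integrable hD fun w hw => (hpU w (hDr w hw).1 (hDr w hw).2).continuousWithinAt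
      have i2 : IntegrableOn (fun x => ⟪pa p (gradient u x), gradient φ x⟫) D :=
        hφ.inner_integrable hD fun w hw => (hpV w (hDr w hw).1 (hDr w hw).2).continuousWithinAt
      have i3 : IntegrableOn (fun x => lam * u (σ x) ^ (p - 1) * φ x) D :=
        hφ.mul_integrable hD fun w hw => (continuousAt_const.mul
          ((huσ w (hDr w hw).1 (hDr w hw).2).rpow_const (Or.inr (by linarith)))).continuousWithinAt
      have i4 : IntegrableOn (fun x => lam * u x ^ (p - 1) * φ x) D :=
        hφ.mul_integrable hD fun w hw => (continuousAt_const.mul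
          ((h.contAt (hDr w hw).1 (hDr w hw).2).1.rpow_const (Or.inr (by linarith)))).continuousWithinAt
      simp only [inner_sub_left]
      rw [integral_sub i1 i2, t1, t2, sub_nonneg]
      refine setIntegral_mono_on i4 i3 hD.measurableSet fun w hw => ?_
      have e1 := h.refl_le hn hae (hsub hw) hw.1
      have e2 := Real.rpow_le_rpow (h.pos w (hsub hw)).le e1 (by linarith : 0 ≤ p - 1)
      exact mul_le_mul_of_nonneg_right (mul_le_mul_of_nonneg_left e2 h.hl) (hφ0 w))
  have hfin := hz y ⟨hay, by rw [hny]; exact hx1, by rw [hny]; exact hx2⟩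
  simp only [hσy] at hfin
  linarith

end PO

section PP
variable {N : ℕ}

theorem EF.ray_eq {R₀ R₁ s p lam : ℝ} {u : EuclideanSpace ℝ (Fin N) → ℝ} (h : EF N R₀ R₁ s p lam u)
    {r : ℝ} (hr : R₀ + s ≤ r) (hr' : r < R₁)
    (hG : ∀ x, r < ‖x‖ → ‖x‖ < R₁ → u x = u (‖x‖ • e1 N)) {x : EuclideanSpace ℝ (Fin N)} (hx : ‖x‖ = r) :
    ∀ t, 1 < t → t < R₁ / r → u (t • x) = u (t • r • e1 N) := by
  have hr0 : 0 < r := by linarith [h.hs, h.hR₀]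
  intro t ht1 ht2
  have hn : ‖t • x‖ = t * r := by rw [norm_smul, hx, Real.norm_eq_abs, abs_of_pos (by linarith)]
  rw [lt_div_iff₀ hr0] at ht2
  rw [hG (t • x) (by rw [hn]; nlinarith) (by rw [hn]; exact ht2), hn, smul_smul]

theorem EF.const_sphere {R₀ R₁ s p lam : ℝ} {u : EuclideanSpace ℝ (Fin N) → ℝ} (h : EF N R₀ R₁ s p lam u)
    {r : ℝ} (hr : R₀ + s ≤ r) (hr' : r < R₁)
    (hG : ∀ x, r < ‖x‖ → ‖x‖ < R₁ → u x = u (‖x‖ • e1 N)) {x : EuclideanSpace ℝ (Fin N)} (hx : ‖x‖ = r) :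
    u x = u (r • e1 N) := by
  have hr0 : 0 < r := by linarith [h.hs, h.hR₀]
  have he := norm_e1 h.hN
  have h1 : 1 < R₁ / r := by rwa [lt_div_iff₀ hr0, one_mul]
  obtain ⟨V, hVo, hV, hVc⟩ := h.hV
  have hc : ∀ y : EuclideanSpace ℝ (Fin N), ‖y‖ = r → Tendsto (fun t : ℝ => u (t • y)) (𝓝[>] 1) (𝓝 (u y)) := by
    intro y hy
    have hyV : y ∈ V := by
      refine hV y (by linarith) ?_
      have := norm_sub_norm_le y (s • e1 N)
      rw [norm_smul, he, Real.norm_of_nonneg h.hs.le] at this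
      linarith
    have c1 : ContinuousAt u y := hVc.continuousOn.continuousAt (hVo.mem_nhds hyV)
    have c2 : Tendsto (fun t : ℝ => t • y) (𝓝 1) (𝓝 y) := by
      have : ContinuousAt (fun t : ℝ => t • y) 1 := by fun_prop
      have h2 := this.tendsto
      rwa [one_smul] at h2
    exact (c1.tendsto.comp c2).mono_left nhdsWithin_le_nhds
  have hne : ‖r • e1 N‖ = r := by rw [norm_smul, he, mul_one, Real.norm_eq_abs, abs_of_pos hr0]
  refine tendsto_nhds_unique_of_eventuallyEq (hc x hx) (hc _ hne) ?_
  filter_upwards [Ioo_mem_nhdsGT h1] with t ht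
  exact h.ray_eq hr hr' hG hx t ht.1 ht.2

theorem EF.radial_grad {R₀ R₁ s p lam : ℝ} {u : EuclideanSpace ℝ (Fin N) → ℝ} (h : EF N R₀ R₁ s p lam u)
    {r : ℝ} (hr : R₀ + s < r) (hr' : r < R₁)
    (hG : ∀ x, r < ‖x‖ → ‖x‖ < R₁ → u x = u (‖x‖ • e1 N)) {x : EuclideanSpace ℝ (Fin N)} (hx : ‖x‖ = r) :
    gradient u x = (⟪gradient u (r • e1 N), r • e1 N⟫ / r ^ 2) • x := by
  have hr0 : 0 < r := by linarith [h.hs, h.hR₀]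
  have he := norm_e1 h.hN
  have h1 : 1 < R₁ / r := by rwa [lt_div_iff₀ hr0, one_mul]
  have hne : ‖r • e1 N‖ = r := by rw [norm_smul, he, mul_one, Real.norm_eq_abs, abs_of_pos hr0]
  have g1 := h.hga (x := x) (by rw [hx]; exact hr) (by rw [hx]; exact hr'.le)
  have g2 := h.hga (x := r • e1 N) (by rw [hne]; exact hr) (by rw [hne]; exact hr'.le)
  have ht := tangential (x := x) (by rw [← norm_pos_iff, hx]; exact hr0) g1 (by
    intro y hy
    rw [h.const_sphere hr.le hr' hG (hy.trans hx), h.const_sphere hr.le hr' hG hx])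
  have d1 := (ray_deriv g1).hasDerivWithinAt (s := Ici 1)
  have d2 := (ray_deriv g2).hasDerivWithinAt (s := Ici 1)
  have heq : (fun t : ℝ => u (t • r • e1 N)) =ᶠ[𝓝[Ici 1] 1] fun t : ℝ => u (t • x) := by
    filter_upwards [Ico_mem_nhdsGE h1] with t ht
    rcases eq_or_lt_of_le ht.1 with h2 | h2
    · rw [← h2, one_smul, one_smul]; exact (h.const_sphere hr.le hr' hG hx).symm
    · exact (h.ray_eq hr.le hr' hG hx t h2 ht.2).symm
  have d3 := d1.congr_of_eventuallyEq_of_mem heq (by simp)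
  have := (uniqueDiffWithinAt_Ici (1 : ℝ)).eq_deriv _ d3 d2
  rw [hx, this] at ht
  exact ht

theorem EF.final {R₀ R₁ s p : ℝ} {u : EuclideanSpace ℝ (Fin N) → ℝ}
    (h : EF N R₀ R₁ s p (lam1 p (Om N R₀ R₁ s)) u)
    (hd : HasDerivAt (fun t : ℝ => lam1 p (Om N R₀ R₁ t)) 0 s) :
    ∃ r₁ ∈ Set.Ioo (R₀ + s) R₁, ∃ g : ℝ → ℝ,
      (∀ x : EuclideanSpace ℝ (Fin N), r₁ < ‖x‖ → ‖x‖ < R₁ → u x = g ‖x‖) ∧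
      (∀ x : EuclideanSpace ℝ (Fin N), ‖x‖ = r₁ → gradient u x = 0) := by
  have hR₁ : 0 < R₁ := h.hR₀.trans h.hR
  have hr : R₀ + s < R₁ := by linarith [h.hs']
  have hr0 : 0 < R₀ + s := by linarith [h.hs, h.hR₀]
  have he := norm_e1 h.hN
  set G : Set ℝ := {ρ | R₀ + s ≤ ρ ∧ ρ ≤ R₁ ∧
    ∀ x : EuclideanSpace ℝ (Fin N), ρ < ‖x‖ → ‖x‖ < R₁ → u x = u (‖x‖ • e1 N)} with hGdef
  have hbdd : BddBelow G := ⟨R₀ + s, fun ρ hρ => hρ.1⟩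
  have hne : G.Nonempty := ⟨R₁, hr.le, le_refl _, fun x h1 h2 => absurd h1 (not_lt.2 h2.le)⟩
  obtain ⟨r, hrd⟩ : ∃ r, r = sInf G := ⟨_, rfl⟩
  have hle : ∀ ρ ∈ G, r ≤ ρ := fun ρ hρ => by rw [hrd]; exact csInf_le hbdd hρ
  have hr1 : R₀ + s ≤ r := by rw [hrd]; exact le_csInf hne fun ρ hρ => hρ.1
  have hGood : ∀ x : EuclideanSpace ℝ (Fin N), r < ‖x‖ → ‖x‖ < R₁ → u x = u (‖x‖ • e1 N) := by
    intro x h1 h2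
    rw [hrd] at h1
    obtain ⟨ρ, hρ, h3⟩ := exists_lt_of_csInf_lt hne h1
    exact hρ.2.2 x h3 h2
  -- first step at the outer sphere
  have hr2 : r < R₁ := by
    obtain ⟨c, hc0, hc⟩ := h.const_grad hd
    have hcne : c ≠ 0 := by
      intro h0
      apply h.hopf
      intro x hx
      rw [← norm_eq_zero, hc x hx, h0]
    obtain ⟨δ, hδ, hδ2, hst⟩ := h.step hr le_rfl (B := 0) (γ := -(c / R₁)) h.zo
      (neg_ne_zero.2 (div_ne_zero hcne hR₁.ne')) (fun x hx => by
        have := (h.outer hx).1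
        rwa [hc x hx] at this)
    have := hle (R₁ - δ) ⟨hδ2, by linarith, hst⟩
    linarith
  have hr3 : R₀ + s < r := by
    refine lt_of_le_of_ne hr1 fun heq => ?_
    have hrp : 0 < r := by linarith
    have hne' : ‖-(r • e1 N)‖ = r := by
      rw [norm_neg, norm_smul, he, mul_one, Real.norm_eq_abs, abs_of_pos hrp]
    have e1' := h.const_sphere hr1 hr2 hGood hne'
    have e2 : u (r • e1 N) = 0 := by
      apply h.zi
      rw [← sub_smul, norm_smul, he, mul_one, Real.norm_eq_abs, ← heq, add_sub_cancel_right,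
        abs_of_pos h.hR₀]
    have e3 : -(r • e1 N) ∈ Om N R₀ R₁ s := by
      rw [mem_Om h.hR₀]
      refine ⟨by rw [hne']; exact hr2, ?_⟩
      have : -(r • e1 N) - s • e1 N = (-(r + s)) • e1 N := by rw [neg_smul, add_smul]; abel
      rw [this, norm_smul, he, mul_one, Real.norm_eq_abs, abs_neg, abs_of_pos (by linarith [h.hs])]
      linarith [h.hs]
    have := h.pos _ e3
    rw [e1', e2] at this
    exact lt_irrefl _ this
  refine ⟨r, ⟨hr3, hr2⟩, fun t => u (t • e1 N), hGood, ?_⟩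
  obtain ⟨γ, hγ⟩ : ∃ γ, γ = ⟪gradient u (r • e1 N), r • e1 N⟫ / r ^ 2 := ⟨_, rfl⟩
  have hgr : ∀ x : EuclideanSpace ℝ (Fin N), ‖x‖ = r → gradient u x = γ • x := fun x hx => by
    rw [hγ]; exact h.radial_grad hr3 hr2 hGood hx
  have hγ0 : γ = 0 := by
    by_contra hγne
    obtain ⟨δ, hδ, hδ2, hst⟩ := h.step hr3 hr2.le
      (fun x hx => h.const_sphere hr1 hr2 hGood hx) hγne hgr
    have := hle (r - δ) ⟨hδ2, by linarith, fun x h1 h2 => by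
      rcases lt_trichotomy ‖x‖ r with h3 | h3 | h3
      · exact hst x h1 h3
      · rw [h3]; exact h.const_sphere hr1 hr2 hGood h3
      · exact hGood x h3 h2⟩
    linarith
  intro x hx
  rw [hgr x hx, hγ0, zero_smul]

end PP

theorem stmt12 (N : ℕ) (hN : 2 ≤ N) (R₀ R₁ : ℝ) (hR₀ : 0 < R₀) (hR : R₀ < R₁)
    (p : ℝ) (hp : 1 < p) (s : ℝ) (hs : 0 < s) (hs' : s < R₁ - R₀)
    (u : EuclideanSpace ℝ (Fin N) → ℝ)
    (hu : IsFirstEigenfunction p (Om N R₀ R₁ s) (lam1 p (Om N R₀ R₁ s)) u)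
    (hd : HasDerivAt (fun t : ℝ => lam1 p (Om N R₀ R₁ t)) 0 s) :
    ∃ r₁ ∈ Set.Ioo (R₀ + s) R₁, ∃ g : ℝ → ℝ,
      (∀ x : EuclideanSpace ℝ (Fin N), r₁ < ‖x‖ → ‖x‖ < R₁ → u x = g ‖x‖) ∧
      (∀ x : EuclideanSpace ℝ (Fin N), ‖x‖ = r₁ → gradient u x = 0) := by
  exact (EF.of hN hR₀ hR hp hs hs' hu).final hd
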